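/- arXiv:1005.4987 — 2 statements merged into one kernel-verified Lean document; each statement's English description precedes it below -/
import Mathlib

section
/- The Euclidean tight 6-design of ℝ^22 on two concentric spheres with inner fiber of 275 points is unique up to a similar transformation fixing the origin: if (X,w) and (X',w') are both Euclidean 6-designs in ℝ^22, each supported by exactly two concentric spheres of positive radii centered at the origin, each of total cardinality 2300, and each having 275 points on one of its two spheres, then there exist a positive real number c, an orthogonal linear map O of ℝ^22, and a positive real number λ such that the map T(x) = c·O(x) satisfies T(X) = X' and w'(T(x)) = λ·w(x) for all x ∈ X. -/
open MeasureTheory Metric MvPolynomial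
open scoped RealInnerProductSpace Classical

/-- Average of a polynomial over the sphere of radius `r` centered at the origin in `ℝⁿ`,
with respect to the (rotation-invariant, normalized) surface measure. -/
noncomputable def sphereAvg (n : ℕ) (r : ℝ) (f : MvPolynomial (Fin n) ℝ) : ℝ :=
  ⨍ u : sphere (0 : EuclideanSpace ℝ (Fin n)) 1,
    eval (fun i => r * (u : EuclideanSpace ℝ (Fin n)) i) f
    ∂((volume : Measure (EuclideanSpace ℝ (Fin n))).toSphere)

/-- `(X₁ ∪ X₂, w)` is a Euclidean `t`-design of `ℝ²²` supported by the two concentric spheres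
of radii `r₁` and `r₂` centered at the origin, with fibers `X₁ ⊆ S(0,r₁)` and `X₂ ⊆ S(0,r₂)`. -/
def IsEuclideanDesignTwoSpheres (t : ℕ) (X₁ X₂ : Finset (EuclideanSpace ℝ (Fin 22)))
    (w : EuclideanSpace ℝ (Fin 22) → ℝ) (r₁ r₂ : ℝ) : Prop :=
  ∀ f : MvPolynomial (Fin 22) ℝ, f.totalDegree ≤ t →
    (∑ x ∈ X₁, w x) * sphereAvg 22 r₁ f + (∑ x ∈ X₂, w x) * sphereAvg 22 r₂ f
      = ∑ x ∈ X₁ ∪ X₂, w x * eval (x : Fin 22 → ℝ) f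

/-- The normalized surface measure on the unit sphere of `ℝⁿ`. -/
noncomputable def sphereProb (n : ℕ) : Measure (sphere (0 : EuclideanSpace ℝ (Fin n)) 1) :=
  ((volume : Measure (EuclideanSpace ℝ (Fin n))).toSphere Set.univ)⁻¹ •
    (volume : Measure (EuclideanSpace ℝ (Fin n))).toSphere

/-- The `k`-th moment of the linear functional `⟪a, ·⟫` on the unit sphere. -/
noncomputable def sphereMoment (n k : ℕ) (a : EuclideanSpace ℝ (Fin n)) : ℝ :=
  ∫ u : sphere (0 : EuclideanSpace ℝ (Fin n)) 1,
    ⟪a, (u : EuclideanSpace ℝ (Fin n))⟫ ^ k ∂sphereProb n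

section SphereMoments

variable {n : ℕ}

local notation "E" => EuclideanSpace ℝ (Fin n)

lemma isProbabilityMeasure_sphereProb [NeZero n] : IsProbabilityMeasure (sphereProb n) := by
  unfold sphereProb
  have : Nontrivial E := by
    apply Module.nontrivial_of_finrank_pos (R := ℝ)
    simp [Nat.pos_of_neZero n]
  have : NeZero (volume : Measure E).toSphere := ⟨Measure.toSphere_ne_zero _⟩
  exact isProbabilityMeasureSMul

instance : IsFiniteMeasure (sphereProb n) := by
  rcases Nat.eq_zero_or_pos n with rfl | h
  · have : (volume : Measure (EuclideanSpace ℝ (Fin 0))).toSphere = 0 := by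
      rw [Measure.toSphere_eq_zero_iff]; infer_instance
    unfold sphereProb
    rw [this, smul_zero]; infer_instance
  · have : NeZero n := ⟨h.ne'⟩
    have := isProbabilityMeasure_sphereProb (n := n)
    infer_instance

lemma integrable_sphereProb {f : sphere (0 : E) 1 → ℝ} (hf : Continuous f) :
    Integrable f (sphereProb n) :=
  hf.integrable_of_hasCompactSupport (HasCompactSupport.of_compactSpace f)

/-- The action of a linear isometry on the unit sphere. -/
noncomputable def sphereIsometry (O : E ≃ₗᵢ[ℝ] E) : sphere (0 : E) 1 ≃ₜ sphere (0 : E) 1 where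
  toFun u := ⟨O u, by simp⟩
  invFun u := ⟨O.symm u, by simp⟩
  left_inv u := by simp
  right_inv u := by simp
  continuous_toFun := by fun_prop
  continuous_invFun := by fun_prop

lemma measurePreserving_sphereIsometry (O : E ≃ₗᵢ[ℝ] E) :
    MeasurePreserving (sphereIsometry O) (sphereProb n) (sphereProb n) := by
  have key : MeasurePreserving (sphereIsometry O) (volume : Measure E).toSphere
      (volume : Measure E).toSphere := by
    refine ⟨(sphereIsometry O).continuous.measurable, ?_⟩
    ext s hs
    rw [Measure.map_apply (sphereIsometry O).continuous.measurable hs,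
      Measure.toSphere_apply' _ hs,
      Measure.toSphere_apply' _ ((sphereIsometry O).continuous.measurable hs)]
    congr 1
    conv_rhs =>
      rw [← O.measurePreserving.measure_preimage_equiv (f := O.toHomeomorph.toMeasurableEquiv)]
    congr 1
    ext x
    simp only [Set.mem_smul, Set.mem_image, Set.mem_preimage]
    constructor
    · rintro ⟨r, hr, _, ⟨u, hu, rfl⟩, rfl⟩
      exact ⟨r, hr, _, ⟨_, hu, rfl⟩, by simp [sphereIsometry]⟩
    · rintro ⟨r, hr, _, ⟨u, hu, rfl⟩, hx⟩
      refine ⟨r, hr, _, ⟨(sphereIsometry O).symm u, by simpa using hu, rfl⟩, ?_⟩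
      apply O.injective
      change _ = O x at hx
      rw [← hx]
      simp [sphereIsometry]
  exact ⟨key.measurable, by rw [sphereProb, Measure.map_smul, key.map_eq]⟩

lemma integral_sphereIsometry (O : E ≃ₗᵢ[ℝ] E) (f : sphere (0 : E) 1 → ℝ) :
    ∫ u, f (sphereIsometry O u) ∂sphereProb n = ∫ u, f u ∂sphereProb n :=
  (measurePreserving_sphereIsometry O).integral_comp
    (sphereIsometry O).measurableEmbedding f

lemma sphereMoment_map (O : E ≃ₗᵢ[ℝ] E) (k : ℕ) (a : E) :
    sphereMoment n k (O a) = sphereMoment n k a := by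
  unfold sphereMoment
  rw [← integral_sphereIsometry O]
  simp [sphereIsometry]

lemma sphereMoment_smul (k : ℕ) (r : ℝ) (a : E) :
    sphereMoment n k (r • a) = r ^ k * sphereMoment n k a := by
  unfold sphereMoment
  rw [← integral_const_mul]
  simp [inner_smul_left, mul_pow]

lemma sphereMoment_congr (k : ℕ) {a b : E} (h : ‖a‖ = ‖b‖) :
    sphereMoment n k a = sphereMoment n k b := by
  rw [← sphereMoment_map (Submodule.reflection (ℝ ∙ (a - b))ᗮ) k a, Submodule.reflection_sub h]

lemma sphereMoment_zero [NeZero n] (a : E) : sphereMoment n 0 a = 1 := by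
  have := isProbabilityMeasure_sphereProb (n := n)
  simp [sphereMoment]

lemma sphereMoment_odd {k : ℕ} (hk : Odd k) (a : E) : sphereMoment n k a = 0 := by
  have h := sphereMoment_smul k (-1) a
  rw [sphereMoment_congr k (a := (-1 : ℝ) • a) (b := a) (by simp), hk.neg_one_pow] at h
  linarith

lemma sphereMoment_eq [NeZero n] (k : ℕ) (a : E) :
    sphereMoment n k a = ‖a‖ ^ k * sphereMoment n k (EuclideanSpace.single 0 1) := by
  rw [← sphereMoment_smul]
  exact sphereMoment_congr k (by simp [norm_smul])

lemma sphereMoment_single (k : ℕ) (i : Fin n) :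
    sphereMoment n k (EuclideanSpace.single i 1) =
      ∫ u : sphere (0 : E) 1, (u : E) i ^ k ∂sphereProb n := by
  simp [sphereMoment, EuclideanSpace.inner_single_left]

lemma sphere_sum_sq (u : sphere (0 : E) 1) : ∑ i, (u : E) i ^ 2 = 1 := by
  have h := EuclideanSpace.norm_sq_eq (u : E)
  simpa using h.symm

/-- The mixed moment of two coordinates, obtained from rotation invariance. -/
lemma integral_coord_mixed [NeZero n] {i j : Fin n} (hij : i ≠ j) :
    let m k := sphereMoment n k (EuclideanSpace.single 0 1)
    (∫ u : sphere (0 : E) 1, (u : E) i ^ 2 * (u : E) j ^ 2 ∂sphereProb n = m 4 / 3) ∧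
    (∫ u : sphere (0 : E) 1, (u : E) i ^ 4 * (u : E) j ^ 2 ∂sphereProb n = m 6 / 5) := by
  intro m
  have hI (p q : ℕ) : Integrable (fun u : sphere (0 : E) 1 => (u : E) i ^ p * (u : E) j ^ q)
      (sphereProb n) := integrable_sphereProb (by fun_prop)
  have hnorm (s : ℝ) : ‖(EuclideanSpace.single i 1 + s • EuclideanSpace.single j 1 : E)‖ ^ 2
      = 1 + s ^ 2 := by
    rw [EuclideanSpace.norm_sq_eq, Finset.sum_eq_add i j hij]
    · simp [hij, hij.symm]
    · intro c _ hc; simp [hc.1, hc.2]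
    · simp
    · simp
  have hm (k : ℕ) (s : ℝ) : ∫ u : sphere (0 : E) 1, ((u : E) i + s * (u : E) j) ^ (2 * k)
      ∂sphereProb n = (1 + s ^ 2) ^ k * m (2 * k) := by
    have := sphereMoment_eq (2 * k)
      (EuclideanSpace.single i 1 + s • EuclideanSpace.single j 1 : E)
    rw [pow_mul, hnorm] at this
    rw [← this]
    simp [sphereMoment, inner_add_left, inner_smul_left, EuclideanSpace.inner_single_left]
  have hz (k : ℕ) (a : Fin n) : ∫ u : sphere (0 : E) 1, (u : E) a ^ k ∂sphereProb n = m k := by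
    rw [← sphereMoment_single]
    exact sphereMoment_congr k (by simp)
  constructor
  · have e : (fun u : sphere (0 : E) 1 => ((u : E) i + 1 * (u : E) j) ^ (2 * 2) +
        ((u : E) i + (-1) * (u : E) j) ^ (2 * 2)) =
        fun u : sphere (0 : E) 1 => 2 * (u : E) i ^ 4 + 2 * (u : E) j ^ 4 +
          12 * ((u : E) i ^ 2 * (u : E) j ^ 2) := by
      funext u; ring
    have e2 := congrArg (fun f => ∫ u, f u ∂sphereProb n) e
    simp only at e2
    rw [integral_add (integrable_sphereProb (by fun_prop)) (integrable_sphereProb (by fun_prop)),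
      hm, hm, integral_add (integrable_sphereProb (by fun_prop))
        (integrable_sphereProb (by fun_prop)),
      integral_add (integrable_sphereProb (by fun_prop)) (integrable_sphereProb (by fun_prop)),
      integral_const_mul, integral_const_mul, integral_const_mul, hz, hz] at e2
    norm_num at e2
    linarith
  · have e : (fun u : sphere (0 : E) 1 => (16 * ((u : E) i + 1 * (u : E) j) ^ (2 * 3) +
        16 * ((u : E) i + (-1) * (u : E) j) ^ (2 * 3)) + (-1) *
        ((u : E) i + 2 * (u : E) j) ^ (2 * 3) + (-1) *
        ((u : E) i + (-2) * (u : E) j) ^ (2 * 3)) =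
        fun u : sphere (0 : E) 1 => 30 * (u : E) i ^ 6 + (-96) * (u : E) j ^ 6 +
          360 * ((u : E) i ^ 4 * (u : E) j ^ 2) := by
      funext u; ring
    have e2 := congrArg (fun f => ∫ u, f u ∂sphereProb n) e
    simp only at e2
    rw [integral_add (integrable_sphereProb (by fun_prop)) (integrable_sphereProb (by fun_prop)),
      integral_add (integrable_sphereProb (by fun_prop)) (integrable_sphereProb (by fun_prop)),
      integral_add (integrable_sphereProb (by fun_prop)) (integrable_sphereProb (by fun_prop)),
      integral_const_mul, integral_const_mul, integral_const_mul, integral_const_mul,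
      hm, hm, hm, hm, integral_add (integrable_sphereProb (by fun_prop))
        (integrable_sphereProb (by fun_prop)),
      integral_add (integrable_sphereProb (by fun_prop)) (integrable_sphereProb (by fun_prop)),
      integral_const_mul, integral_const_mul, integral_const_mul, hz, hz] at e2
    norm_num at e2
    linarith

lemma sphereMoment_single_values [NeZero n] :
    let m k := sphereMoment n k (EuclideanSpace.single 0 1)
    n * m 2 = 1 ∧ (n + 2) * m 4 = 3 * m 2 ∧ (n + 4) * m 6 = 5 * m 4 := by
  intro m
  have := isProbabilityMeasure_sphereProb (n := n)
  have hz (k : ℕ) (a : Fin n) : ∫ u : sphere (0 : E) 1, (u : E) a ^ k ∂sphereProb n = m k := by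
    rw [← sphereMoment_single]
    exact sphereMoment_congr k (by simp)
  have hsum (k : ℕ) : m k = ∑ j, ∫ u : sphere (0 : E) 1, (u : E) 0 ^ k * (u : E) j ^ 2
      ∂sphereProb n := by
    rw [← integral_finsetSum _ fun j _ => integrable_sphereProb (by fun_prop), ← hz k 0]
    congr 1
    funext u
    rw [← Finset.mul_sum, sphere_sum_sq, mul_one]
  refine ⟨?_, ?_, ?_⟩
  · have h0 : m 0 = 1 := sphereMoment_zero _
    rw [← h0, hsum 0]
    simp [hz]
  · have h := hsum 2
    rw [← Finset.add_sum_erase _ _ (Finset.mem_univ (0 : Fin n)),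
      Finset.sum_congr rfl fun j hj =>
        (integral_coord_mixed (n := n) (i := 0) (j := j) (Finset.ne_of_mem_erase hj).symm).1] at h
    have e4 : ∫ u : sphere (0 : E) 1, (u : E) 0 ^ 2 * (u : E) 0 ^ 2 ∂sphereProb n = m 4 := by
      simp_rw [← pow_add]; exact hz 4 0
    rw [e4, Finset.sum_const, Finset.card_erase_of_mem (Finset.mem_univ _), Finset.card_univ,
      Fintype.card_fin, nsmul_eq_mul, Nat.cast_sub NeZero.one_le] at h
    push_cast at h
    linear_combination -3 * h
  · have h := hsum 4
    rw [← Finset.add_sum_erase _ _ (Finset.mem_univ (0 : Fin n)),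
      Finset.sum_congr rfl fun j hj =>
        (integral_coord_mixed (n := n) (i := 0) (j := j) (Finset.ne_of_mem_erase hj).symm).2] at h
    have e4 : ∫ u : sphere (0 : E) 1, (u : E) 0 ^ 4 * (u : E) 0 ^ 2 ∂sphereProb n = m 6 := by
      simp_rw [← pow_add]; exact hz 6 0
    rw [e4, Finset.sum_const, Finset.card_erase_of_mem (Finset.mem_univ _), Finset.card_univ,
      Fintype.card_fin, nsmul_eq_mul, Nat.cast_sub NeZero.one_le] at h
    push_cast at h
    linear_combination -5 * h

/-- The even moments of degree at most six. -/
lemma sphereMoment_values [NeZero n] (a : E) :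
    sphereMoment n 2 a = ‖a‖ ^ 2 / n ∧ sphereMoment n 4 a = 3 * ‖a‖ ^ 4 / (n * (n + 2)) ∧
      sphereMoment n 6 a = 15 * ‖a‖ ^ 6 / (n * (n + 2) * (n + 4)) := by
  obtain ⟨h2, h4, h6⟩ := sphereMoment_single_values (n := n)
  have hn : (n : ℝ) ≠ 0 := NeZero.ne _
  have hn2 : (n : ℝ) + 2 ≠ 0 := by positivity
  have hn4 : (n : ℝ) + 4 ≠ 0 := by positivity
  rw [sphereMoment_eq 2, sphereMoment_eq 4, sphereMoment_eq 6]
  refine ⟨?_, ?_, ?_⟩ <;> field_simp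
  · linear_combination ‖a‖ ^ 2 * h2
  · linear_combination ‖a‖ ^ 4 * (n * h4 + 3 * h2)
  · linear_combination ‖a‖ ^ 6 * (n * (n + 2) * h6 + 5 * n * h4 + 15 * h2)

end SphereMoments

section DesignMoments

/-- The linear form `⟪a, ·⟫` as a polynomial. -/
noncomputable def linearFormPoly {n : ℕ} (a : EuclideanSpace ℝ (Fin n)) : MvPolynomial (Fin n) ℝ :=
  ∑ i, C (a i) * X i

/-- The squared norm as a polynomial. -/
noncomputable def normSqPoly (n : ℕ) : MvPolynomial (Fin n) ℝ := ∑ i, X i ^ 2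

variable {n : ℕ}

lemma eval_linearFormPoly (a x : EuclideanSpace ℝ (Fin n)) (r : ℝ) :
    eval (fun i => r * x i) (linearFormPoly a) = r * ⟪a, x⟫ := by
  simp only [linearFormPoly, map_sum, map_mul, eval_C, eval_X, PiLp.inner_apply, Finset.mul_sum,
    RCLike.inner_apply, conj_trivial]
  exact Finset.sum_congr rfl fun i _ => by ring

lemma eval_normSqPoly (x : EuclideanSpace ℝ (Fin n)) (r : ℝ) :
    eval (fun i => r * x i) (normSqPoly n) = r ^ 2 * ‖x‖ ^ 2 := by
  simp [normSqPoly, EuclideanSpace.norm_sq_eq, mul_pow, Finset.mul_sum]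

lemma totalDegree_linearFormPoly_le (a : EuclideanSpace ℝ (Fin n)) :
    (linearFormPoly a).totalDegree ≤ 1 := by
  refine totalDegree_finsetSum_le fun i _ => ?_
  refine (totalDegree_mul _ _).trans ?_
  simp [totalDegree_X]

lemma totalDegree_normSqPoly_le : (normSqPoly n).totalDegree ≤ 2 := by
  refine totalDegree_finsetSum_le fun i _ => ?_
  simp

lemma totalDegree_zonal_le (a : EuclideanSpace ℝ (Fin n)) (k l : ℕ) :
    (linearFormPoly a ^ k * normSqPoly n ^ l).totalDegree ≤ k + 2 * l := by
  refine (totalDegree_mul _ _).trans (add_le_add ?_ ?_)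
  · refine (totalDegree_pow _ _).trans ?_
    have := totalDegree_linearFormPoly_le a
    nlinarith
  · refine (totalDegree_pow _ _).trans ?_
    have := totalDegree_normSqPoly_le (n := n)
    nlinarith

lemma sphereAvg_zonal (a : EuclideanSpace ℝ (Fin n)) (r : ℝ) (k l : ℕ) :
    sphereAvg n r (linearFormPoly a ^ k * normSqPoly n ^ l) =
      r ^ (k + 2 * l) * sphereMoment n k a := by
  unfold sphereAvg sphereMoment
  rw [average, ← sphereProb, ← integral_const_mul]
  congr 1
  funext u
  rw [map_mul, map_pow, map_pow, eval_linearFormPoly, eval_normSqPoly, norm_eq_of_mem_sphere]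
  ring

/-- A weighted pair of finite subsets of the unit sphere which becomes a Euclidean `6`-design
after the two parts are rescaled by `r` and `s`; only zonal test polynomials are recorded. -/
structure IsUnitDesign (A B : Finset (EuclideanSpace ℝ (Fin 22)))
    (w v : EuclideanSpace ℝ (Fin 22) → ℝ) (r s : ℝ) : Prop where
  r_pos : 0 < r
  s_pos : 0 < s
  r_ne_s : r ≠ s
  norm_left : ∀ x ∈ A, ‖x‖ = 1
  norm_right : ∀ x ∈ B, ‖x‖ = 1
  weight_left : ∀ x ∈ A, 0 < w x
  weight_right : ∀ x ∈ B, 0 < v x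
  card_left : A.card = 275
  card_right : B.card = 2025
  moment : ∀ (a : EuclideanSpace ℝ (Fin 22)) (k l : ℕ), k + 2 * l ≤ 6 →
    r ^ (k + 2 * l) * ∑ x ∈ A, w x * ⟪a, x⟫ ^ k + s ^ (k + 2 * l) * ∑ x ∈ B, v x * ⟪a, x⟫ ^ k =
      ((∑ x ∈ A, w x) * r ^ (k + 2 * l) + (∑ x ∈ B, v x) * s ^ (k + 2 * l)) * sphereMoment 22 k a

local notation "E" => EuclideanSpace ℝ (Fin 22)

lemma isUnitDesign_of_design {X₁ X₂ : Finset E} {w : E → ℝ} {r₁ r₂ : ℝ}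
    (hr₁ : 0 < r₁) (hr₂ : 0 < r₂) (hrne : r₁ ≠ r₂)
    (hX₁ : ∀ x ∈ X₁, ‖x‖ = r₁) (hX₂ : ∀ x ∈ X₂, ‖x‖ = r₂)
    (hw : ∀ x ∈ X₁ ∪ X₂, 0 < w x) (hcard : (X₁ ∪ X₂).card = 2300) (h275 : X₁.card = 275)
    (hdesign : IsEuclideanDesignTwoSpheres 6 X₁ X₂ w r₁ r₂) :
    IsUnitDesign (X₁.image (r₁⁻¹ • ·)) (X₂.image (r₂⁻¹ • ·))
      (fun x => w (r₁ • x)) (fun x => w (r₂ • x)) r₁ r₂ := by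
  have hdisj : Disjoint X₁ X₂ := Finset.disjoint_left.2 fun x h1 h2 =>
    hrne ((hX₁ x h1).symm.trans (hX₂ x h2))
  have hinj {r : ℝ} (hr : 0 < r) : Function.Injective (fun x : E => r⁻¹ • x) :=
    smul_right_injective _ (inv_ne_zero hr.ne')
  have hsum {r : ℝ} (hr : 0 < r) (Y : Finset E) (f : E → ℝ) :
      ∑ x ∈ Y.image (r⁻¹ • ·), f x = ∑ x ∈ Y, f (r⁻¹ • x) :=
    Finset.sum_image fun x _ y _ h => hinj hr h
  refine ⟨hr₁, hr₂, hrne, ?_, ?_, ?_, ?_, ?_, ?_, ?_⟩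
  · simp only [Finset.mem_image]
    rintro _ ⟨x, hx, rfl⟩
    rw [norm_smul, hX₁ x hx, norm_inv, Real.norm_of_nonneg hr₁.le, inv_mul_cancel₀ hr₁.ne']
  · simp only [Finset.mem_image]
    rintro _ ⟨x, hx, rfl⟩
    rw [norm_smul, hX₂ x hx, norm_inv, Real.norm_of_nonneg hr₂.le, inv_mul_cancel₀ hr₂.ne']
  · simp only [Finset.mem_image]
    rintro _ ⟨x, hx, rfl⟩
    rw [smul_inv_smul₀ hr₁.ne']
    exact hw x (Finset.mem_union_left _ hx)
  · simp only [Finset.mem_image]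
    rintro _ ⟨x, hx, rfl⟩
    rw [smul_inv_smul₀ hr₂.ne']
    exact hw x (Finset.mem_union_right _ hx)
  · rw [Finset.card_image_of_injective _ (hinj hr₁), h275]
  · rw [Finset.card_image_of_injective _ (hinj hr₂)]
    rw [Finset.card_union_of_disjoint hdisj] at hcard
    omega
  · intro a k l hkl
    have h := hdesign _ ((totalDegree_zonal_le a k l).trans hkl)
    rw [sphereAvg_zonal, sphereAvg_zonal, Finset.sum_union hdisj] at h
    have hev (x : E) : eval (x : Fin 22 → ℝ) (linearFormPoly a ^ k * normSqPoly 22 ^ l) =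
        ⟪a, x⟫ ^ k * (‖x‖ ^ 2) ^ l := by
      have h1 := eval_linearFormPoly a x 1
      have h2 := eval_normSqPoly x 1
      simp only [one_mul, one_pow] at h1 h2
      rw [map_mul, map_pow, map_pow, h1, h2]
    have hpart {r : ℝ} (hr : 0 < r) (Y : Finset E) (hY : ∀ x ∈ Y, ‖x‖ = r) :
        r ^ (k + 2 * l) * ∑ x ∈ Y, w (r • r⁻¹ • x) * ⟪a, r⁻¹ • x⟫ ^ k =
        ∑ x ∈ Y, w x * eval (x : Fin 22 → ℝ) (linearFormPoly a ^ k * normSqPoly 22 ^ l) := by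
      rw [Finset.mul_sum]
      refine Finset.sum_congr rfl fun x hx => ?_
      rw [smul_inv_smul₀ hr.ne', inner_smul_right, hev, hY x hx, mul_pow, inv_pow]
      have := hr.ne'
      field_simp
      ring
    rw [hsum hr₁, hsum hr₂, hsum hr₁, hsum hr₂, hpart hr₁ X₁ hX₁, hpart hr₂ X₂ hX₂, ← h]
    simp only [smul_inv_smul₀ hr₁.ne', smul_inv_smul₀ hr₂.ne']
    ring

namespace IsUnitDesign

variable {A B : Finset E} {w v : E → ℝ} {r s : ℝ}

lemma split_moment (h : IsUnitDesign A B w v r s) (a : E) (k : ℕ) (hk : k ≤ 4) :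
    ∑ x ∈ A, w x * ⟪a, x⟫ ^ k = (∑ x ∈ A, w x) * sphereMoment 22 k a ∧
    ∑ x ∈ B, v x * ⟪a, x⟫ ^ k = (∑ x ∈ B, v x) * sphereMoment 22 k a := by
  have h0 := h.moment a k 0 (by omega)
  have h1 := h.moment a k 1 (by omega)
  have hr := h.r_pos
  have hs := h.s_pos
  have hrs : s ^ 2 - r ^ 2 ≠ 0 := by
    intro h'
    exact h.r_ne_s ((sq_eq_sq₀ hr.le hs.le).1 (by linarith))
  simp only [mul_zero, add_zero, mul_one, pow_add] at h0 h1
  have hrk := (pow_pos hr k).ne'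
  have hsk := (pow_pos hs k).ne'
  constructor
  · refine sub_eq_zero.1 ((mul_eq_zero.1 (?_ : (r ^ k * (s ^ 2 - r ^ 2)) * _ = 0)).resolve_left
      (mul_ne_zero hrk hrs))
    linear_combination s ^ 2 * h0 - h1
  · refine sub_eq_zero.1 ((mul_eq_zero.1 (?_ : (s ^ k * (s ^ 2 - r ^ 2)) * _ = 0)).resolve_left
      (mul_ne_zero hsk hrs))
    linear_combination h1 - r ^ 2 * h0

end IsUnitDesign

end DesignMoments

section TightDesign

local notation "E" => EuclideanSpace ℝ (Fin 22)

namespace IsUnitDesign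

variable {A B : Finset E} {w v : E → ℝ} {r s : ℝ}

/-- The moments of the first fiber in a given direction, up to degree four. -/
lemma moments_left (h : IsUnitDesign A B w v r s) (a : E) :
    (∑ x ∈ A, w x * ⟪a, x⟫ = 0) ∧ (∑ x ∈ A, w x * ⟪a, x⟫ ^ 2 = (∑ x ∈ A, w x) * (‖a‖ ^ 2 / 22)) ∧
    (∑ x ∈ A, w x * ⟪a, x⟫ ^ 3 = 0) ∧
    (∑ x ∈ A, w x * ⟪a, x⟫ ^ 4 = (∑ x ∈ A, w x) * (‖a‖ ^ 4 / 176)) := by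
  obtain ⟨h2, h4, -⟩ := sphereMoment_values (n := 22) a
  have e1 := (h.split_moment a 1 (by norm_num)).1
  have e2 := (h.split_moment a 2 (by norm_num)).1
  have e3 := (h.split_moment a 3 (by norm_num)).1
  have e4 := (h.split_moment a 4 (by norm_num)).1
  rw [sphereMoment_odd (by decide)] at e1 e3
  simp only [pow_one, mul_zero] at e1 e3
  rw [h2] at e2
  rw [h4] at e4
  refine ⟨e1, by rw [e2]; norm_num, e3, by rw [e4]; push_cast; ring⟩

lemma moments_right (h : IsUnitDesign A B w v r s) (a : E) :
    (∑ x ∈ B, v x * ⟪a, x⟫ = 0) ∧ (∑ x ∈ B, v x * ⟪a, x⟫ ^ 2 = (∑ x ∈ B, v x) * (‖a‖ ^ 2 / 22)) ∧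
    (∑ x ∈ B, v x * ⟪a, x⟫ ^ 3 = 0) ∧
    (∑ x ∈ B, v x * ⟪a, x⟫ ^ 4 = (∑ x ∈ B, v x) * (‖a‖ ^ 4 / 176)) := by
  obtain ⟨h2, h4, -⟩ := sphereMoment_values (n := 22) a
  have e1 := (h.split_moment a 1 (by norm_num)).2
  have e2 := (h.split_moment a 2 (by norm_num)).2
  have e3 := (h.split_moment a 3 (by norm_num)).2
  have e4 := (h.split_moment a 4 (by norm_num)).2
  rw [sphereMoment_odd (by decide)] at e1 e3
  simp only [pow_one, mul_zero] at e1 e3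
  rw [h2] at e2
  rw [h4] at e4
  refine ⟨e1, by rw [e2]; norm_num, e3, by rw [e4]; push_cast; ring⟩

lemma moments_high (h : IsUnitDesign A B w v r s) (a : E) :
    (r ^ 5 * ∑ x ∈ A, w x * ⟪a, x⟫ ^ 5 + s ^ 5 * ∑ x ∈ B, v x * ⟪a, x⟫ ^ 5 = 0) ∧
    (r ^ 6 * ∑ x ∈ A, w x * ⟪a, x⟫ ^ 6 + s ^ 6 * ∑ x ∈ B, v x * ⟪a, x⟫ ^ 6 =
      ((∑ x ∈ A, w x) * r ^ 6 + (∑ x ∈ B, v x) * s ^ 6) * (5 * ‖a‖ ^ 6 / 4576)) := by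
  obtain ⟨-, -, h6⟩ := sphereMoment_values (n := 22) a
  have e5 := h.moment a 5 0 (by norm_num)
  have e6 := h.moment a 6 0 (by norm_num)
  rw [sphereMoment_odd (by decide)] at e5
  simp only [mul_zero, add_zero] at e5 e6
  rw [h6] at e6
  exact ⟨e5, by rw [e6]; push_cast; ring⟩

end IsUnitDesign

lemma sum_mul_sq_cubic (A : Finset E) (w : E → ℝ) (a : E) (c₀ c₁ c₂ c₃ : ℝ) :
    ∑ x ∈ A, w x * (c₀ + c₁ * ⟪a, x⟫ + c₂ * ⟪a, x⟫ ^ 2 + c₃ * ⟪a, x⟫ ^ 3) ^ 2 =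
      c₀ ^ 2 * ∑ x ∈ A, w x + (2 * c₀ * c₁) * ∑ x ∈ A, w x * ⟪a, x⟫ +
      (c₁ ^ 2 + 2 * c₀ * c₂) * ∑ x ∈ A, w x * ⟪a, x⟫ ^ 2 +
      (2 * c₀ * c₃ + 2 * c₁ * c₂) * ∑ x ∈ A, w x * ⟪a, x⟫ ^ 3 +
      (c₂ ^ 2 + 2 * c₁ * c₃) * ∑ x ∈ A, w x * ⟪a, x⟫ ^ 4 +
      (2 * c₂ * c₃) * ∑ x ∈ A, w x * ⟪a, x⟫ ^ 5 + c₃ ^ 2 * ∑ x ∈ A, w x * ⟪a, x⟫ ^ 6 := by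
  simp only [Finset.mul_sum, ← Finset.sum_add_distrib]
  exact Finset.sum_congr rfl fun x _ => by ring

/-- If a nonnegative weighted sum of squares containing the term `w a * t ^ 2` equals `t`,
then `w a * t ≤ 1`, and equality kills all the other terms. -/
lemma le_one_of_sum_sq_eq {A : Finset E} {w f : E → ℝ} {a : E} {t R : ℝ} (ha : a ∈ A)
    (hw : ∀ x ∈ A, 0 < w x) (hR : 0 ≤ R) (ht : 0 < t) (hfa : f a = t)
    (hsum : ∑ x ∈ A, w x * f x ^ 2 + R = t) :
    w a * t ≤ 1 ∧ (w a * t = 1 → R = 0 ∧ ∀ x ∈ A, x ≠ a → f x = 0) := by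
  have hnn : ∀ x ∈ A.erase a, 0 ≤ w x * f x ^ 2 := fun x hx =>
    mul_nonneg (hw x (Finset.mem_of_mem_erase hx)).le (sq_nonneg _)
  have h0 := Finset.sum_nonneg hnn
  rw [← Finset.add_sum_erase _ _ ha, hfa] at hsum
  constructor
  · by_contra! hlt
    nlinarith
  · intro h1
    have h2 : w a * t ^ 2 = t := by rw [sq, ← mul_assoc, h1, one_mul]
    have h3 : ∑ x ∈ A.erase a, w x * f x ^ 2 = 0 := by linarith
    refine ⟨by linarith, fun x hx hxa => ?_⟩
    have h4 := (Finset.sum_eq_zero_iff_of_nonneg hnn).1 h3 x (Finset.mem_erase.2 ⟨hxa, hx⟩)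
    simpa [(hw x hx).ne'] using h4

namespace IsUnitDesign

variable {A B : Finset E} {w v : E → ℝ} {r s : ℝ}

lemma weight_sum_left_pos (h : IsUnitDesign A B w v r s) : 0 < ∑ x ∈ A, w x :=
  Finset.sum_pos h.weight_left (Finset.card_pos.1 (by rw [h.card_left]; norm_num))

lemma weight_sum_right_pos (h : IsUnitDesign A B w v r s) : 0 < ∑ x ∈ B, v x :=
  Finset.sum_pos h.weight_right (Finset.card_pos.1 (by rw [h.card_right]; norm_num))

/-- The first fiber is a tight spherical `4`-design. -/
lemma left_tight (h : IsUnitDesign A B w v r s) :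
    (∀ x ∈ A, w x = (∑ y ∈ A, w y) / 275) ∧
    (∀ x ∈ A, ∀ y ∈ A, x ≠ y → ⟪x, y⟫ = 1 / 6 ∨ ⟪x, y⟫ = -1 / 4) := by
  set W := ∑ y ∈ A, w y with hW
  have hWpos : 0 < W := h.weight_sum_left_pos
  set α : ℝ := W⁻¹ with hα
  have hαW : α * W = 1 := inv_mul_cancel₀ hWpos.ne'
  have hαpos : 0 < α := inv_pos.2 hWpos
  have key (a : E) (ha : a ∈ A) := le_one_of_sum_sq_eq (w := w) (R := 0) (t := 275 * α)
    (f := fun x => -11 * α + 22 * α * ⟪a, x⟫ + 264 * α * ⟪a, x⟫ ^ 2 + 0 * ⟪a, x⟫ ^ 3) ha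
    h.weight_left le_rfl (by positivity)
    (by rw [real_inner_self_eq_norm_sq, h.norm_left a ha]; ring) (by
      obtain ⟨e1, e2, e3, e4⟩ := h.moments_left a
      rw [h.norm_left a ha] at e2 e4
      rw [sum_mul_sq_cubic, e1, e2, e3, e4, ← hW]
      linear_combination 275 * α * hαW)
  have hle : ∀ a ∈ A, w a * (275 * α) ≤ 1 := fun a ha => (key a ha).1
  have heq : ∀ a ∈ A, w a * (275 * α) = 1 := by
    refine (Finset.sum_eq_sum_iff_of_le hle).1 ?_
    rw [← Finset.sum_mul, ← hW, Finset.sum_const, h.card_left, nsmul_eq_mul]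
    push_cast
    linear_combination 275 * hαW
  refine ⟨fun x hx => ?_, fun x hx y hy hxy => ?_⟩
  · have := heq x hx
    rw [eq_div_iff (by norm_num)]
    linear_combination W * this - 275 * w x * hαW
  · have h0 := ((key x hx).2 (heq x hx)).2 y hy (Ne.symm hxy)
    have h1 : (6 * ⟪x, y⟫ - 1) * (4 * ⟪x, y⟫ + 1) = 0 := by
      refine (mul_eq_zero.1 (?_ : (11 * α) * _ = 0)).resolve_left (by positivity)
      linear_combination h0
    rcases mul_eq_zero.1 h1 with h2 | h2
    · left; linarith
    · right; linarith

/-- The reproducing kernel of the space of cubic polynomials vanishes off the diagonal. -/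
lemma kernel_zero (h : IsUnitDesign A B w v r s) :
    let W := ∑ x ∈ A, w x
    let V := ∑ x ∈ B, v x
    let q₂ := 264 / (W * r ^ 4 + V * s ^ 4)
    let q₃ := 2288 / (W * r ^ 6 + V * s ^ 6)
    (23 + W * q₂ * r ^ 4 * (21 / 22) + W * q₃ * r ^ 6 * (7 / 8) = 275) ∧
    (∀ x ∈ B, v x = V / 2025) ∧
    (∀ x ∈ A, ∀ y ∈ B, q₂ * (⟪x, y⟫ ^ 2 - 1 / 22) +
      q₃ * r * s * (⟪x, y⟫ ^ 3 - ⟪x, y⟫ / 8) = 0) ∧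
    (∀ x ∈ B, ∀ y ∈ B, x ≠ y → (1 + 22 * ⟪x, y⟫) + V * q₂ * s ^ 4 * (⟪x, y⟫ ^ 2 - 1 / 22) +
      V * q₃ * s ^ 6 * (⟪x, y⟫ ^ 3 - ⟪x, y⟫ / 8) = 0) := by
  intro W V q₂ q₃
  have hr := h.r_pos
  have hs := h.s_pos
  have hWpos : 0 < W := h.weight_sum_left_pos
  have hVpos : 0 < V := h.weight_sum_right_pos
  have hA2 : 0 < W * r ^ 4 + V * s ^ 4 := by positivity
  have hA3 : 0 < W * r ^ 6 + V * s ^ 6 := by positivity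
  have hq2 : 0 < q₂ := by positivity
  have hq3 : 0 < q₃ := by positivity
  have hq2' : q₂ * (W * r ^ 4 + V * s ^ 4) = 264 := div_mul_cancel₀ _ hA2.ne'
  have hq3' : q₃ * (W * r ^ 6 + V * s ^ 6) = 2288 := div_mul_cancel₀ _ hA3.ne'
  set α : ℝ := W⁻¹ with hα
  have hαW : α * W = 1 := inv_mul_cancel₀ hWpos.ne'
  have hαpos : 0 < α := inv_pos.2 hWpos
  set β : ℝ := V⁻¹ with hβ
  have hβV : β * V = 1 := inv_mul_cancel₀ hVpos.ne'
  have hβpos : 0 < β := inv_pos.2 hVpos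
  set c := q₂ * r ^ 2 * s ^ 2 with hc
  set d := q₃ * r ^ 3 * s ^ 3 with hd
  set t₁ := 23 * α + q₂ * r ^ 4 * (21 / 22) + q₃ * r ^ 6 * (7 / 8) with ht1
  set t₂ := 23 * β + q₂ * s ^ 4 * (21 / 22) + q₃ * s ^ 6 * (7 / 8) with ht2
  have nonneg (Y : Finset E) (u f : E → ℝ) (hu : ∀ x ∈ Y, 0 < u x) :
      0 ≤ ∑ x ∈ Y, u x * f x ^ 2 :=
    Finset.sum_nonneg fun x hx => mul_nonneg (hu x hx).le (sq_nonneg _)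
  have keyA (a : E) (ha : a ∈ A) := le_one_of_sum_sq_eq (w := w) (t := t₁)
    (R := ∑ x ∈ B, v x * (-c / 22 + (-d / 8) * ⟪a, x⟫ + c * ⟪a, x⟫ ^ 2 + d * ⟪a, x⟫ ^ 3) ^ 2)
    (f := fun x => (α - q₂ * r ^ 4 / 22) + (22 * α - q₃ * r ^ 6 / 8) * ⟪a, x⟫ +
      q₂ * r ^ 4 * ⟪a, x⟫ ^ 2 + q₃ * r ^ 6 * ⟪a, x⟫ ^ 3) ha
    h.weight_left (nonneg _ _ _ h.weight_right) (by positivity)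
    (by rw [real_inner_self_eq_norm_sq, h.norm_left a ha]; ring) (by
      obtain ⟨e1, e2, e3, e4⟩ := h.moments_left a
      obtain ⟨f1, f2, f3, f4⟩ := h.moments_right a
      obtain ⟨g5, g6⟩ := h.moments_high a
      rw [h.norm_left a ha] at e2 e4 f2 f4 g6
      rw [sum_mul_sq_cubic, sum_mul_sq_cubic, e1, e2, e3, e4, f1, f2, f3, f4]
      change _ * W + _ + _ * (W * _) + _ + _ * (W * _) + _ + _ +
        (_ * V + _ + _ * (V * _) + _ + _ * (V * _) + _ + _) = _
      change _ = (W * _ + V * _) * _ at g6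
      linear_combination 2 * q₂ * q₃ * r ^ 5 * g5 + q₃ ^ 2 * r ^ 6 * g6 + 23 * α * hαW +
        (7 / 1936) * q₂ * r ^ 4 * hq2' + (7 / 18304) * q₃ * r ^ 6 * hq3')
  have keyB (a : E) (ha : a ∈ B) := le_one_of_sum_sq_eq (w := v) (t := t₂)
    (R := ∑ x ∈ A, w x * (-c / 22 + (-d / 8) * ⟪a, x⟫ + c * ⟪a, x⟫ ^ 2 + d * ⟪a, x⟫ ^ 3) ^ 2)
    (f := fun x => (β - q₂ * s ^ 4 / 22) + (22 * β - q₃ * s ^ 6 / 8) * ⟪a, x⟫ +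
      q₂ * s ^ 4 * ⟪a, x⟫ ^ 2 + q₃ * s ^ 6 * ⟪a, x⟫ ^ 3) ha
    h.weight_right (nonneg _ _ _ h.weight_left) (by positivity)
    (by rw [real_inner_self_eq_norm_sq, h.norm_right a ha]; ring) (by
      obtain ⟨e1, e2, e3, e4⟩ := h.moments_left a
      obtain ⟨f1, f2, f3, f4⟩ := h.moments_right a
      obtain ⟨g5, g6⟩ := h.moments_high a
      rw [h.norm_right a ha] at e2 e4 f2 f4 g6
      rw [sum_mul_sq_cubic, sum_mul_sq_cubic, e1, e2, e3, e4, f1, f2, f3, f4]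
      change _ * V + _ + _ * (V * _) + _ + _ * (V * _) + _ + _ +
        (_ * W + _ + _ * (W * _) + _ + _ * (W * _) + _ + _) = _
      change _ = (W * _ + V * _) * _ at g6
      linear_combination 2 * q₂ * q₃ * s ^ 5 * g5 + q₃ ^ 2 * s ^ 6 * g6 + 23 * β * hβV +
        (7 / 1936) * q₂ * s ^ 4 * hq2' + (7 / 18304) * q₃ * s ^ 6 * hq3')
  have hleA : ∑ a ∈ A, w a * t₁ ≤ ∑ a ∈ A, 1 := Finset.sum_le_sum fun a ha => (keyA a ha).1
  have hleB : ∑ a ∈ B, v a * t₂ ≤ ∑ a ∈ B, 1 := Finset.sum_le_sum fun a ha => (keyB a ha).1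
  have hcA : ∑ a ∈ A, (1 : ℝ) = 275 := by simp [h.card_left]
  have hcB : ∑ a ∈ B, (1 : ℝ) = 2025 := by simp [h.card_right]
  have hsA : ∑ a ∈ A, w a * t₁ = W * t₁ := (Finset.sum_mul _ _ _).symm
  have hsB : ∑ a ∈ B, v a * t₂ = V * t₂ := (Finset.sum_mul _ _ _).symm
  have htot : W * t₁ + V * t₂ = 2300 := by
    linear_combination 23 * hαW + 23 * hβV + (21 / 22) * hq2' + (7 / 8) * hq3'
  have hWt : W * t₁ = 275 := by linarith
  have hVt : V * t₂ = 2025 := by linarith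
  have heqA : ∀ a ∈ A, w a * t₁ = 1 :=
    (Finset.sum_eq_sum_iff_of_le fun a ha => (keyA a ha).1).1 (by rw [hcA, hsA, hWt])
  have heqB : ∀ a ∈ B, v a * t₂ = 1 :=
    (Finset.sum_eq_sum_iff_of_le fun a ha => (keyB a ha).1).1 (by rw [hcB, hsB, hVt])
  refine ⟨by linear_combination hWt - 23 * hαW, fun x hx => ?_, fun x hx y hy => ?_,
    fun x hx y hy hxy => ?_⟩
  · rw [eq_div_iff (by norm_num)]
    linear_combination V * heqB x hx - v x * hVt
  · have h0 := ((keyA x hx).2 (heqA x hx)).1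
    rw [Finset.sum_eq_zero_iff_of_nonneg fun z hz =>
      mul_nonneg (h.weight_right z hz).le (sq_nonneg _)] at h0
    have h1 := h0 y hy
    simp only [mul_eq_zero, (h.weight_right y hy).ne', false_or, ne_eq, OfNat.ofNat_ne_zero,
      not_false_eq_true, pow_eq_zero_iff] at h1
    refine (mul_eq_zero.1 (?_ : (r ^ 2 * s ^ 2) * _ = 0)).resolve_left (by positivity)
    linear_combination h1
  · have h0 := ((keyB x hx).2 (heqB x hx)).2 y hy (Ne.symm hxy)
    linear_combination V * h0 - (1 + 22 * ⟪x, y⟫) * hβV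

end IsUnitDesign

end TightDesign

section CrossValues

local notation "E" => EuclideanSpace ℝ (Fin 22)

/-- If `m` attains at least nine of the twenty-five units, then it attains exactly sixteen. -/
lemma multiplicity_arith_of_nine_le {m₁ m₂ m₃ : ℕ} {σ₁ σ₂ σ₃ s : ℝ}
    (h₁ : m₁ * (σ₁ ^ 2 + 175) = 2800) (h₂ : m₂ * (σ₂ ^ 2 + 175) = 2800)
    (h₃ : m₃ * (σ₃ ^ 2 + 175) = 2800) (hm : m₁ + m₂ + m₃ = 25) (hσ : -1 ≤ σ₃)
    (hs : σ₁ + σ₂ + σ₃ = s) (hc : σ₃ ^ 3 - 175 * σ₃ + 2450 = s * (σ₃ - 7) ^ 2) (h9 : 9 ≤ m₃) :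
    s = 50 := by
  have le16 {m : ℕ} {σ : ℝ} (h : m * (σ ^ 2 + 175) = 2800) : m ≤ 16 := by
    by_contra! hlt
    have : (17 : ℝ) ≤ m := by exact_mod_cast hlt
    nlinarith [sq_nonneg σ]
  have pos {m : ℕ} {σ : ℝ} (h : m * (σ ^ 2 + 175) = 2800) : 1 ≤ m := by
    rw [Nat.one_le_iff_ne_zero]
    rintro rfl
    norm_num at h
  have bound {m : ℕ} {σ : ℝ} (k : ℕ) (b : ℝ) (hb : 0 < b) (hk : k * (b ^ 2 + 175) ≥ 2800)
      (h : m * (σ ^ 2 + 175) = 2800) (hkm : k ≤ m) : σ ≤ b := by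
    have : (k : ℝ) ≤ m := by exact_mod_cast hkm
    refine abs_le_of_sq_le_sq' ?_ hb.le |>.2
    by_contra! hlt
    have hk0 : (0 : ℝ) < k := by
      rcases Nat.eq_zero_or_pos k with rfl | h0
      · norm_num at hk
      · exact_mod_cast h0
    nlinarith [sq_nonneg σ, sq_nonneg b]
  rcases (le16 h₃).lt_or_eq with h15 | rfl
  · exfalso
    have hm3 : (m₃ : ℝ) ≤ 15 := by exact_mod_cast Nat.lt_succ_iff.1 h15
    have hu : σ₃ ≤ 11.7 := bound 9 11.7 (by norm_num) (by norm_num) h₃ h9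
    have hl : 3.4 ≤ σ₃ := by
      by_contra! hlt
      have : σ₃ ^ 2 < 11.56 := by nlinarith
      nlinarith
    have hs90 : 90 < s := by
      by_contra! hle
      have h1 : s * (σ₃ - 7) ^ 2 ≤ 90 * (σ₃ - 7) ^ 2 :=
        mul_le_mul_of_nonneg_right hle (sq_nonneg _)
      nlinarith [mul_nonneg (sub_nonneg.2 hl) (sub_nonneg.2 hu),
        mul_nonneg (mul_nonneg (sub_nonneg.2 hl) (sub_nonneg.2 hl)) (sub_nonneg.2 hu)]
    have b1 := bound 1 52 (by norm_num) (by norm_num) h₁ (pos h₁)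
    have b2 := bound 1 52 (by norm_num) (by norm_num) h₂ (pos h₂)
    rcases (pos h₁).lt_or_eq with h1 | h1
    · have b1' := bound 2 35 (by norm_num) (by norm_num) h₁ h1
      rcases (pos h₂).lt_or_eq with h2 | h2
      · have b2' := bound 2 35 (by norm_num) (by norm_num) h₂ h2
        linarith
      · have b1'' := bound 9 11.7 (by norm_num) (by norm_num) h₁ (by omega)
        linarith
    · have b2'' := bound 9 11.7 (by norm_num) (by norm_num) h₂ (by omega)
      linarith
  · have h0 : σ₃ = 0 := by
      refine pow_eq_zero_iff (n := 2) (by norm_num) |>.1 ?_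
      push_cast at h₃
      linarith
    rw [h0] at hc
    linarith

lemma multiplicity_arith {m₁ m₂ m₃ : ℕ} {θ₁ θ₂ θ₃ a : ℝ}
    (h₁ : m₁ * (1 + 22 * θ₁ ^ 2 + 1936 / 7 * (θ₁ ^ 2 - 1 / 22) ^ 2) = 25)
    (h₂ : m₂ * (1 + 22 * θ₂ ^ 2 + 1936 / 7 * (θ₂ ^ 2 - 1 / 22) ^ 2) = 25)
    (h₃ : m₃ * (1 + 22 * θ₃ ^ 2 + 1936 / 7 * (θ₃ ^ 2 - 1 / 22) ^ 2) = 25)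
    (hm : m₁ + m₂ + m₃ = 25) (e₁ : θ₁ + θ₂ + θ₃ = -a)
    (e₂ : θ₁ * θ₂ + θ₁ * θ₃ + θ₂ * θ₃ = -1 / 8)
    (hroot : ∀ θ, θ = θ₁ ∨ θ = θ₂ ∨ θ = θ₃ → θ ^ 3 + a * θ ^ 2 - θ / 8 - a / 22 = 0) :
    176 * a ^ 2 = 9 := by
  have g₁ : m₁ * ((176 * θ₁ ^ 2 - 1) ^ 2 + 175) = 2800 := by linear_combination 112 * h₁
  have g₂ : m₂ * ((176 * θ₂ ^ 2 - 1) ^ 2 + 175) = 2800 := by linear_combination 112 * h₂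
  have g₃ : m₃ * ((176 * θ₃ ^ 2 - 1) ^ 2 + 175) = 2800 := by linear_combination 112 * h₃
  have hs : (176 * θ₁ ^ 2 - 1) + (176 * θ₂ ^ 2 - 1) + (176 * θ₃ ^ 2 - 1) =
      176 * a ^ 2 + 41 := by
    linear_combination 176 * (θ₁ + θ₂ + θ₃ - a) * e₁ - 352 * e₂
  have hneg (θ : ℝ) : -1 ≤ 176 * θ ^ 2 - 1 := by nlinarith [sq_nonneg θ]
  have hc (θ : ℝ) (h : θ = θ₁ ∨ θ = θ₂ ∨ θ = θ₃) :
      (176 * θ ^ 2 - 1) ^ 3 - 175 * (176 * θ ^ 2 - 1) + 2450 =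
        (176 * a ^ 2 + 41) * ((176 * θ ^ 2 - 1) - 7) ^ 2 := by
    have := hroot θ h
    linear_combination 176 ^ 3 * ((θ ^ 3 - θ / 8) - (a * θ ^ 2 - a / 22)) * this
  have : 176 * a ^ 2 + 41 = 50 := by
    rcases (by omega : 9 ≤ m₁ ∨ 9 ≤ m₂ ∨ 9 ≤ m₃) with h9 | h9 | h9
    · exact multiplicity_arith_of_nine_le g₂ g₃ g₁ (by omega) (hneg _) (by linarith)
        (hc _ (by simp)) h9
    · exact multiplicity_arith_of_nine_le g₁ g₃ g₂ (by omega) (hneg _) (by linarith)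
        (hc _ (by simp)) h9
    · exact multiplicity_arith_of_nine_le g₁ g₂ g₃ (by omega) (hneg _) (by linarith)
        (hc _ (by simp)) h9
  linarith

/-- The quadratic kernel vanishes at two distinct roots of the cross polynomial. -/
lemma quadratic_kernel_zero {x y z a : ℝ} (e₁ : x + y + z = -a)
    (e₂ : x * y + x * z + y * z = -1 / 8) (e₃ : x * y * z = a / 22) :
    1 + 22 * (x * y) + 1936 / 7 * (x ^ 2 - 1 / 22) * (y ^ 2 - 1 / 22) = 0 := by
  linear_combination (1936 / 7) * ((x * y + 1 / 22) * e₂ - (x + y) * (e₃ + (1 / 22) * e₁))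

lemma vieta_of_distinct_roots {x y z a : ℝ} (hxy : x ≠ y) (hxz : x ≠ z) (hyz : y ≠ z)
    (hx : x ^ 3 + a * x ^ 2 - x / 8 - a / 22 = 0) (hy : y ^ 3 + a * y ^ 2 - y / 8 - a / 22 = 0)
    (hz : z ^ 3 + a * z ^ 2 - z / 8 - a / 22 = 0) :
    x + y + z = -a ∧ x * y + x * z + y * z = -1 / 8 ∧ x * y * z = a / 22 := by
  have h1 : x ^ 2 + x * y + y ^ 2 + a * (x + y) - 1 / 8 = 0 :=
    (mul_eq_zero.1 (by linear_combination hx - hy : (x - y) * _ = 0)).resolve_left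
      (sub_ne_zero.2 hxy)
  have h2 : x ^ 2 + x * z + z ^ 2 + a * (x + z) - 1 / 8 = 0 :=
    (mul_eq_zero.1 (by linear_combination hx - hz : (x - z) * _ = 0)).resolve_left
      (sub_ne_zero.2 hxz)
  have h3 : x + y + z + a = 0 :=
    (mul_eq_zero.1 (by linear_combination h1 - h2 : (y - z) * _ = 0)).resolve_left
      (sub_ne_zero.2 hyz)
  have e₂ : x * y + x * z + y * z = -1 / 8 := by linear_combination (x + y) * h3 - h1
  exact ⟨by linarith, e₂, by linear_combination hx - x ^ 2 * h3 + x * e₂⟩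

/-- The first four directional moments of `Y` agree with those of the unit sphere. -/
def HasSphereMoments (Y : Finset E) : Prop :=
  ∀ a : E, (∑ x ∈ Y, ⟪a, x⟫ = 0) ∧ (∑ x ∈ Y, ⟪a, x⟫ ^ 2 = Y.card * (‖a‖ ^ 2 / 22)) ∧
    (∑ x ∈ Y, ⟪a, x⟫ ^ 3 = 0) ∧ (∑ x ∈ Y, ⟪a, x⟫ ^ 4 = Y.card * (‖a‖ ^ 4 / 176))

namespace HasSphereMoments

variable {Y : Finset E}

lemma sum_quartic (h : HasSphereMoments Y) {a : E} (ha : ‖a‖ = 1) (c₀ c₁ c₂ c₃ c₄ : ℝ) :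
    ∑ x ∈ Y, (c₀ + c₁ * ⟪a, x⟫ + c₂ * ⟪a, x⟫ ^ 2 + c₃ * ⟪a, x⟫ ^ 3 + c₄ * ⟪a, x⟫ ^ 4) =
      Y.card * (c₀ + c₂ / 22 + c₄ / 176) := by
  obtain ⟨e1, e2, e3, e4⟩ := h a
  rw [ha] at e2 e4
  simp only [Finset.sum_add_distrib, ← Finset.mul_sum, e1, e2, e3, e4, Finset.sum_const,
    nsmul_eq_mul]
  ring

lemma exists_mul_sub_ne_zero (h : HasSphereMoments Y) (hY : Y.Nonempty) {a : E} (ha : ‖a‖ = 1)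
    (p q : ℝ) : ∃ x ∈ Y, ⟪a, x⟫ ≠ p ∧ ⟪a, x⟫ ≠ q := by
  by_contra! hcon
  have h0 : ∑ x ∈ Y, ((p * q) ^ 2 + (-2 * (p * q) * (p + q)) * ⟪a, x⟫ +
      ((p + q) ^ 2 + 2 * (p * q)) * ⟪a, x⟫ ^ 2 + (-2 * (p + q)) * ⟪a, x⟫ ^ 3 +
      1 * ⟪a, x⟫ ^ 4) = 0 := by
    refine Finset.sum_eq_zero fun x hx => ?_
    have : (⟪a, x⟫ - p) * (⟪a, x⟫ - q) = 0 := by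
      by_cases hp : ⟪a, x⟫ = p
      · rw [hp, sub_self, zero_mul]
      · rw [hcon x hx hp, sub_self, mul_zero]
    linear_combination ((⟪a, x⟫ - p) * (⟪a, x⟫ - q)) * this
  rw [h.sum_quartic ha] at h0
  have hc : (0 : ℝ) < Y.card := by exact_mod_cast Finset.card_pos.2 hY
  have := (mul_eq_zero.1 h0).resolve_left hc.ne'
  nlinarith [sq_nonneg (p * q + 1 / 22), sq_nonneg (p + q)]

/-- The multiplicity of an inner product value, computed with the quadratic kernel. -/
lemma card_filter_mul (h : HasSphereMoments Y) {a : E} (ha : ‖a‖ = 1) {θ : ℝ}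
    (hθ : ∀ x ∈ Y, ⟪a, x⟫ ≠ θ →
      1 + 22 * (θ * ⟪a, x⟫) + 1936 / 7 * (θ ^ 2 - 1 / 22) * (⟪a, x⟫ ^ 2 - 1 / 22) = 0) :
    (Y.filter fun x => ⟪a, x⟫ = θ).card *
      (1 + 22 * θ ^ 2 + 1936 / 7 * (θ ^ 2 - 1 / 22) ^ 2) = Y.card := by
  have h0 := h.sum_quartic ha (1 - 1936 / 7 * (θ ^ 2 - 1 / 22) / 22) (22 * θ)
    (1936 / 7 * (θ ^ 2 - 1 / 22)) 0 0
  rw [← Finset.sum_filter_add_sum_filter_not Y (fun x => ⟪a, x⟫ = θ),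
    Finset.sum_eq_zero (s := Y.filter fun x => ¬ _), Finset.sum_congr rfl
      (g := fun _ => 1 + 22 * θ ^ 2 + 1936 / 7 * (θ ^ 2 - 1 / 22) ^ 2),
    Finset.sum_const, nsmul_eq_mul, add_zero] at h0
  · rw [h0]
    ring
  · intro x hx
    rw [(Finset.mem_filter.1 hx).2]
    ring
  · intro x hx
    rw [Finset.mem_filter] at hx
    linear_combination hθ x hx.1 hx.2

end HasSphereMoments

/-- The inner products between the two fibers are governed by a single explicit cubic. -/
lemma cross_coefficient {A B : Finset E} {a : ℝ} (hA : HasSphereMoments A)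
    (hB : HasSphereMoments B) (hA1 : ∀ x ∈ A, ‖x‖ = 1) (hB1 : ∀ x ∈ B, ‖x‖ = 1)
    (hcA : A.card = 275) (hcB : B.card = 2025)
    (hcub : ∀ x ∈ A, ∀ y ∈ B, ⟪x, y⟫ ^ 3 + a * ⟪x, y⟫ ^ 2 - ⟪x, y⟫ / 8 - a / 22 = 0) :
    176 * a ^ 2 = 9 := by
  have hAne : A.Nonempty := Finset.card_pos.1 (by omega)
  obtain ⟨v, hv⟩ : B.Nonempty := Finset.card_pos.1 (by omega)
  obtain ⟨u₁, hu₁, -⟩ := hA.exists_mul_sub_ne_zero hAne (hB1 v hv) 0 0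
  obtain ⟨u₂, hu₂, h12, -⟩ := hA.exists_mul_sub_ne_zero hAne (hB1 v hv) ⟪v, u₁⟫ ⟪v, u₁⟫
  obtain ⟨u₃, hu₃, h13, h23⟩ := hA.exists_mul_sub_ne_zero hAne (hB1 v hv) ⟪v, u₁⟫ ⟪v, u₂⟫
  have hcub' : ∀ y ∈ B, ∀ x ∈ A, ⟪y, x⟫ ^ 3 + a * ⟪y, x⟫ ^ 2 - ⟪y, x⟫ / 8 - a / 22 = 0 := by
    intro y hy x hx
    rw [real_inner_comm]
    exact hcub x hx y hy
  set θ : Fin 3 → ℝ := ![⟪v, u₁⟫, ⟪v, u₂⟫, ⟪v, u₃⟫] with hθ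
  obtain ⟨e₁, e₂, e₃⟩ := vieta_of_distinct_roots h12.symm h13.symm h23.symm (hcub' v hv u₁ hu₁)
    (hcub' v hv u₂ hu₂) (hcub' v hv u₃ hu₃)
  have hmem {c : ℝ} (hc : c ^ 3 + a * c ^ 2 - c / 8 - a / 22 = 0) : ∃ i, c = θ i := by
    have : (c - ⟪v, u₁⟫) * ((c - ⟪v, u₂⟫) * (c - ⟪v, u₃⟫)) = 0 := by
      linear_combination hc - c ^ 2 * e₁ + c * e₂ - e₃
    simp only [mul_eq_zero, sub_eq_zero] at this
    rcases this with h | h | h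
    exacts [⟨0, h⟩, ⟨1, h⟩, ⟨2, h⟩]
  have hinj : Function.Injective θ := by
    intro i j hij
    fin_cases i <;> fin_cases j <;> simp_all [θ, eq_comm]
  have hker (i j : Fin 3) (hij : i ≠ j) :
      1 + 22 * (θ i * θ j) + 1936 / 7 * (θ i ^ 2 - 1 / 22) * (θ j ^ 2 - 1 / 22) = 0 := by
    have q12 := quadratic_kernel_zero e₁ e₂ e₃
    have q13 := quadratic_kernel_zero (x := ⟪v, u₁⟫) (y := ⟪v, u₃⟫) (z := ⟪v, u₂⟫) (a := a)
      (by linarith) (by linarith) (by linarith)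
    have q23 := quadratic_kernel_zero (x := ⟪v, u₂⟫) (y := ⟪v, u₃⟫) (z := ⟪v, u₁⟫) (a := a)
      (by linarith) (by linarith) (by linarith)
    fin_cases i <;> fin_cases j <;> simp [θ] at hij ⊢ <;> linarith
  have hmul (i : Fin 3) : ∃ m : ℕ, (A.filter fun x => ⟪v, x⟫ = θ i).card = 11 * m ∧
      m * (1 + 22 * θ i ^ 2 + 1936 / 7 * (θ i ^ 2 - 1 / 22) ^ 2) = 25 := by
    have n1 := hA.card_filter_mul (hB1 v hv) (θ := θ i) (by
      intro x hx hne
      obtain ⟨j, hj⟩ := hmem (hcub' v hv x hx)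
      rw [hj] at hne ⊢
      exact hker i j fun h => hne (h ▸ rfl))
    have n2 := hB.card_filter_mul (hA1 u₁ hu₁) (θ := θ i) (by
      intro x hx hne
      obtain ⟨j, hj⟩ := hmem (hcub u₁ hu₁ x hx)
      rw [hj] at hne ⊢
      exact hker i j fun h => hne (h ▸ rfl))
    rw [hcA] at n1
    rw [hcB] at n2
    set n := (A.filter fun x => ⟪v, x⟫ = θ i).card
    set n' := (B.filter fun x => ⟪u₁, x⟫ = θ i).card
    set κ := 1 + 22 * θ i ^ 2 + 1936 / 7 * (θ i ^ 2 - 1 / 22) ^ 2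
    have hκ : 0 < κ := by positivity
    have hnn : (81 * n : ℝ) = 11 * n' := by
      refine mul_right_cancel₀ hκ.ne' ?_
      push_cast at n1 n2
      linear_combination 81 * n1 - 11 * n2
    have hnn' : 81 * n = 11 * n' := by exact_mod_cast hnn
    obtain ⟨m, hm⟩ : 11 ∣ n := (by norm_num : Nat.Coprime 11 81).dvd_of_dvd_mul_left ⟨n', hnn'⟩
    refine ⟨m, hm, ?_⟩
    rw [hm] at n1
    push_cast at n1
    linarith
  choose m hm hmκ using hmul
  refine multiplicity_arith (hmκ 0) (hmκ 1) (hmκ 2) ?_ e₁ e₂ ?_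
  · have hsum : ∑ i, (A.filter fun x => ⟪v, x⟫ = θ i).card = A.card := by
      rw [← Finset.card_biUnion]
      · congr 1
        ext x
        simp only [Finset.mem_biUnion, Finset.mem_univ, true_and, Finset.mem_filter]
        exact ⟨fun ⟨_, h⟩ => h.1, fun hx => (hmem (hcub' v hv x hx)).imp fun i hi => ⟨hx, hi⟩⟩
      · intro i _ j _ hij
        refine Finset.disjoint_left.2 fun x hi hj => hij (hinj ?_)
        rw [← (Finset.mem_filter.1 hi).2, ← (Finset.mem_filter.1 hj).2]
    simp only [Fin.sum_univ_three, hm, hcA] at hsum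
    omega
  · rintro c (rfl | rfl | rfl)
    exacts [hcub' v hv u₁ hu₁, hcub' v hv u₂ hu₂, hcub' v hv u₃ hu₃]

end CrossValues

section Lifting

local notation "E" => EuclideanSpace ℝ (Fin 22)

/-- The two fibers, rescaled so that the products `⟪x, y⟫ + h h' / 15` are integers, where the
height `h` is `3` on the first fiber and `1` on the second one. -/
structure IsLifted (A B : Finset (EuclideanSpace ℝ (Fin 22))) : Prop where
  card_left : A.card = 275
  card_right : B.card = 2025
  self_left : ∀ x ∈ A, ⟪x, x⟫ = 12 / 5
  self_right : ∀ x ∈ B, ⟪x, x⟫ = 44 / 15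
  left_left : ∀ x ∈ A, ∀ y ∈ A, x ≠ y → ⟪x, y⟫ = -3 / 5 ∨ ⟪x, y⟫ = 2 / 5
  left_right : ∀ x ∈ A, ∀ y ∈ B, ⟪x, y⟫ = -1 / 5 ∨ ⟪x, y⟫ = 4 / 5 ∨ ⟪x, y⟫ = -6 / 5
  right_right : ∀ x ∈ B, ∀ y ∈ B, x ≠ y →
    ⟪x, y⟫ = -1 / 15 ∨ ⟪x, y⟫ = 14 / 15 ∨ ⟪x, y⟫ = -16 / 15
  moments_left : ∀ a : EuclideanSpace ℝ (Fin 22), (∑ x ∈ A, ⟪a, x⟫ = 0) ∧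
    (∑ x ∈ A, ⟪a, x⟫ ^ 2 = 30 * ⟪a, a⟫) ∧ (∑ x ∈ A, ⟪a, x⟫ ^ 3 = 0) ∧
    (∑ x ∈ A, ⟪a, x⟫ ^ 4 = 9 * ⟪a, a⟫ ^ 2)
  moments_right : ∀ a : EuclideanSpace ℝ (Fin 22), (∑ x ∈ B, ⟪a, x⟫ = 0) ∧
    (∑ x ∈ B, ⟪a, x⟫ ^ 2 = 270 * ⟪a, a⟫) ∧ (∑ x ∈ B, ⟪a, x⟫ ^ 3 = 0) ∧
    (∑ x ∈ B, ⟪a, x⟫ ^ 4 = 99 * ⟪a, a⟫ ^ 2)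

lemma hasSphereMoments_of_const_weight {Y : Finset E} {w : E → ℝ} {M : ℝ} (hM : 0 < M)
    (hY : 0 < Y.card) (hw : ∀ x ∈ Y, w x = M / Y.card)
    (h : ∀ a : E, (∑ x ∈ Y, w x * ⟪a, x⟫ = 0) ∧ (∑ x ∈ Y, w x * ⟪a, x⟫ ^ 2 = M * (‖a‖ ^ 2 / 22)) ∧
      (∑ x ∈ Y, w x * ⟪a, x⟫ ^ 3 = 0) ∧ (∑ x ∈ Y, w x * ⟪a, x⟫ ^ 4 = M * (‖a‖ ^ 4 / 176))) :
    HasSphereMoments Y := by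
  have hc : (0 : ℝ) < Y.card := by exact_mod_cast hY
  have key (f : E → ℝ) (t : ℝ) (hf : ∑ x ∈ Y, w x * f x = M * t) :
      ∑ x ∈ Y, f x = Y.card * t := by
    rw [Finset.sum_congr rfl fun x hx => by rw [hw x hx], ← Finset.mul_sum] at hf
    refine mul_left_cancel₀ hM.ne' ?_
    field_simp at hf
    rw [hf]
  intro a
  obtain ⟨e1, e2, e3, e4⟩ := h a
  refine ⟨?_, key _ _ e2, ?_, key _ _ e4⟩
  · simpa using key _ 0 (by rw [e1, mul_zero])
  · simpa using key _ 0 (by rw [e3, mul_zero])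

namespace HasSphereMoments

lemma sum_smul_image {Y : Finset E} (h : HasSphereMoments Y) {ρ : ℝ} (hρ : ρ ≠ 0) (a : E) :
    (∑ x ∈ Y.image (ρ • ·), ⟪a, x⟫ = 0) ∧
    (∑ x ∈ Y.image (ρ • ·), ⟪a, x⟫ ^ 2 = Y.card * ρ ^ 2 / 22 * ⟪a, a⟫) ∧
    (∑ x ∈ Y.image (ρ • ·), ⟪a, x⟫ ^ 3 = 0) ∧
    (∑ x ∈ Y.image (ρ • ·), ⟪a, x⟫ ^ 4 = Y.card * (ρ ^ 2) ^ 2 / 176 * ⟪a, a⟫ ^ 2) := by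
  have hsum (f : E → ℝ) : ∑ x ∈ Y.image (ρ • ·), f x = ∑ x ∈ Y, f (ρ • x) :=
    Finset.sum_image fun x _ y _ hxy => smul_right_injective _ hρ hxy
  obtain ⟨e1, e2, e3, e4⟩ := h a
  simp only [hsum, inner_smul_right, mul_pow, ← Finset.mul_sum, e1, e2, e3, e4,
    real_inner_self_eq_norm_sq]
  refine ⟨mul_zero _, ?_, mul_zero _, ?_⟩ <;> ring

end HasSphereMoments

namespace IsUnitDesign

variable {A B : Finset E} {w v : E → ℝ} {r s : ℝ}

lemma hasSphereMoments_left (h : IsUnitDesign A B w v r s) : HasSphereMoments A :=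
  hasSphereMoments_of_const_weight h.weight_sum_left_pos (by rw [h.card_left]; norm_num)
    (by rw [h.card_left]; exact_mod_cast h.left_tight.1) h.moments_left

lemma hasSphereMoments_right (h : IsUnitDesign A B w v r s) : HasSphereMoments B :=
  hasSphereMoments_of_const_weight h.weight_sum_right_pos (by rw [h.card_right]; norm_num)
    (by rw [h.card_right]; exact_mod_cast h.kernel_zero.2.1) h.moments_right

/-- The ratio of the radii, the total weights and the remaining inner products are determined. -/
lemma parameters (h : IsUnitDesign A B w v r s) :
    s = √11 * r ∧ ∑ x ∈ B, v x = (∑ x ∈ A, w x) / 99 ∧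
    (∀ x ∈ A, ∀ y ∈ B,
      (4 * √11 * ⟪x, y⟫ + 1) * ((4 * √11 * ⟪x, y⟫ - 4) * (4 * √11 * ⟪x, y⟫ + 6)) = 0) ∧
    (∀ x ∈ B, ∀ y ∈ B, x ≠ y →
      (44 * ⟪x, y⟫ + 1) * ((44 * ⟪x, y⟫ - 14) * (44 * ⟪x, y⟫ + 16)) = 0) := by
  obtain ⟨k1, -, k3, k4⟩ := h.kernel_zero
  have hr := h.r_pos
  have hs := h.s_pos
  have hWpos := h.weight_sum_left_pos
  have hVpos := h.weight_sum_right_pos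
  have hA := h.hasSphereMoments_left
  have hB := h.hasSphereMoments_right
  set W := ∑ x ∈ A, w x
  set V := ∑ x ∈ B, v x
  set A₂ := W * r ^ 4 + V * s ^ 4 with hA2
  set A₃ := W * r ^ 6 + V * s ^ 6 with hA3
  have hA2pos : 0 < A₂ := by positivity
  have hA3pos : 0 < A₃ := by positivity
  set q₂ := 264 / A₂
  set q₃ := 2288 / A₃
  have hq2 : 0 < q₂ := by positivity
  have hq3 : 0 < q₃ := by positivity
  have hq2' : q₂ * A₂ = 264 := div_mul_cancel₀ _ hA2pos.ne'
  have hq3' : q₃ * A₃ = 2288 := div_mul_cancel₀ _ hA3pos.ne'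
  have h11 : √11 ^ 2 = (11 : ℝ) := Real.sq_sqrt (by norm_num)
  have h11pos : (0 : ℝ) < √11 := Real.sqrt_pos.2 (by norm_num)
  set ρ : ℝ := √11
  set a := q₂ / (q₃ * r * s) with ha
  have hapos : 0 < a := by positivity
  have ha' : a * (q₃ * r * s) = q₂ := div_mul_cancel₀ _ (by positivity)
  have hcub : ∀ x ∈ A, ∀ y ∈ B, ⟪x, y⟫ ^ 3 + a * ⟪x, y⟫ ^ 2 - ⟪x, y⟫ / 8 - a / 22 = 0 := by
    intro x hx y hy
    refine (mul_eq_zero.1 (?_ : (q₃ * r * s) * _ = 0)).resolve_left (by positivity)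
    linear_combination k3 x hx y hy + (⟪x, y⟫ ^ 2 - 1 / 22) * ha'
  have ha9 := cross_coefficient hA hB h.norm_left h.norm_right h.card_left h.card_right hcub
  have haρ : 4 * ρ * a = 3 := by
    have : (4 * ρ * a - 3) * (4 * ρ * a + 3) = 0 := by
      linear_combination ha9 + 16 * a ^ 2 * h11
    rcases mul_eq_zero.1 this with h1 | h1
    · linarith
    · have : 0 < 4 * ρ * a := by positivity
      linarith
  have r1 : 2 * ρ * A₃ = 13 * r * s * A₂ := by
    have : 4 * ρ * q₂ = 3 * (q₃ * r * s) := by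
      linear_combination (q₃ * r * s) * haρ - 4 * ρ * ha'
    linear_combination (1 / 528) * A₂ * A₃ * this - (4 / 528) * ρ * A₃ * hq2' +
      (3 / 528) * r * s * A₂ * hq3'
  have r2 : 18 * (V * s ^ 4) * A₃ = 143 * (W * r ^ 6) * A₂ := by
    linear_combination (-1 / 14) * A₂ * A₃ * k1 + (1 / 14) * (W * r ^ 4 * (21 / 22)) * A₃ * hq2' +
      (1 / 14) * (W * r ^ 6 * (7 / 8)) * A₂ * hq3' - 18 * A₃ * hA2
  have r3 : 9 * (V * s ^ 5) = 11 * ρ * (W * r ^ 5) := by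
    refine mul_left_cancel₀ (show 26 * r * A₂ ≠ 0 by positivity) ?_
    linear_combination 2 * ρ * r2 - 18 * (V * s ^ 4) * r1
  have r4 : s = ρ * r := by
    refine mul_left_cancel₀ (show 125 * (W * r ^ 5) ≠ 0 by positivity) ?_
    rw [hA2, hA3] at r1
    linear_combination 9 * r1 - (2 * ρ * s - 13 * r) * r3 - 22 * s * W * r ^ 5 * h11
  have r5 : V = W / 99 := by
    refine mul_left_cancel₀ (show 9 * 121 * (ρ * r ^ 5) ≠ 0 by positivity) ?_
    rw [r4] at r3
    linear_combination r3 - 9 * V * ρ * r ^ 5 * (ρ ^ 2 + 11) * h11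
  refine ⟨r4, r5, fun x hx y hy => ?_, fun x hx y hy hxy => ?_⟩
  · have := hcub x hx y hy
    linear_combination 64 * ρ ^ 3 * this - 16 * ρ ^ 2 * (⟪x, y⟫ ^ 2 - 1 / 22) * haρ +
      (8 * ρ * ⟪x, y⟫ + 24 / 11) * h11
  · have hs2 : s ^ 2 = 11 * r ^ 2 := by rw [r4]; linear_combination r ^ 2 * h11
    have f2 : V * q₂ * s ^ 4 = 726 / 5 := by
      have hA2' : A₂ = W * r ^ 4 * (20 / 9) := by
        rw [hA2, r5]; linear_combination W / 99 * (s ^ 2 + 11 * r ^ 2) * hs2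
      rw [hA2'] at hq2'
      rw [r5]
      linear_combination (11 / 20) * hq2' + W / 99 * q₂ * (s ^ 2 + 11 * r ^ 2) * hs2
    have f3 : V * q₃ * s ^ 6 = 10648 / 5 := by
      have hA3' : A₃ = W * r ^ 6 * (130 / 9) := by
        rw [hA3, r5]
        linear_combination W / 99 * (s ^ 4 + 11 * r ^ 2 * s ^ 2 + 121 * r ^ 4) * hs2
      rw [hA3'] at hq3'
      rw [r5]
      linear_combination (121 / 130) * hq3' +
        W / 99 * q₃ * (s ^ 4 + 11 * r ^ 2 * s ^ 2 + 121 * r ^ 4) * hs2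
    have := k4 x hx y hy hxy
    rw [f2, f3] at this
    linear_combination 40 * this

/-- Up to scaling of the fibers, a unit design is a lifted one. -/
lemma isLifted (h : IsUnitDesign A B w v r s) :
    IsLifted (A.image (√(12 / 5) • ·)) (B.image ((√11 * √(12 / 5) / 3) • ·)) := by
  obtain ⟨-, -, hAB, hBB⟩ := h.parameters
  have h11 : √11 ^ 2 = (11 : ℝ) := Real.sq_sqrt (by norm_num)
  have h11pos : (0 : ℝ) < √11 := Real.sqrt_pos.2 (by norm_num)
  have hσ2 : √(12 / 5) ^ 2 = (12 / 5 : ℝ) := Real.sq_sqrt (by norm_num)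
  have hσpos : (0 : ℝ) < √(12 / 5) := Real.sqrt_pos.2 (by norm_num)
  set ρ : ℝ := √11
  set σ : ℝ := √(12 / 5)
  clear_value ρ σ
  have hτ : (ρ * σ / 3) ^ 2 = 44 / 15 := by
    linear_combination (σ ^ 2 / 9) * h11 + (11 / 9) * hσ2
  have hτpos : 0 < ρ * σ / 3 := by positivity
  have iA := smul_right_injective E hσpos.ne'
  have iB := smul_right_injective E hτpos.ne'
  constructor
  · rw [Finset.card_image_of_injective _ iA, h.card_left]
  · rw [Finset.card_image_of_injective _ iB, h.card_right]
  · simp only [Finset.forall_mem_image, inner_smul_left, inner_smul_right]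
    intro x hx
    rw [real_inner_self_eq_norm_sq, h.norm_left x hx]
    simp only [conj_trivial]
    linear_combination hσ2
  · simp only [Finset.forall_mem_image, inner_smul_left, inner_smul_right]
    intro x hx
    rw [real_inner_self_eq_norm_sq, h.norm_right x hx]
    simp only [conj_trivial]
    linear_combination hτ
  · simp only [Finset.forall_mem_image, inner_smul_left, inner_smul_right, conj_trivial]
    intro x hx y hy hne
    rw [← mul_assoc, ← sq, hσ2]
    rcases h.left_tight.2 x hx y hy fun e => hne (e ▸ rfl) with e | e <;> rw [e] <;> norm_num
  · simp only [Finset.forall_mem_image, inner_smul_left, inner_smul_right, conj_trivial]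
    intro x hx y hy
    have h1 : ρ * σ / 3 * (σ * ⟪x, y⟫) = (4 * ρ * ⟪x, y⟫) / 5 := by
      linear_combination (ρ / 3 * ⟪x, y⟫) * hσ2
    have := hAB x hx y hy
    simp only [mul_eq_zero (a := _ + _), mul_eq_zero (a := _ - _)] at this
    simp only [h1]
    rcases this with e | e | e
    · left; linarith
    · right; left; linarith
    · right; right; linarith
  · simp only [Finset.forall_mem_image, inner_smul_left, inner_smul_right, conj_trivial]
    intro x hx y hy hne
    rw [← mul_assoc, ← sq, hτ]
    have := hBB x hx y hy fun e => hne (e ▸ rfl)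
    simp only [mul_eq_zero (a := _ + _), mul_eq_zero (a := _ - _)] at this
    rcases this with e | e | e
    · left; linarith
    · right; left; linarith
    · right; right; linarith
  · intro a
    obtain ⟨e1, e2, e3, e4⟩ := h.hasSphereMoments_left.sum_smul_image hσpos.ne' a
    rw [hσ2, h.card_left] at e2 e4
    exact ⟨e1, by rw [e2]; push_cast; ring, e3, by rw [e4]; push_cast; ring⟩
  · intro a
    obtain ⟨e1, e2, e3, e4⟩ := h.hasSphereMoments_right.sum_smul_image hτpos.ne' a
    rw [hτ, h.card_right] at e2 e4
    exact ⟨e1, by rw [e2]; push_cast; ring, e3, by rw [e4]; push_cast; ring⟩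

end IsUnitDesign

end Lifting

section Recognition

local notation "E" => EuclideanSpace ℝ (Fin 22)

/-- A design whose first fiber has `275` points is, up to scaling, a lifted configuration with
constant weights. -/
lemma exists_isLifted {X₁ X₂ : Finset E} {w : E → ℝ} {r₁ r₂ : ℝ}
    (hr₁ : 0 < r₁) (hr₂ : 0 < r₂) (hrne : r₁ ≠ r₂)
    (hX₁ : ∀ x ∈ X₁, ‖x‖ = r₁) (hX₂ : ∀ x ∈ X₂, ‖x‖ = r₂)
    (hw : ∀ x ∈ X₁ ∪ X₂, 0 < w x) (hcard : (X₁ ∪ X₂).card = 2300) (h275 : X₁.card = 275)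
    (hdesign : IsEuclideanDesignTwoSpheres 6 X₁ X₂ w r₁ r₂) :
    ∃ (A B : Finset E) (ρ ω : ℝ), IsLifted A B ∧ 0 < ρ ∧ 0 < ω ∧
      X₁ = A.image (ρ • ·) ∧ X₂ = B.image ((3 * ρ) • ·) ∧
      (∀ x ∈ X₁, w x = ω) ∧ (∀ x ∈ X₂, w x = ω / 729) := by
  have h := isUnitDesign_of_design hr₁ hr₂ hrne hX₁ hX₂ hw hcard h275 hdesign
  obtain ⟨hs, hV, -, -⟩ := h.parameters
  have hW := h.weight_sum_left_pos
  have hwA := h.left_tight.1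
  have hwB := h.kernel_zero.2.1
  have hσpos : (0 : ℝ) < √(12 / 5) := Real.sqrt_pos.2 (by norm_num)
  have h11pos : (0 : ℝ) < √11 := Real.sqrt_pos.2 (by norm_num)
  have hlift := h.isLifted
  simp only [hV] at hwB
  set W := ∑ x ∈ X₁.image (r₁⁻¹ • ·), w (r₁ • x)
  refine ⟨_, _, r₁ / √(12 / 5), W / 275, hlift, by positivity, by positivity, ?_, ?_, ?_, ?_⟩
  · simp only [Finset.image_image, Function.comp_def, smul_smul]
    rw [show r₁ / √(12 / 5) * (√(12 / 5) * r₁⁻¹) = 1 by field_simp]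
    simp
  · simp only [Finset.image_image, Function.comp_def, smul_smul]
    rw [show 3 * (r₁ / √(12 / 5)) * (√11 * √(12 / 5) / 3 * r₂⁻¹) = 1 by
      rw [hs]; field_simp]
    simp
  · intro x hx
    have := hwA (r₁⁻¹ • x) (Finset.mem_image_of_mem _ hx)
    rwa [smul_inv_smul₀ hr₁.ne'] at this
  · intro x hx
    have := hwB (r₂⁻¹ • x) (Finset.mem_image_of_mem _ hx)
    rw [smul_inv_smul₀ hr₂.ne'] at this
    rw [this]
    ring

/-- The pairing of two lifted vectors. -/
noncomputable def liftPairing (z z' : E × ℝ) : ℝ := ⟪z.1, z'.1⟫ + z.2 * z'.2 / 15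

lemma liftPairing_comm (z z' : E × ℝ) : liftPairing z z' = liftPairing z' z := by
  rw [liftPairing, liftPairing, real_inner_comm, mul_comm z.2]

lemma liftPairing_add_left (z₁ z₂ z' : E × ℝ) :
    liftPairing (z₁ + z₂) z' = liftPairing z₁ z' + liftPairing z₂ z' := by
  simp only [liftPairing, Prod.fst_add, Prod.snd_add, inner_add_left]
  ring

lemma liftPairing_sub_left (z₁ z₂ z' : E × ℝ) :
    liftPairing (z₁ - z₂) z' = liftPairing z₁ z' - liftPairing z₂ z' := by
  simp only [liftPairing, Prod.fst_sub, Prod.snd_sub, inner_sub_left]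
  ring

lemma liftPairing_self_nonneg (z : E × ℝ) : 0 ≤ liftPairing z z :=
  add_nonneg real_inner_self_nonneg (div_nonneg (mul_self_nonneg _) (by norm_num))

lemma eq_zero_of_liftPairing_self {z : E × ℝ} (h : liftPairing z z = 0) : z = 0 := by
  have h1 : 0 ≤ ⟪z.1, z.1⟫ := real_inner_self_nonneg
  have h2 : 0 ≤ z.2 * z.2 / 15 := div_nonneg (mul_self_nonneg _) (by norm_num)
  have h0 : ⟪z.1, z.1⟫ + z.2 * z.2 / 15 = 0 := h
  refine Prod.ext ((inner_self_eq_zero (𝕜 := ℝ)).1 (by linarith)) (mul_self_eq_zero.1 ?_)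
  linarith

/-- The lifted vectors coming from the two fibers. -/
def IsLiftedPoint (A B : Finset E) (z : E × ℝ) : Prop :=
  (z.1 ∈ A ∧ z.2 = 3) ∨ (z.1 ∈ B ∧ z.2 = 1)

/-- All pairings with lifted points are integers. -/
def HasIntPairings (A B : Finset E) (z : E × ℝ) : Prop :=
  ∀ z', IsLiftedPoint A B z' → ∃ n : ℤ, liftPairing z z' = n

namespace HasIntPairings

variable {A B : Finset E} {z z' : E × ℝ}

lemma add (h : HasIntPairings A B z) (h' : HasIntPairings A B z') :
    HasIntPairings A B (z + z') := by
  intro y hy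
  obtain ⟨m, hm⟩ := h y hy
  obtain ⟨n, hn⟩ := h' y hy
  exact ⟨m + n, by rw [liftPairing_add_left, hm, hn]; push_cast; ring⟩

lemma sub (h : HasIntPairings A B z) (h' : HasIntPairings A B z') :
    HasIntPairings A B (z - z') := by
  intro y hy
  obtain ⟨m, hm⟩ := h y hy
  obtain ⟨n, hn⟩ := h' y hy
  exact ⟨m - n, by rw [liftPairing_sub_left, hm, hn]; push_cast; ring⟩

end HasIntPairings

namespace IsLifted

variable {A B : Finset E}

lemma liftPairing_self (h : IsLifted A B) {z : E × ℝ} (hz : IsLiftedPoint A B z) :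
    liftPairing z z = 3 := by
  rcases hz with ⟨hz, h3⟩ | ⟨hz, h1⟩
  · rw [liftPairing, h.self_left _ hz, h3]; norm_num
  · rw [liftPairing, h.self_right _ hz, h1]; norm_num

lemma hasIntPairings (h : IsLifted A B) {z : E × ℝ} (hz : IsLiftedPoint A B z) :
    HasIntPairings A B z := by
  intro z' hz'
  rcases eq_or_ne z z' with rfl | hne
  · exact ⟨3, by rw [h.liftPairing_self hz]; norm_num⟩
  rcases hz with ⟨hz, e⟩ | ⟨hz, e⟩ <;> rcases hz' with ⟨hz', e'⟩ | ⟨hz', e'⟩ <;>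
    rw [liftPairing, e, e']
  · rcases h.left_left _ hz _ hz' (fun e₁ => hne (Prod.ext e₁ (e.trans e'.symm))) with e₂ | e₂
    exacts [⟨0, by rw [e₂]; norm_num⟩, ⟨1, by rw [e₂]; norm_num⟩]
  · rcases h.left_right _ hz _ hz' with e₂ | e₂ | e₂
    exacts [⟨0, by rw [e₂]; norm_num⟩, ⟨1, by rw [e₂]; norm_num⟩, ⟨-1, by rw [e₂]; norm_num⟩]
  · rw [real_inner_comm]
    rcases h.left_right _ hz' _ hz with e₂ | e₂ | e₂
    exacts [⟨0, by rw [e₂]; norm_num⟩, ⟨1, by rw [e₂]; norm_num⟩, ⟨-1, by rw [e₂]; norm_num⟩]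
  · rcases h.right_right _ hz _ hz' (fun e₁ => hne (Prod.ext e₁ (e.trans e'.symm))) with
      e₂ | e₂ | e₂
    exacts [⟨0, by rw [e₂]; norm_num⟩, ⟨1, by rw [e₂]; norm_num⟩, ⟨-1, by rw [e₂]; norm_num⟩]

/-- A degree four weighting of the pairings with all lifted points. -/
lemma sum_liftPairing (h : IsLifted A B) (z : E × ℝ) :
    ∑ x ∈ A, liftPairing z (x, 3) ^ 2 * (liftPairing z (x, 3) ^ 2 - 1) +
      ∑ x ∈ B, liftPairing z (x, 1) ^ 2 * (liftPairing z (x, 1) ^ 2 - 1) =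
    108 * liftPairing z z ^ 2 - 300 * liftPairing z z := by
  have key (Y : Finset E) (c p₂ p₄ : ℝ) (e : (∑ x ∈ Y, ⟪z.1, x⟫ = 0) ∧
      (∑ x ∈ Y, ⟪z.1, x⟫ ^ 2 = p₂) ∧ (∑ x ∈ Y, ⟪z.1, x⟫ ^ 3 = 0) ∧
      (∑ x ∈ Y, ⟪z.1, x⟫ ^ 4 = p₄)) :
      ∑ x ∈ Y, (⟪z.1, x⟫ + c) ^ 2 * ((⟪z.1, x⟫ + c) ^ 2 - 1) =
        p₄ + (6 * c ^ 2 - 1) * p₂ + Y.card * (c ^ 4 - c ^ 2) := by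
    obtain ⟨e1, e2, e3, e4⟩ := e
    have : ∀ x ∈ Y, (⟪z.1, x⟫ + c) ^ 2 * ((⟪z.1, x⟫ + c) ^ 2 - 1) =
        ⟪z.1, x⟫ ^ 4 + 4 * c * ⟪z.1, x⟫ ^ 3 + (6 * c ^ 2 - 1) * ⟪z.1, x⟫ ^ 2 +
        (4 * c ^ 3 - 2 * c) * ⟪z.1, x⟫ + (c ^ 4 - c ^ 2) := fun x _ => by ring
    simp only [Finset.sum_congr rfl this, Finset.sum_add_distrib, ← Finset.mul_sum, e1, e2, e3,
      e4, Finset.sum_const, nsmul_eq_mul]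
    ring
  simp only [liftPairing]
  rw [key A _ _ _ (h.moments_left z.1), key B _ _ _ (h.moments_right z.1), h.card_left,
    h.card_right]
  push_cast
  ring

lemma int_sq_mul_nonneg {t : ℝ} (ht : ∃ n : ℤ, t = n) : 0 ≤ t ^ 2 * (t ^ 2 - 1) := by
  obtain ⟨n, rfl⟩ := ht
  rcases eq_or_ne n 0 with rfl | hn
  · simp
  · have : 1 ≤ n ^ 2 := by have := sq_pos_of_ne_zero hn; omega
    have h1 : (1 : ℝ) ≤ (n : ℝ) ^ 2 := by exact_mod_cast this
    nlinarith

lemma liftPairing_self_ne_two (h : IsLifted A B) {z : E × ℝ} (hz : HasIntPairings A B z) :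
    liftPairing z z ≠ 2 := by
  intro h2
  have h0 := h.sum_liftPairing z
  have hA : 0 ≤ ∑ x ∈ A, liftPairing z (x, 3) ^ 2 * (liftPairing z (x, 3) ^ 2 - 1) :=
    Finset.sum_nonneg fun x hx => int_sq_mul_nonneg (hz _ (Or.inl ⟨hx, rfl⟩))
  have hB : 0 ≤ ∑ x ∈ B, liftPairing z (x, 1) ^ 2 * (liftPairing z (x, 1) ^ 2 - 1) :=
    Finset.sum_nonneg fun x hx => int_sq_mul_nonneg (hz _ (Or.inr ⟨hx, rfl⟩))
  rw [h2] at h0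
  linarith

/-- The lifted points and their negatives are exactly the vectors of norm three with integral
pairings. -/
lemma isLiftedPoint_or_neg (h : IsLifted A B) {z : E × ℝ} (hz : HasIntPairings A B z)
    (h3 : liftPairing z z = 3) : IsLiftedPoint A B z ∨ IsLiftedPoint A B (-z) := by
  obtain ⟨y, hy, hne⟩ : ∃ y, IsLiftedPoint A B y ∧
      liftPairing z y ^ 2 * (liftPairing z y ^ 2 - 1) ≠ 0 := by
    by_contra! hcon
    have h0 := h.sum_liftPairing z
    rw [Finset.sum_eq_zero fun x hx => hcon _ (Or.inl ⟨hx, rfl⟩),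
      Finset.sum_eq_zero fun x hx => hcon _ (Or.inr ⟨hx, rfl⟩), h3] at h0
    norm_num at h0
  have hyy := h.liftPairing_self hy
  have hsub : liftPairing (z - y) (z - y) = 6 - 2 * liftPairing z y := by
    rw [liftPairing_sub_left, liftPairing_comm z, liftPairing_comm y, liftPairing_sub_left,
      liftPairing_sub_left, h3, hyy, liftPairing_comm y z]
    ring
  have hadd : liftPairing (z + y) (z + y) = 6 + 2 * liftPairing z y := by
    rw [liftPairing_add_left, liftPairing_comm z, liftPairing_comm y, liftPairing_add_left,
      liftPairing_add_left, h3, hyy, liftPairing_comm y z]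
    ring
  have n1 := h.liftPairing_self_ne_two (hz.sub (h.hasIntPairings hy))
  have n2 := h.liftPairing_self_ne_two (hz.add (h.hasIntPairings hy))
  have p1 := liftPairing_self_nonneg (z - y)
  have p2 := liftPairing_self_nonneg (z + y)
  obtain ⟨n, hn⟩ := hz y hy
  rw [hn] at hsub hadd hne
  rw [hsub] at n1 p1
  rw [hadd] at n2 p2
  have l1 : n ≤ 3 := by
    have : (n : ℝ) ≤ 3 := by linarith
    exact_mod_cast this
  have l2 : -3 ≤ n := by
    have : (-3 : ℝ) ≤ n := by linarith
    exact_mod_cast this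
  obtain rfl | rfl : n = 3 ∨ n = -3 := by
    by_contra! hn3
    interval_cases n <;>
      first | omega | (apply hne; norm_num; done) | (apply n1; norm_num; done) |
        (apply n2; norm_num)
  · left
    have := eq_zero_of_liftPairing_self (z := z - y) (by rw [hsub]; norm_num)
    rwa [sub_eq_zero.1 this]
  · right
    have := eq_zero_of_liftPairing_self (z := z + y) (by rw [hadd]; norm_num)
    rwa [neg_eq_of_add_eq_zero_right this]

end IsLifted

end Recognition

section Frames

local notation "E" => EuclideanSpace ℝ (Fin 22)

/-- A point `y₀` of the second fiber together with an enumeration of the points of the first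
fiber whose pairing with `y₀` is `-1`. -/
structure IsFrame (A B : Finset (EuclideanSpace ℝ (Fin 22))) {ι : Type} [Fintype ι]
    (y₀ : EuclideanSpace ℝ (Fin 22)) (p : ι → EuclideanSpace ℝ (Fin 22)) : Prop where
  card_index : Fintype.card ι = 22
  mem_right : y₀ ∈ B
  mem_left : ∀ i, p i ∈ A
  inner_base : ∀ i, ⟪p i, y₀⟫ = -6 / 5
  inner_self : ∀ i, ⟪p i, p i⟫ = 12 / 5
  inner_ne : ∀ i j, i ≠ j → ⟪p i, p j⟫ = 2 / 5
  exists_eq : ∀ x ∈ A, ⟪x, y₀⟫ = -6 / 5 → ∃ i, p i = x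

namespace IsLifted

variable {A B : Finset E}

lemma sum_mixed (h : IsLifted A B) (a b : E) :
    ∑ x ∈ A, ⟪a, x⟫ * ⟪b, x⟫ = 30 * ⟪a, b⟫ ∧ ∑ x ∈ A, ⟪a, x⟫ * ⟪b, x⟫ ^ 2 = 0 := by
  obtain ⟨-, s2, s3, -⟩ := h.moments_left (b + a)
  obtain ⟨-, -, d3, -⟩ := h.moments_left (b - a)
  obtain ⟨-, a2, a3, -⟩ := h.moments_left a
  obtain ⟨-, b2, -, -⟩ := h.moments_left b
  constructor
  · have : ∀ x ∈ A, ⟪a, x⟫ * ⟪b, x⟫ =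
        (1 / 2) * (⟪b + a, x⟫ ^ 2 - ⟪a, x⟫ ^ 2 - ⟪b, x⟫ ^ 2) := fun x _ => by
      rw [inner_add_left]; ring
    rw [Finset.sum_congr rfl this, ← Finset.mul_sum, Finset.sum_sub_distrib,
      Finset.sum_sub_distrib, s2, a2, b2, real_inner_add_add_self, real_inner_comm a b]
    ring
  · have : ∀ x ∈ A, ⟪a, x⟫ * ⟪b, x⟫ ^ 2 =
        (1 / 6) * (⟪b + a, x⟫ ^ 3 - ⟪b - a, x⟫ ^ 3 - 2 * ⟪a, x⟫ ^ 3) := fun x _ => by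
      rw [inner_add_left, inner_sub_left]; ring
    rw [Finset.sum_congr rfl this, ← Finset.mul_sum, Finset.sum_sub_distrib,
      Finset.sum_sub_distrib, ← Finset.mul_sum, s3, d3, a3]
    ring

/-- The distribution of the pairings of the first fiber with a point of the second fiber. -/
lemma card_filter_inner (h : IsLifted A B) {y : E} (hy : y ∈ B) :
    (A.filter fun x => ⟪x, y⟫ = -6 / 5).card = 22 ∧
    (A.filter fun x => ⟪x, y⟫ = 4 / 5).card = 77 ∧
    (A.filter fun x => ⟪x, y⟫ = -1 / 5).card = 176 := by
  obtain ⟨e1, e2, -, -⟩ := h.moments_left y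
  rw [h.self_right y hy] at e2
  have count (c : ℝ) (c₀ c₁ c₂ : ℝ)
      (hf : ∀ x ∈ A, (if ⟪x, y⟫ = c then (1 : ℝ) else 0) = c₀ + c₁ * ⟪y, x⟫ + c₂ * ⟪y, x⟫ ^ 2) :
      ((A.filter fun x => ⟪x, y⟫ = c).card : ℝ) = 275 * c₀ + 88 * c₂ := by
    rw [← Finset.sum_boole, Finset.sum_congr rfl hf, Finset.sum_add_distrib,
      Finset.sum_add_distrib, ← Finset.mul_sum, ← Finset.mul_sum, e1, e2, Finset.sum_const,
      h.card_left, nsmul_eq_mul]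
    push_cast
    ring
  have c1 := count (-6 / 5) (-2 / 25) (-3 / 10) (1 / 2) (fun x hx => by
    rw [real_inner_comm x y]
    rcases h.left_right x hx y hy with e | e | e <;> rw [e] <;> norm_num)
  have c2 := count (4 / 5) (3 / 25) (7 / 10) (1 / 2) (fun x hx => by
    rw [real_inner_comm x y]
    rcases h.left_right x hx y hy with e | e | e <;> rw [e] <;> norm_num)
  have c3 := count (-1 / 5) (24 / 25) (-2 / 5) (-1) (fun x hx => by
    rw [real_inner_comm x y]
    rcases h.left_right x hx y hy with e | e | e <;> rw [e] <;> norm_num)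
  refine ⟨?_, ?_, ?_⟩ <;> rify
  · rw [c1]; norm_num
  · rw [c2]; norm_num
  · rw [c3]; norm_num

lemma inner_of_inner_base (h : IsLifted A B) {y p q : E} (hy : y ∈ B) (hp : p ∈ A) (hq : q ∈ A)
    (hpy : ⟪p, y⟫ = -6 / 5) (hqy : ⟪q, y⟫ = -6 / 5) (hpq : p ≠ q) : ⟪p, q⟫ = 2 / 5 := by
  refine (h.left_left p hp q hq hpq).resolve_left fun hbad => ?_
  obtain ⟨m1, m2⟩ := h.sum_mixed p y
  obtain ⟨p1, -, -, -⟩ := h.moments_left p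
  obtain ⟨y1, y2, -, -⟩ := h.moments_left y
  rw [h.self_right y hy] at y2
  rw [hpy] at m1
  have hsum : ∑ x ∈ A, (2 / 5 - ⟪p, x⟫) * (⟪y, x⟫ ^ 2 / 2 - 3 / 10 * ⟪y, x⟫ - 2 / 25) = -2 := by
    have : ∀ x ∈ A, (2 / 5 - ⟪p, x⟫) * (⟪y, x⟫ ^ 2 / 2 - 3 / 10 * ⟪y, x⟫ - 2 / 25) =
        -4 / 125 + (-3 / 25) * ⟪y, x⟫ + (1 / 5) * ⟪y, x⟫ ^ 2 + (2 / 25) * ⟪p, x⟫ +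
        (3 / 10) * (⟪p, x⟫ * ⟪y, x⟫) + (-1 / 2) * (⟪p, x⟫ * ⟪y, x⟫ ^ 2) := fun x _ => by ring
    rw [Finset.sum_congr rfl this]
    simp only [Finset.sum_add_distrib, ← Finset.mul_sum, m1, m2, p1, y1, y2, Finset.sum_const,
      h.card_left, nsmul_eq_mul]
    norm_num
  rw [← Finset.add_sum_erase _ _ hp, ← Finset.add_sum_erase _ _ (Finset.mem_erase.2 ⟨hpq.symm, hq⟩),
    h.self_left p hp, hbad, real_inner_comm p y, real_inner_comm q y, hpy, hqy] at hsum
  have hnn : 0 ≤ ∑ x ∈ (A.erase p).erase q,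
      (2 / 5 - ⟪p, x⟫) * (⟪y, x⟫ ^ 2 / 2 - 3 / 10 * ⟪y, x⟫ - 2 / 25) := by
    refine Finset.sum_nonneg fun x hx => mul_nonneg ?_ ?_
    · have hx' := Finset.mem_of_mem_erase hx
      rcases h.left_left p hp x (Finset.mem_of_mem_erase hx') (Finset.ne_of_mem_erase hx').symm
        with e | e <;> rw [e] <;> norm_num
    · have hx' := Finset.mem_of_mem_erase (Finset.mem_of_mem_erase hx)
      rw [real_inner_comm x y]
      rcases h.left_right x hx' y hy with e | e | e <;> rw [e] <;> norm_num
  norm_num at hsum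
  linarith

lemma exists_isFrame (h : IsLifted A B) : ∃ (y₀ : E) (p : Fin 22 → E), IsFrame A B y₀ p := by
  obtain ⟨y, hy⟩ : B.Nonempty := Finset.card_pos.1 (by rw [h.card_right]; norm_num)
  set P := A.filter fun x => ⟪x, y⟫ = -6 / 5 with hP
  have e : P ≃ Fin 22 := P.equivFinOfCardEq (h.card_filter_inner hy).1
  have hmem (i) : (e.symm i : E) ∈ A ∧ ⟪(e.symm i : E), y⟫ = -6 / 5 :=
    Finset.mem_filter.1 (e.symm i).2
  refine ⟨y, fun i => e.symm i, by simp, hy, fun i => (hmem i).1, fun i => (hmem i).2,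
    fun i => h.self_left _ (hmem i).1, fun i j hij => ?_, fun x hx hxy => ?_⟩
  · exact h.inner_of_inner_base hy (hmem i).1 (hmem j).1 (hmem i).2 (hmem j).2
      fun e' => hij (e.symm.injective (Subtype.ext e'))
  · exact ⟨e ⟨x, Finset.mem_filter.2 ⟨hx, hxy⟩⟩, by simp⟩

end IsLifted

namespace IsFrame

variable {A B : Finset E} {ι : Type} [Fintype ι] {y₀ : E} {p : ι → E}

lemma reindex {κ : Type} [Fintype κ] (h : IsFrame A B y₀ p) (φ : κ ≃ ι) :
    IsFrame A B y₀ (p ∘ φ) where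
  card_index := (Fintype.card_congr φ).trans h.card_index
  mem_right := h.mem_right
  mem_left i := h.mem_left _
  inner_base i := h.inner_base _
  inner_self i := h.inner_self _
  inner_ne i j hij := h.inner_ne _ _ (φ.injective.ne hij)
  exists_eq x hx hxy := by
    obtain ⟨i, hi⟩ := h.exists_eq x hx hxy
    exact ⟨φ.symm i, by simpa using hi⟩

lemma inner_eq_ite (h : IsFrame A B y₀ p) (i j : ι) :
    ⟪p i, p j⟫ = 2 / 5 + if i = j then 2 else 0 := by
  split_ifs with hij
  · rw [hij, h.inner_self]; norm_num
  · rw [h.inner_ne i j hij]; norm_num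

lemma inner_sum_smul (h : IsFrame A B y₀ p) (c : ι → ℝ) (j : ι) :
    ⟪∑ i, c i • p i, p j⟫ = 2 / 5 * ∑ i, c i + 2 * c j := by
  simp only [sum_inner, inner_smul_left, conj_trivial, h.inner_eq_ite, mul_add,
    Finset.sum_add_distrib, mul_ite, mul_zero, Finset.sum_ite_eq', Finset.mem_univ, if_true,
    ← Finset.sum_mul]
  ring

lemma linearIndependent (h : IsFrame A B y₀ p) : LinearIndependent ℝ p := by
  rw [Fintype.linearIndependent_iff]
  intro c hc
  have h0 (j : ι) : 2 / 5 * ∑ i, c i + 2 * c j = 0 := by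
    rw [← h.inner_sum_smul, hc, inner_zero_left]
  have hS : ∑ j : ι, (2 / 5 * ∑ i, c i + 2 * c j) = 0 := Finset.sum_eq_zero fun j _ => h0 j
  rw [Finset.sum_add_distrib, ← Finset.mul_sum _ _ (2 : ℝ), Finset.sum_const, Finset.card_univ,
    h.card_index, nsmul_eq_mul] at hS
  push_cast at hS
  intro j
  have := h0 j
  linarith

/-- The basis of the ambient space underlying a frame. -/
noncomputable def basis (h : IsFrame A B y₀ p) : Module.Basis ι ℝ E :=
  haveI : Nonempty ι := Fintype.card_pos_iff.1 (by rw [h.card_index]; norm_num)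
  basisOfLinearIndependentOfCardEqFinrank h.linearIndependent (by
    rw [h.card_index, finrank_euclideanSpace_fin])

lemma basis_apply (h : IsFrame A B y₀ p) (i : ι) : h.basis i = p i := by
  simp [basis]

lemma ext_inner (h : IsFrame A B y₀ p) {d d' : E} (hd : ∀ i, ⟪d, p i⟫ = ⟪d', p i⟫) : d = d' :=
  InnerProductSpace.ext_inner_right_basis h.basis fun i => by rw [h.basis_apply, hd]

lemma eq_sum (h : IsFrame A B y₀ p) (d : E) :
    d = ∑ i, ((⟪d, p i⟫ - (∑ j, ⟪d, p j⟫) / 27) / 2) • p i := by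
  refine h.ext_inner fun i => ?_
  rw [h.inner_sum_smul, ← Finset.sum_div, Finset.sum_sub_distrib, Finset.sum_const,
    Finset.card_univ, h.card_index, nsmul_eq_mul]
  push_cast
  ring

lemma inner_eq (h : IsFrame A B y₀ p) (d d' : E) :
    ⟪d, d'⟫ = (∑ i, ⟪d, p i⟫ * ⟪d', p i⟫ - (∑ i, ⟪d, p i⟫) * (∑ i, ⟪d', p i⟫) / 27) / 2 := by
  conv_lhs => rw [h.eq_sum d]
  simp only [sum_inner, inner_smul_left, conj_trivial, real_inner_comm d' (p _), sub_div, sub_mul,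
    Finset.sum_sub_distrib, div_mul_eq_mul_div, ← Finset.sum_div, ← Finset.mul_sum]

lemma liftPairing_base (h : IsFrame A B y₀ p) (z : E × ℝ) :
    ∑ i, liftPairing z (p i, 3) = 5 * z.2 - 9 * liftPairing z (y₀, 1) := by
  simp only [liftPairing]
  rw [h.inner_eq z.1 y₀]
  simp only [real_inner_comm (p _) y₀, h.inner_base, Finset.sum_add_distrib, Finset.sum_const,
    Finset.card_univ, h.card_index, ← Finset.sum_mul, nsmul_eq_mul]
  push_cast
  ring

/-- The pairing in frame coordinates. -/
lemma liftPairing_eq (h : IsFrame A B y₀ p) (z z' : E × ℝ) :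
    liftPairing z z' = (∑ i, liftPairing z (p i, 3) * liftPairing z' (p i, 3) -
      z.2 * z'.2 - 3 * liftPairing z (y₀, 1) * liftPairing z' (y₀, 1)) / 2 +
      z.2 * liftPairing z' (y₀, 1) + z'.2 * liftPairing z (y₀, 1) := by
  have b := h.liftPairing_base z
  have b' := h.liftPairing_base z'
  have hs (w : E × ℝ) : ∑ i, ⟪w.1, p i⟫ = ∑ i, liftPairing w (p i, 3) - 22 * (w.2 / 5) := by
    simp only [liftPairing, Finset.sum_add_distrib, Finset.sum_const, Finset.card_univ,
      h.card_index, nsmul_eq_mul]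
    push_cast
    ring
  have hm : ∑ i, ⟪z.1, p i⟫ * ⟪z'.1, p i⟫ = ∑ i, liftPairing z (p i, 3) * liftPairing z' (p i, 3) -
      z.2 / 5 * ∑ i, liftPairing z' (p i, 3) - z'.2 / 5 * ∑ i, liftPairing z (p i, 3) +
      22 * (z.2 * z'.2 / 25) := by
    have (i : ι) : ⟪z.1, p i⟫ * ⟪z'.1, p i⟫ = liftPairing z (p i, 3) * liftPairing z' (p i, 3) -
        z.2 / 5 * liftPairing z' (p i, 3) - z'.2 / 5 * liftPairing z (p i, 3) +
        z.2 * z'.2 / 25 := by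
      simp only [liftPairing]
      ring
    simp only [this, Finset.sum_add_distrib, Finset.sum_sub_distrib, ← Finset.mul_sum,
      Finset.sum_const, Finset.card_univ, h.card_index, nsmul_eq_mul]
    push_cast
    ring
  rw [show liftPairing z z' = ⟪z.1, z'.1⟫ + z.2 * z'.2 / 15 from rfl, h.inner_eq, hm, hs, hs, b, b']
  ring

end IsFrame

end Frames

section HexadSystems

local notation "E" => EuclideanSpace ℝ (Fin 22)

/-- The incidence data of the hexads and heptads on 22 points. -/
structure IsHexadSystem {ι : Type} [DecidableEq ι] (H C : Finset (Finset ι)) : Prop where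
  card_hexads : H.card = 77
  card_heptads : C.card = 176
  card_hexad : ∀ b ∈ H, b.card = 6
  card_heptad : ∀ c ∈ C, c.card = 7
  hexad_inter : ∀ b ∈ H, ∀ b' ∈ H, b ≠ b' → (b ∩ b').card = 0 ∨ (b ∩ b').card = 2
  mixed_inter : ∀ b ∈ H, ∀ c ∈ C, (b ∩ c).card = 1 ∨ (b ∩ c).card = 3
  heptad_inter : ∀ c ∈ C, ∀ c' ∈ C, c ≠ c' → (c ∩ c').card = 1 ∨ (c ∩ c').card = 3

/-- The set of frame points at inner product `2 / 5` with `x`. -/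
noncomputable def frameSupport {ι : Type} [Fintype ι] (p : ι → EuclideanSpace ℝ (Fin 22))
    (x : EuclideanSpace ℝ (Fin 22)) : Finset ι :=
  Finset.univ.filter fun i => ⟪x, p i⟫ = 2 / 5

/-- The supports of the points of the first fiber at inner product `4 / 5` with the base point. -/
noncomputable def frameHexads {ι : Type} [Fintype ι] [DecidableEq ι]
    (A : Finset (EuclideanSpace ℝ (Fin 22))) (y₀ : EuclideanSpace ℝ (Fin 22))
    (p : ι → EuclideanSpace ℝ (Fin 22)) : Finset (Finset ι) :=
  (A.filter fun x => ⟪x, y₀⟫ = 4 / 5).image (frameSupport p)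

/-- The complements of the supports of the points of the first fiber at inner product `-1 / 5`
with the base point. -/
noncomputable def frameHeptads {ι : Type} [Fintype ι] [DecidableEq ι]
    (A : Finset (EuclideanSpace ℝ (Fin 22))) (y₀ : EuclideanSpace ℝ (Fin 22))
    (p : ι → EuclideanSpace ℝ (Fin 22)) : Finset (Finset ι) :=
  (A.filter fun x => ⟪x, y₀⟫ = -1 / 5).image fun x => (frameSupport p x)ᶜ

namespace IsFrame

variable {A B : Finset E} {ι : Type} [Fintype ι] {y₀ : E} {p : ι → E}

lemma inner_eq_of_not_mem_support (h : IsLifted A B) (hF : IsFrame A B y₀ p) {x : E} (hx : x ∈ A)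
    (hxy : ⟪x, y₀⟫ ≠ -6 / 5) {i : ι} (hi : i ∉ frameSupport p x) : ⟪x, p i⟫ = -3 / 5 := by
  refine (h.left_left x hx (p i) (hF.mem_left i) ?_).resolve_right ?_
  · rintro rfl
    exact hxy (hF.inner_base i)
  · simpa [frameSupport] using hi

lemma liftPairing_frame [DecidableEq ι] (h : IsLifted A B) (hF : IsFrame A B y₀ p) {x : E}
    (hx : x ∈ A) (hxy : ⟪x, y₀⟫ ≠ -6 / 5) (i : ι) :
    liftPairing (x, 3) (p i, 3) = if i ∈ frameSupport p x then 1 else 0 := by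
  split_ifs with hi
  · have : ⟪x, p i⟫ = 2 / 5 := by simpa [frameSupport] using hi
    simp only [liftPairing, this]
    norm_num
  · simp only [liftPairing, hF.inner_eq_of_not_mem_support h hx hxy hi]
    norm_num

lemma card_support [DecidableEq ι] (h : IsLifted A B) (hF : IsFrame A B y₀ p) {x : E} (hx : x ∈ A)
    (hxy : ⟪x, y₀⟫ ≠ -6 / 5) :
    ((frameSupport p x).card : ℝ) = 15 - 9 * (⟪x, y₀⟫ + 1 / 5) := by
  have := hF.liftPairing_base (x, 3)
  simp only [hF.liftPairing_frame h hx hxy, Finset.sum_ite_mem, Finset.univ_inter,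
    Finset.sum_const, nsmul_eq_mul, mul_one] at this
  rw [this]
  simp only [liftPairing]
  ring

lemma card_support_inter [DecidableEq ι] (h : IsLifted A B) (hF : IsFrame A B y₀ p) {x x' : E}
    (hx : x ∈ A) (hxy : ⟪x, y₀⟫ ≠ -6 / 5) (hx' : x' ∈ A) (hxy' : ⟪x', y₀⟫ ≠ -6 / 5) :
    ⟪x, x'⟫ = (((frameSupport p x ∩ frameSupport p x').card : ℝ) - 9 -
      3 * (⟪x, y₀⟫ + 1 / 5) * (⟪x', y₀⟫ + 1 / 5)) / 2 + 3 * (⟪x, y₀⟫ + 1 / 5) +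
      3 * (⟪x', y₀⟫ + 1 / 5) - 3 / 5 := by
  have := hF.liftPairing_eq (x, 3) (x', 3)
  simp only [hF.liftPairing_frame h hx hxy, hF.liftPairing_frame h hx' hxy', ← ite_and,
    ite_mul, zero_mul, one_mul, ← Finset.mem_inter, Finset.sum_ite_mem, Finset.univ_inter,
    Finset.sum_const, nsmul_eq_mul, mul_one] at this
  simp only [liftPairing] at this
  linarith

lemma isHexadSystem [DecidableEq ι] (h : IsLifted A B) (hF : IsFrame A B y₀ p) :
    IsHexadSystem (frameHexads A y₀ p) (frameHeptads A y₀ p) := by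
  obtain ⟨-, c77, c176⟩ := h.card_filter_inner hF.mem_right
  have hexad_inter {x x' : E} (hx : x ∈ A) (hxy : ⟪x, y₀⟫ = 4 / 5) (hx' : x' ∈ A)
      (hxy' : ⟪x', y₀⟫ = 4 / 5) (hne : x ≠ x') :
      (frameSupport p x ∩ frameSupport p x').card = 0 ∨
        (frameSupport p x ∩ frameSupport p x').card = 2 := by
    have e := hF.card_support_inter h hx (by rw [hxy]; norm_num) hx' (by rw [hxy']; norm_num)
    rw [hxy, hxy'] at e
    rify
    rcases h.left_left x hx x' hx' hne with e' | e' <;> rw [e'] at e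
    · left; linarith
    · right; linarith
  have heptad_inter {x x' : E} (hx : x ∈ A) (hxy : ⟪x, y₀⟫ = -1 / 5) (hx' : x' ∈ A)
      (hxy' : ⟪x', y₀⟫ = -1 / 5) (hne : x ≠ x') :
      ((frameSupport p x)ᶜ ∩ (frameSupport p x')ᶜ).card = 1 ∨
        ((frameSupport p x)ᶜ ∩ (frameSupport p x')ᶜ).card = 3 := by
    have e := hF.card_support_inter h hx (by rw [hxy]; norm_num) hx' (by rw [hxy']; norm_num)
    have c := hF.card_support h hx (by rw [hxy]; norm_num)
    have c' := hF.card_support h hx' (by rw [hxy']; norm_num)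
    have u := Finset.card_union_add_card_inter (frameSupport p x) (frameSupport p x')
    have v := Finset.card_add_card_compl (frameSupport p x ∪ frameSupport p x')
    rw [hF.card_index] at v
    rw [← Finset.compl_union]
    rw [hxy, hxy'] at e
    rw [hxy] at c
    rw [hxy'] at c'
    rify at u v ⊢
    rcases h.left_left x hx x' hx' hne with e' | e' <;> rw [e'] at e
    · left; linarith
    · right; linarith
  have card6 {x : E} (hx : x ∈ A) (hxy : ⟪x, y₀⟫ = 4 / 5) : (frameSupport p x).card = 6 := by
    have e := hF.card_support h hx (by rw [hxy]; norm_num)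
    rw [hxy] at e
    rify
    linarith
  have card7 {x : E} (hx : x ∈ A) (hxy : ⟪x, y₀⟫ = -1 / 5) : (frameSupport p x)ᶜ.card = 7 := by
    have e := hF.card_support h hx (by rw [hxy]; norm_num)
    rw [hxy] at e
    have := Finset.card_add_card_compl (frameSupport p x)
    rw [hF.card_index] at this
    rify at this ⊢
    linarith
  simp only [frameHexads, frameHeptads]
  refine ⟨?_, ?_, ?_, ?_, ?_, ?_, ?_⟩
  · rw [Finset.card_image_of_injOn, c77]
    intro x hx x' hx' he
    obtain ⟨hx, hxy⟩ := Finset.mem_filter.1 (Finset.mem_coe.1 hx)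
    obtain ⟨hx', hxy'⟩ := Finset.mem_filter.1 (Finset.mem_coe.1 hx')
    by_contra hne
    have := hexad_inter hx hxy hx' hxy' hne
    rw [he, Finset.inter_self, card6 hx' hxy'] at this
    omega
  · rw [Finset.card_image_of_injOn, c176]
    intro x hx x' hx' he
    obtain ⟨hx, hxy⟩ := Finset.mem_filter.1 (Finset.mem_coe.1 hx)
    obtain ⟨hx', hxy'⟩ := Finset.mem_filter.1 (Finset.mem_coe.1 hx')
    by_contra hne
    have := heptad_inter hx hxy hx' hxy' hne
    simp only at he
    rw [he, Finset.inter_self, card7 hx' hxy'] at this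
    omega
  · simp only [Finset.forall_mem_image, Finset.mem_filter]
    exact fun x hx => card6 hx.1 hx.2
  · simp only [Finset.forall_mem_image, Finset.mem_filter]
    exact fun x hx => card7 hx.1 hx.2
  · simp only [Finset.forall_mem_image, Finset.mem_filter]
    exact fun x hx x' hx' hne => hexad_inter hx.1 hx.2 hx'.1 hx'.2 fun e => hne (by rw [e])
  · simp only [Finset.forall_mem_image, Finset.mem_filter]
    rintro x ⟨hx, hxy⟩ x' ⟨hx', hxy'⟩
    have e := hF.card_support_inter h hx (by rw [hxy]; norm_num) hx' (by rw [hxy']; norm_num)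
    have c := card6 hx hxy
    have u := Finset.card_inter_add_card_sdiff (frameSupport p x) (frameSupport p x')
    rw [c] at u
    rw [hxy, hxy'] at e
    rw [← Finset.sdiff_eq_inter_compl]
    rify at u ⊢
    rcases h.left_left x hx x' hx' (by rintro rfl; norm_num [hxy] at hxy') with e' | e' <;>
      rw [e'] at e
    · right; linarith
    · left; linarith
  · simp only [Finset.forall_mem_image, Finset.mem_filter]
    exact fun x hx x' hx' hne => heptad_inter hx.1 hx.2 hx'.1 hx'.2 fun e => hne (by rw [e])

end IsFrame

end HexadSystems

section HexadCombinatorics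

/-- The fixed point free involutions of six points. -/
def synthemes : Fin 15 → Fin 6 → Fin 6 :=
  ![![1, 0, 3, 2, 5, 4], ![1, 0, 4, 5, 2, 3], ![1, 0, 5, 4, 3, 2], ![2, 3, 0, 1, 5, 4],
    ![2, 4, 0, 5, 1, 3], ![2, 5, 0, 4, 3, 1], ![3, 2, 1, 0, 5, 4], ![3, 4, 5, 0, 1, 2],
    ![3, 5, 4, 0, 2, 1], ![4, 2, 1, 5, 0, 3], ![4, 3, 5, 1, 0, 2], ![4, 5, 3, 2, 0, 1],
    ![5, 2, 1, 4, 3, 0], ![5, 3, 4, 1, 2, 0], ![5, 4, 3, 2, 1, 0]]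

set_option synthInstance.maxSize 2000 in
set_option synthInstance.maxHeartbeats 400000 in
lemma exists_synthemes_aux : ∀ a : Fin 6, a ≠ 0 → ∀ b : Fin 6, b ≠ 1 → (a = 1 ↔ b = 0) →
    ∀ c : Fin 6, c ≠ 2 → (a = 2 ↔ c = 0) → (b = 2 ↔ c = 1) →
    ∀ d : Fin 6, d ≠ 3 → (a = 3 ↔ d = 0) → (b = 3 ↔ d = 1) → (c = 3 ↔ d = 2) →
    ∀ e : Fin 6, e ≠ 4 → (a = 4 ↔ e = 0) → (b = 4 ↔ e = 1) → (c = 4 ↔ e = 2) → (d = 4 ↔ e = 3) →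
    ∀ f : Fin 6, f ≠ 5 → (a = 5 ↔ f = 0) → (b = 5 ↔ f = 1) → (c = 5 ↔ f = 2) → (d = 5 ↔ f = 3) →
    (e = 5 ↔ f = 4) → ∃ s, synthemes s = ![a, b, c, d, e, f] := by
  decide

lemma exists_synthemes (f : Fin 6 → Fin 6) (hne : ∀ i, f i ≠ i) (hinv : ∀ i, f (f i) = i) :
    ∃ s, synthemes s = f := by
  have hiff (i j : Fin 6) : f i = j ↔ f j = i :=
    ⟨fun h => by rw [← h, hinv], fun h => by rw [← h, hinv]⟩
  have hf : f = ![f 0, f 1, f 2, f 3, f 4, f 5] := by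
    funext i
    fin_cases i <;> rfl
  rw [hf]
  apply exists_synthemes_aux <;> first | exact hne _ | exact hiff _ _

lemma synthemes_zero {s : Fin 15} : synthemes s 0 = 3 → synthemes s 1 = 4 → synthemes s 2 = 5 →
    s = 7 := by
  revert s
  decide

lemma synthemes_transversal : ∀ t : Fin 15, (∀ i : Fin 6, i < 3 → 3 ≤ synthemes t i) →
    (∀ i : Fin 6, i < 3 → synthemes t i ≠ synthemes 7 i) → t = 11 ∨ t = 13 := by
  decide

namespace IsHexadSystem

variable {ι : Type} [DecidableEq ι] {H C : Finset (Finset ι)}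

lemma eq_of_three (h : IsHexadSystem H C) {b b' : Finset ι} (hb : b ∈ H) (hb' : b' ∈ H)
    (x y z : ι) (hxy : x ≠ y) (hxz : x ≠ z) (hyz : y ≠ z) (hx : x ∈ b) (hy : y ∈ b) (hz : z ∈ b)
    (hx' : x ∈ b') (hy' : y ∈ b') (hz' : z ∈ b') : b = b' := by
  by_contra hne
  have : 2 < (b ∩ b').card := Finset.two_lt_card.2 ⟨x, Finset.mem_inter.2 ⟨hx, hx'⟩, y,
    Finset.mem_inter.2 ⟨hy, hy'⟩, z, Finset.mem_inter.2 ⟨hz, hz'⟩, hxy, hxz, hyz⟩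
  have := h.hexad_inter b hb b' hb' hne
  omega

lemma not_four (h : IsHexadSystem H C) {b c : Finset ι} (hb : b ∈ H) (hc : c ∈ C)
    (w x y z : ι) (hwx : w ≠ x) (hwy : w ≠ y) (hwz : w ≠ z) (hxy : x ≠ y) (hxz : x ≠ z)
    (hyz : y ≠ z) (hw : w ∈ b) (hx : x ∈ b) (hy : y ∈ b) (hz : z ∈ b)
    (hw' : w ∈ c) (hx' : x ∈ c) (hy' : y ∈ c) (hz' : z ∈ c) : False := by
  have : 3 < (b ∩ c).card := Finset.three_lt_card.2 ⟨w, Finset.mem_inter.2 ⟨hw, hw'⟩,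
    x, Finset.mem_inter.2 ⟨hx, hx'⟩, y, Finset.mem_inter.2 ⟨hy, hy'⟩,
    z, Finset.mem_inter.2 ⟨hz, hz'⟩, hwx, hwy, hwz, hxy, hxz, hyz⟩
  have := h.mixed_inter b hb c hc
  omega

lemma disjoint_powersetCard {b b' : Finset ι} {n : ℕ} (h : (b ∩ b').card < n) :
    Disjoint (b.powersetCard n) (b'.powersetCard n) := by
  rw [Finset.disjoint_left]
  intro t ht ht'
  rw [Finset.mem_powersetCard] at ht ht'
  have := Finset.card_le_card (Finset.subset_inter ht.1 ht'.1)
  omega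

variable [Fintype ι]

lemma exists_hexad (h : IsHexadSystem H C) (hι : Fintype.card ι = 22) {t : Finset ι}
    (ht : t.card = 3) : ∃ b ∈ H, t ⊆ b := by
  have hcard : (H.biUnion fun b => b.powersetCard 3).card = 1540 := by
    rw [Finset.card_biUnion fun b hb b' hb' hne => disjoint_powersetCard (by
      have := h.hexad_inter b hb b' hb' hne
      omega)]
    rw [Finset.sum_congr rfl fun b hb => by rw [Finset.card_powersetCard, h.card_hexad b hb],
      Finset.sum_const, h.card_hexads]
    rfl
  have heq : (H.biUnion fun b => b.powersetCard 3) = Finset.univ.powersetCard 3 := by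
    refine Finset.eq_of_subset_of_card_le (Finset.biUnion_subset.2 fun b _ =>
      Finset.powersetCard_mono (Finset.subset_univ b)) ?_
    rw [hcard, Finset.card_powersetCard, Finset.card_univ, hι]
    decide
  have hmem : t ∈ H.biUnion fun b => b.powersetCard 3 := by
    rw [heq]
    exact Finset.mem_powersetCard_univ.2 ht
  obtain ⟨b, hb, hbt⟩ := Finset.mem_biUnion.1 hmem
  exact ⟨b, hb, (Finset.mem_powersetCard.1 hbt).1⟩

lemma exists_hexad_or_heptad (h : IsHexadSystem H C) (hι : Fintype.card ι = 22) {t : Finset ι}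
    (ht : t.card = 4) : (∃ b ∈ H, t ⊆ b) ∨ ∃ c ∈ C, t ⊆ c := by
  have hcardH : (H.biUnion fun b => b.powersetCard 4).card = 1155 := by
    rw [Finset.card_biUnion fun b hb b' hb' hne => disjoint_powersetCard (by
      have := h.hexad_inter b hb b' hb' hne
      omega)]
    rw [Finset.sum_congr rfl fun b hb => by rw [Finset.card_powersetCard, h.card_hexad b hb],
      Finset.sum_const, h.card_hexads]
    rfl
  have hcardC : (C.biUnion fun b => b.powersetCard 4).card = 6160 := by
    rw [Finset.card_biUnion fun b hb b' hb' hne => disjoint_powersetCard (by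
      have := h.heptad_inter b hb b' hb' hne
      omega)]
    rw [Finset.sum_congr rfl fun b hb => by rw [Finset.card_powersetCard, h.card_heptad b hb],
      Finset.sum_const, h.card_heptads]
    rfl
  have hdisj : Disjoint (H.biUnion fun b => b.powersetCard 4)
      (C.biUnion fun b => b.powersetCard 4) := by
    rw [Finset.disjoint_biUnion_left]
    intro b hb
    rw [Finset.disjoint_biUnion_right]
    intro c hc
    refine disjoint_powersetCard ?_
    have := h.mixed_inter b hb c hc
    omega
  have heq : ((H.biUnion fun b => b.powersetCard 4) ∪ C.biUnion fun b => b.powersetCard 4) =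
      Finset.univ.powersetCard 4 := by
    refine Finset.eq_of_subset_of_card_le (Finset.union_subset
      (Finset.biUnion_subset.2 fun b _ => Finset.powersetCard_mono (Finset.subset_univ b))
      (Finset.biUnion_subset.2 fun b _ => Finset.powersetCard_mono (Finset.subset_univ b))) ?_
    rw [Finset.card_union_of_disjoint hdisj, hcardH, hcardC, Finset.card_powersetCard,
      Finset.card_univ, hι]
    decide
  have hmem := Finset.mem_powersetCard_univ.2 ht
  rw [← heq, Finset.mem_union, Finset.mem_biUnion, Finset.mem_biUnion] at hmem
  exact hmem.imp (fun ⟨b, hb, hbt⟩ => ⟨b, hb, (Finset.mem_powersetCard.1 hbt).1⟩)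
    fun ⟨b, hb, hbt⟩ => ⟨b, hb, (Finset.mem_powersetCard.1 hbt).1⟩

end IsHexadSystem

/-- A labelled hexad together with a point outside of it. -/
structure IsHexadBase {ι : Type} [Fintype ι] [DecidableEq ι] (H : Finset (Finset ι))
    (a : Fin 6 → ι) (o : ι) : Prop where
  injective : Function.Injective a
  image_mem : Finset.univ.image a ∈ H
  ne : ∀ i, a i ≠ o

/-- Some hexad contains the four given points. -/
def InHexad {ι : Type} (H : Finset (Finset ι)) (w x y z : ι) : Prop :=
  ∃ b ∈ H, w ∈ b ∧ x ∈ b ∧ y ∈ b ∧ z ∈ b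

namespace IsHexadBase

variable {ι : Type} [Fintype ι] [DecidableEq ι] {H C : Finset (Finset ι)} {a : Fin 6 → ι} {o : ι}

lemma exists_isHexadBase (h : IsHexadSystem H C) (hι : Fintype.card ι = 22) :
    ∃ (a : Fin 6 → ι) (o : ι), IsHexadBase H a o := by
  obtain ⟨b, hb⟩ : H.Nonempty := Finset.card_pos.1 (by rw [h.card_hexads]; norm_num)
  have e : b ≃ Fin 6 := b.equivFinOfCardEq (h.card_hexad b hb)
  obtain ⟨o, ho⟩ : ∃ o, o ∉ b := by
    by_contra! hall
    have := Finset.card_le_card fun x (_ : x ∈ Finset.univ) => hall x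
    rw [Finset.card_univ, hι, h.card_hexad b hb] at this
    omega
  have him : Finset.univ.image (fun i => (e.symm i : ι)) = b := by
    ext x
    simp only [Finset.mem_image, Finset.mem_univ, true_and]
    exact ⟨fun ⟨i, hi⟩ => hi ▸ (e.symm i).2, fun hx => ⟨e ⟨x, hx⟩, by simp⟩⟩
  refine ⟨fun i => e.symm i, o, fun i j hij => e.symm.injective (Subtype.ext hij), by rwa [him],
    fun i hi => ho (hi ▸ (e.symm i).2)⟩

lemma not_mem (hB : IsHexadBase H a o) : o ∉ Finset.univ.image a := by
  simpa using hB.ne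

lemma not_mem_of_three (h : IsHexadSystem H C) (hB : IsHexadBase H a o) {b : Finset ι}
    (hb : b ∈ H) (ho : o ∈ b) {i j k : Fin 6} (hij : i ≠ j) (hik : i ≠ k) (hjk : j ≠ k)
    (hi : a i ∈ b) (hj : a j ∈ b) : a k ∉ b := fun hk => by
  refine hB.not_mem ?_
  rw [← h.eq_of_three hb hB.image_mem (a i) (a j) (a k) (hB.injective.ne hij)
    (hB.injective.ne hik) (hB.injective.ne hjk) hi hj hk (by simp) (by simp) (by simp)]
  exact ho

lemma exists_partner (h : IsHexadSystem H C) (hι : Fintype.card ι = 22) (hB : IsHexadBase H a o)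
    {x : ι} (hx : ∀ i, a i ≠ x) (hxo : x ≠ o) (i : Fin 6) :
    ∃ j, j ≠ i ∧ InHexad H o x (a i) (a j) := by
  obtain ⟨b, hb, hsub⟩ := h.exists_hexad hι (t := {a i, o, x}) (Finset.card_eq_three.2
    ⟨a i, o, x, hB.ne i, hx i, hxo.symm, rfl⟩)
  have hai : a i ∈ b := hsub (by simp)
  have ho : o ∈ b := hsub (by simp)
  have hne : b ≠ Finset.univ.image a := fun e => hB.not_mem (e ▸ ho)
  have hpos : 0 < (b ∩ Finset.univ.image a).card :=
    Finset.card_pos.2 ⟨a i, Finset.mem_inter.2 ⟨hai, by simp⟩⟩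
  have h2 := h.hexad_inter b hb _ hB.image_mem hne
  obtain ⟨y, hy, hyne⟩ := Finset.exists_mem_ne (s := b ∩ Finset.univ.image a) (by omega) (a i)
  obtain ⟨hyb, hya⟩ := Finset.mem_inter.1 hy
  obtain ⟨j, -, rfl⟩ := Finset.mem_image.1 hya
  exact ⟨j, fun e => hyne (by rw [e]), b, hb, ho, hsub (by simp), hai, hyb⟩

lemma partner_unique (h : IsHexadSystem H C) (hB : IsHexadBase H a o)
    {x : ι} (hx : ∀ i, a i ≠ x) (hxo : x ≠ o) {i j k : Fin 6} (hj : j ≠ i) (hk : k ≠ i)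
    (hij : InHexad H o x (a i) (a j)) (hik : InHexad H o x (a i) (a k)) : j = k := by
  obtain ⟨b, hb, b1, b2, b3, b4⟩ := hij
  obtain ⟨b', hb', c1, c2, c3, c4⟩ := hik
  have := h.eq_of_three hb hb' o x (a i) hxo.symm (hB.ne i).symm (hx i).symm b1 b2 b3 c1 c2 c3
  subst this
  by_contra hne
  exact hB.not_mem_of_three h hb b1 hj.symm hk.symm hne b3 b4 c4

lemma exists_syntheme (h : IsHexadSystem H C) (hι : Fintype.card ι = 22) (hB : IsHexadBase H a o)
    {x : ι} (hx : ∀ i, a i ≠ x) (hxo : x ≠ o) :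
    ∃ s, ∀ i, InHexad H o x (a i) (a (synthemes s i)) := by
  choose f hf hf' using hB.exists_partner h hι hx hxo
  have hinv (i) : f (f i) = i := by
    refine hB.partner_unique h hx hxo (hf _) (hf i).symm (hf' _) ?_
    obtain ⟨b, hb, b1, b2, b3, b4⟩ := hf' i
    exact ⟨b, hb, b1, b2, b4, b3⟩
  obtain ⟨s, rfl⟩ := exists_synthemes f hf hinv
  exact ⟨s, hf'⟩

lemma synthemes_ne : ∀ s i, synthemes s i ≠ i := by decide

lemma eq_of_syntheme (h : IsHexadSystem H C) (hB : IsHexadBase H a o)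
    {x x' : ι} (hxo : x ≠ o) (hxo' : x' ≠ o) {s : Fin 15}
    (hs : ∀ i, InHexad H o x (a i) (a (synthemes s i)))
    (hs' : ∀ i, InHexad H o x' (a i) (a (synthemes s i))) : x = x' := by
  have key (i : Fin 6) : ∃ b ∈ H, o ∈ b ∧ x ∈ b ∧ x' ∈ b ∧ a i ∈ b ∧ a (synthemes s i) ∈ b := by
    obtain ⟨b, hb, b1, b2, b3, b4⟩ := hs i
    obtain ⟨b', hb', c1, c2, c3, c4⟩ := hs' i
    have := h.eq_of_three hb hb' o (a i) (a (synthemes s i)) (hB.ne _).symm (hB.ne _).symm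
      (hB.injective.ne (synthemes_ne s i).symm) b1 b3 b4 c1 c3 c4
    subst this
    exact ⟨b, hb, b1, b2, c2, b3, b4⟩
  by_contra hne
  obtain ⟨k, hk0, hk⟩ : ∃ k : Fin 6, 0 ≠ k ∧ synthemes s 0 ≠ k := by
    clear hs hs' key
    revert s
    decide
  obtain ⟨b, hb, b1, b2, b3, b4, b5⟩ := key 0
  obtain ⟨b', hb', c1, c2, c3, c4, c5⟩ := key k
  have := h.eq_of_three hb hb' o x x' hxo.symm hxo'.symm hne b1 b2 b3 c1 c2 c3
  subst this
  exact hB.not_mem_of_three h hb b1 (synthemes_ne s 0).symm hk0 hk b4 b5 c4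

end IsHexadBase

end HexadCombinatorics

section HexadLabelling

/-- Eleven hexads in standard coordinates. -/
def standardHexads : Finset (Finset (Fin 22)) :=
  {{0, 1, 2, 3, 4, 5}, {0, 1, 6, 7, 8, 9}, {0, 2, 6, 10, 11, 12}, {0, 3, 6, 13, 14, 15},
    {0, 4, 6, 16, 17, 18}, {0, 5, 6, 19, 20, 21}, {1, 2, 6, 13, 16, 19}, {1, 3, 6, 10, 17, 20},
    {1, 4, 6, 11, 14, 21}, {2, 3, 6, 7, 18, 21}, {2, 4, 6, 8, 15, 20}}

/-- A heptad in standard coordinates. -/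
def standardHeptad : Finset (Fin 22) := {0, 1, 2, 6, 14, 18, 20}

namespace IsHexadBase

variable {ι : Type} [Fintype ι] [DecidableEq ι] {H C : Finset (Finset ι)} {a : Fin 6 → ι} {o : ι}

lemma exists_points (h : IsHexadSystem H C) (hι : Fintype.card ι = 22) (hB : IsHexadBase H a o) :
    ∃ e : Fin 15 → ι, Function.Injective e ∧ (∀ s i, a i ≠ e s) ∧ (∀ s, e s ≠ o) ∧
      (∀ x, (∀ i, a i ≠ x) → x ≠ o → ∃ s, e s = x) ∧
      ∀ s i, InHexad H o (e s) (a i) (a (synthemes s i)) := by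
  set R := (insert o (Finset.univ.image a))ᶜ with hR
  have hcard : R.card = 15 := by
    rw [hR, Finset.card_compl, Finset.card_insert_of_notMem hB.not_mem, h.card_hexad _ hB.image_mem,
      hι]
  have hmem (x : ι) : x ∈ R ↔ (∀ i, a i ≠ x) ∧ x ≠ o := by
    simp only [hR, Finset.mem_compl, Finset.mem_insert, Finset.mem_image, Finset.mem_univ,
      true_and, not_or, not_exists]
    exact and_comm
  choose f hf using fun x : R => hB.exists_syntheme h hι ((hmem x).1 x.2).1 ((hmem x).1 x.2).2
  have hinj : Function.Injective f := fun x y hxy => Subtype.ext <|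
    hB.eq_of_syntheme h ((hmem x).1 x.2).2 ((hmem y).1 y.2).2 (hf x) (hxy ▸ hf y)
  have hbij : Function.Bijective f := (Fintype.bijective_iff_injective_and_card f).2
    ⟨hinj, by rw [Fintype.card_coe, hcard, Fintype.card_fin]⟩
  set g := Equiv.ofBijective f hbij with hg
  have hfg (s) : f (g.symm s) = s := g.apply_symm_apply s
  refine ⟨fun s => g.symm s, fun s t hst => g.symm.injective (Subtype.ext hst),
    fun s => ((hmem _).1 (g.symm s).2).1, fun s => ((hmem _).1 (g.symm s).2).2,
    fun x hx hxo => ⟨g ⟨x, (hmem x).2 ⟨hx, hxo⟩⟩, by simp⟩, fun s => ?_⟩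
  have := hf (g.symm s)
  rwa [hfg] at this

/-- After relabelling, some heptad contains the first three points of the base hexad, the outer
point, and a point inducing the standard matching. -/
lemma exists_adapted (h : IsHexadSystem H C) (hι : Fintype.card ι = 22) :
    ∃ (a : Fin 6 → ι) (o : ι), IsHexadBase H a o ∧ ∃ c ∈ C, ∃ x ∈ c, o ∈ c ∧ a 0 ∈ c ∧ a 1 ∈ c ∧
      a 2 ∈ c ∧ (∀ i, a i ≠ x) ∧ x ≠ o ∧ InHexad H o x (a 0) (a 3) ∧ InHexad H o x (a 1) (a 4) ∧
      InHexad H o x (a 2) (a 5) := by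
  obtain ⟨a, o, hB⟩ := exists_isHexadBase h hι
  have hcard : ({o, a 0, a 1, a 2} : Finset ι).card = 4 := by
    rw [Finset.card_insert_of_notMem, Finset.card_eq_three.2 ⟨a 0, a 1, a 2,
      hB.injective.ne (by decide), hB.injective.ne (by decide), hB.injective.ne (by decide), rfl⟩]
    simp [(hB.ne _).symm]
  have hnot : ¬ ∃ b ∈ H, ({o, a 0, a 1, a 2} : Finset ι) ⊆ b := fun ⟨b, hb, hsub⟩ =>
    hB.not_mem_of_three h hb (hsub (by simp)) (i := 0) (j := 1) (k := 2) (by decide) (by decide)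
      (by decide) (hsub (by simp)) (hsub (by simp)) (hsub (by simp))
  obtain ⟨c, hc, hsub⟩ := (h.exists_hexad_or_heptad hι hcard).resolve_left hnot
  have ho : o ∈ c := hsub (by simp)
  have hac (i : Fin 6) (hi : i < 3) : a i ∈ c := by
    refine hsub ?_
    have : i = 0 ∨ i = 1 ∨ i = 2 := by revert i; decide
    rcases this with rfl | rfl | rfl <;> simp
  have hinter : (c ∩ Finset.univ.image a).card ≤ 3 := by
    have := h.mixed_inter _ hB.image_mem c hc
    rw [Finset.inter_comm] at this
    omega
  obtain ⟨x, hx⟩ : ∃ x, x ∈ (c \ Finset.univ.image a).erase o := by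
    refine Finset.card_pos.1 ?_
    have h7 := h.card_heptad c hc
    have := Finset.card_inter_add_card_sdiff c (Finset.univ.image a)
    have := Finset.pred_card_le_card_erase (s := c \ Finset.univ.image a) (a := o)
    omega
  obtain ⟨hxo, hx⟩ := Finset.mem_erase.1 hx
  obtain ⟨hxc, hxa⟩ := Finset.mem_sdiff.1 hx
  have hxa : ∀ i, a i ≠ x := by simpa using hxa
  choose f hf hf' using hB.exists_partner h hι hxa hxo
  have hf3 (i : Fin 6) (hi : i < 3) : 3 ≤ f i := by
    by_contra! hlt
    obtain ⟨b, hb, b1, b2, b3, b4⟩ := hf' i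
    exact h.not_four hb hc o x (a i) (a (f i)) hxo.symm (hB.ne _).symm (hB.ne _).symm (hxa _).symm
      (hxa _).symm (hB.injective.ne (hf i).symm) b1 b2 b3 b4 ho hxc (hac i hi) (hac _ hlt)
  have hfinj (i j : Fin 6) (hij : i ≠ j) : f i ≠ f j := fun e => by
    refine hij (hB.partner_unique h hxa hxo (i := f i) (hf i).symm (e ▸ (hf j).symm) ?_ ?_)
    · obtain ⟨b, hb, b1, b2, b3, b4⟩ := hf' i
      exact ⟨b, hb, b1, b2, b4, b3⟩
    · obtain ⟨b, hb, b1, b2, b3, b4⟩ := hf' j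
      exact ⟨b, hb, b1, b2, e ▸ b4, b3⟩
  have hperm : ∀ l : Fin 6, 3 ≤ l → ∀ m : Fin 6, 3 ≤ m → ∀ n : Fin 6, 3 ≤ n → l ≠ m → l ≠ n →
      m ≠ n → Function.Bijective ![0, 1, 2, l, m, n] := by
    decide
  have hbij := hperm (f 0) (hf3 0 (by decide)) (f 1) (hf3 1 (by decide)) (f 2) (hf3 2 (by decide))
    (hfinj _ _ (by decide)) (hfinj _ _ (by decide)) (hfinj _ _ (by decide))
  refine ⟨a ∘ ![0, 1, 2, f 0, f 1, f 2], o,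
    ⟨hB.injective.comp hbij.injective, ?_, fun i => hB.ne _⟩,
    c, hc, x, hxc, ho, hac 0 (by decide), hac 1 (by decide), hac 2 (by decide), fun i => hxa _, hxo,
    hf' 0, hf' 1, hf' 2⟩
  rw [← Finset.image_image, Finset.image_univ_of_surjective hbij.surjective]
  exact hB.image_mem

end IsHexadBase

namespace IsHexadSystem

variable {ι : Type} [Fintype ι] [DecidableEq ι] {H C : Finset (Finset ι)}

/-- Every hexad system contains the standard hexads and the standard heptad in a suitable
labelling. -/
theorem exists_labelling (h : IsHexadSystem H C) (hι : Fintype.card ι = 22) :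
    ∃ φ : Fin 22 ≃ ι, (∀ b ∈ standardHexads, b.image φ ∈ H) ∧ standardHeptad.image φ ∈ C := by
  obtain ⟨a, o, hB, c, hc, x, hxc, hoc, h0, h1, h2, hxa, hxo, h03, h14, h25⟩ :=
    IsHexadBase.exists_adapted h hι
  obtain ⟨e, he, hae, heo, hsurj, hmem⟩ := hB.exists_points h hι
  set φ : Fin 22 → ι := Fin.append (m := 6) (n := 16) a (Fin.cons o e) with hφ
  have hinj : Function.Injective φ := by
    rw [hφ, Fin.append_injective_iff, Fin.cons_injective_iff]
    refine ⟨hB.injective, ⟨?_, he⟩, fun i => Fin.cases (hB.ne i) fun s => hae s i⟩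
    rintro ⟨s, hs⟩
    exact heo s hs
  have hbij : Function.Bijective φ := (Fintype.bijective_iff_injective_and_card φ).2
    ⟨hinj, by rw [Fintype.card_fin, hι]⟩
  have hpair (i j : Fin 6) (s t u : Fin 15) (hs : synthemes s i = j) (ht : synthemes t i = j)
      (hu : synthemes u i = j) (hst : s ≠ t) (hsu : s ≠ u) (htu : t ≠ u) :
      ({a i, a j, o, e s, e t, e u} : Finset ι) ∈ H := by
    have hij : i ≠ j := hs ▸ (IsHexadBase.synthemes_ne s i).symm
    obtain ⟨b, hb, b1, b2, b3, b4⟩ := hs ▸ hmem s i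
    obtain ⟨b', hb', c1, c2, c3, c4⟩ := ht ▸ hmem t i
    obtain ⟨b'', hb'', d1, d2, d3, d4⟩ := hu ▸ hmem u i
    obtain rfl := h.eq_of_three hb hb' o (a i) (a j) (hB.ne _).symm (hB.ne _).symm
      (hB.injective.ne hij) b1 b3 b4 c1 c3 c4
    obtain rfl := h.eq_of_three hb hb'' o (a i) (a j) (hB.ne _).symm (hB.ne _).symm
      (hB.injective.ne hij) b1 b3 b4 d1 d3 d4
    convert hb
    refine Finset.eq_of_subset_of_card_le ?_ ?_
    · simp only [Finset.insert_subset_iff, Finset.singleton_subset_iff]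
      exact ⟨b3, b4, b1, b2, c2, d2⟩
    · rw [h.card_hexad b hb]
      simp [Finset.card_insert_of_notMem, hB.injective.ne hij, hB.ne, hae, (heo _).symm,
        he.ne hst, he.ne hsu, he.ne htu]
  have hac (i : Fin 6) (hi : i < 3) : a i ∈ c := by
    have : i = 0 ∨ i = 1 ∨ i = 2 := by revert i; decide
    rcases this with rfl | rfl | rfl <;> assumption
  have hge (s : Fin 15) (hs : e s ∈ c) (i : Fin 6) (hi : i < 3) : 3 ≤ synthemes s i := by
    by_contra! hlt
    obtain ⟨b, hb, b1, b2, b3, b4⟩ := hmem s i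
    exact h.not_four hb hc o (e s) (a i) (a (synthemes s i)) (heo _).symm (hB.ne _).symm
      (hB.ne _).symm (hae _ _).symm (hae _ _).symm
      (hB.injective.ne (IsHexadBase.synthemes_ne s i).symm) b1 b2 b3 b4 hoc hs (hac i hi)
      (hac _ hlt)
  have hne (s t : Fin 15) (hst : s ≠ t) (hs : e s ∈ c) (ht : e t ∈ c) (i : Fin 6) (hi : i < 3) :
      synthemes t i ≠ synthemes s i := fun hti => by
    obtain ⟨b, hb, b1, b2, b3, b4⟩ := hmem s i
    obtain ⟨b', hb', c1, c2, c3, c4⟩ := hti ▸ hmem t i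
    obtain rfl := h.eq_of_three hb hb' o (a i) (a (synthemes s i)) (hB.ne _).symm (hB.ne _).symm
      (hB.injective.ne (IsHexadBase.synthemes_ne s i).symm) b1 b3 b4 c1 c3 c4
    exact h.not_four hb hc o (e s) (e t) (a i) (heo _).symm (heo _).symm (hB.ne _).symm
      (he.ne hst) (hae _ _).symm (hae _ _).symm b1 b2 c2 b3 hoc hs ht (hac i hi)
  have hx7 : e 7 = x := by
    obtain ⟨s, rfl⟩ := hsurj x hxa hxo
    congr 1
    refine (synthemes_zero ?_ ?_ ?_).symm
    · exact hB.partner_unique h hxa hxo (IsHexadBase.synthemes_ne _ _) (by decide) (hmem s 0) h03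
    · exact hB.partner_unique h hxa hxo (IsHexadBase.synthemes_ne _ _) (by decide) (hmem s 1) h14
    · exact hB.partner_unique h hxa hxo (IsHexadBase.synthemes_ne _ _) (by decide) (hmem s 2) h25
  subst hx7
  have hsub : c ⊆ {a 0, a 1, a 2, o, e 7, e 11, e 13} := by
    intro y hy
    by_cases hyo : y = o
    · simp [hyo]
    by_cases hya : ∃ i, a i = y
    · obtain ⟨i, rfl⟩ := hya
      have hi : i < 3 := by
        by_contra! hi
        have h4 : 3 < (Finset.univ.image a ∩ c).card := by
          refine Finset.three_lt_card.2 ⟨a 0, ?_, a 1, ?_, a 2, ?_, a i, ?_,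
            hB.injective.ne (by decide), hB.injective.ne (by decide), hB.injective.ne ?_,
            hB.injective.ne (by decide), hB.injective.ne ?_, hB.injective.ne ?_⟩
          · simp [h0]
          · simp [h1]
          · simp [h2]
          · simp [hy]
          all_goals
            rintro rfl
            revert hi
            decide
        have := h.mixed_inter _ hB.image_mem c hc
        omega
      have : i = 0 ∨ i = 1 ∨ i = 2 := by
        revert hi
        clear hy hyo
        revert i
        decide
      rcases this with rfl | rfl | rfl <;> simp
    · obtain ⟨s, rfl⟩ := hsurj y (not_exists.1 hya) hyo
      by_cases hs : 7 = s
      · simp [← hs]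
      · rcases synthemes_transversal s (hge s hy) (hne 7 s hs hxc hy) with rfl | rfl <;> simp
  have hceq : ({a 0, a 1, a 2, o, e 7, e 11, e 13} : Finset ι) ∈ C := by
    convert hc
    refine (Finset.eq_of_subset_of_card_le hsub ?_).symm
    rw [h.card_heptad c hc]
    exact (Finset.card_insert_le _ _).trans (Nat.succ_le_succ Finset.card_le_six)
  refine ⟨Equiv.ofBijective φ hbij, ?_, ?_⟩
  · simp only [standardHexads, Finset.forall_mem_insert, Finset.mem_singleton, forall_eq,
      Equiv.ofBijective_apply, Finset.image_insert, Finset.image_singleton]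
    refine ⟨?_, hpair 0 1 0 1 2 rfl rfl rfl (by decide) (by decide) (by decide),
      hpair 0 2 3 4 5 rfl rfl rfl (by decide) (by decide) (by decide),
      hpair 0 3 6 7 8 rfl rfl rfl (by decide) (by decide) (by decide),
      hpair 0 4 9 10 11 rfl rfl rfl (by decide) (by decide) (by decide),
      hpair 0 5 12 13 14 rfl rfl rfl (by decide) (by decide) (by decide),
      hpair 1 2 6 9 12 rfl rfl rfl (by decide) (by decide) (by decide),
      hpair 1 3 3 10 13 rfl rfl rfl (by decide) (by decide) (by decide),
      hpair 1 4 4 7 14 rfl rfl rfl (by decide) (by decide) (by decide),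
      hpair 2 3 0 11 14 rfl rfl rfl (by decide) (by decide) (by decide),
      hpair 2 4 1 8 13 rfl rfl rfl (by decide) (by decide) (by decide)⟩
    have := hB.image_mem
    rw [show (Finset.univ : Finset (Fin 6)) = {0, 1, 2, 3, 4, 5} by decide] at this
    simp only [Finset.image_insert, Finset.image_singleton] at this
    exact this
  · simp only [standardHeptad, Equiv.ofBijective_apply, Finset.image_insert,
      Finset.image_singleton]
    exact hceq

end IsHexadSystem

end HexadLabelling

section BinaryCode

/-- The matrix over `ZMod 2` whose rows are the indicators of the given sets. -/
def indicatorMatrix {m n : ℕ} (W : Fin m → Finset (Fin n)) : Matrix (Fin m) (Fin n) (ZMod 2) :=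
  Matrix.of fun i j => if j ∈ W i then 1 else 0

/-- Generators of the binary code: the standard hexads and the standard heptad, extended by two
further coordinates. -/
def codeWords : Fin 12 → Finset (Fin 24) :=
  ![{0, 1, 2, 3, 4, 5, 22, 23}, {0, 1, 6, 7, 8, 9, 22, 23}, {0, 2, 6, 10, 11, 12, 22, 23},
    {0, 3, 6, 13, 14, 15, 22, 23}, {0, 4, 6, 16, 17, 18, 22, 23}, {0, 5, 6, 19, 20, 21, 22, 23},
    {1, 2, 6, 13, 16, 19, 22, 23}, {1, 3, 6, 10, 17, 20, 22, 23}, {1, 4, 6, 11, 14, 21, 22, 23},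
    {2, 3, 6, 7, 18, 21, 22, 23}, {2, 4, 6, 8, 15, 20, 22, 23}, {0, 1, 2, 6, 14, 18, 20, 23}]

/-- A right inverse of the generator matrix. -/
def codeSections : Fin 24 → Finset (Fin 12) :=
  ![{4, 9}, {6, 9}, ∅, ∅, ∅, {4, 5}, {0, 5, 6, 9}, ∅, {9, 10}, {1, 4, 6, 10}, {6, 7},
    {3, 4, 6, 8}, {2, 3, 7, 8}, ∅, {3, 4}, ∅, ∅, ∅, ∅, ∅, ∅, ∅, {3, 6, 9, 11}, {0, 3, 5, 9, 11}]

/-- Coordinates of a code word with respect to the generators. -/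
def codeCoordinates : Fin 12 → Finset (Fin 24) :=
  ![{3, 15, 16, 18, 19, 20}, {7, 13, 15, 17, 18, 19, 20}, {2, 4, 13, 15, 17, 20, 21},
    {3, 4, 13, 15, 17, 19, 21}, {3, 4, 15, 16, 17, 19, 21}, {3, 4, 15, 17, 21},
    {3, 4, 15, 17, 19, 21}, {3, 4, 15, 16, 19, 21}, {3, 4, 13, 18, 19, 20},
    {13, 15, 17, 18, 19, 20}, {3, 4, 13, 17, 19, 21}, {3, 4, 13, 16, 20, 21}]

set_option maxRecDepth 4000 in
lemma card_code_mod_two : ∀ i j : Fin 24,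
    ((Finset.univ.filter fun k => k ∈ codeSections i ∧ j ∈ codeWords k).card +
      (Finset.univ.filter fun k => i ∈ codeWords k ∧ j ∈ codeCoordinates k).card) % 2 =
      if i = j then 1 else 0 := by
  decide +kernel

lemma one_eq_code : (1 : Matrix (Fin 24) (Fin 24) (ZMod 2)) =
    indicatorMatrix codeSections * indicatorMatrix codeWords +
      (indicatorMatrix codeWords).transpose * indicatorMatrix codeCoordinates := by
  ext i j
  have := congrArg (Nat.cast : ℕ → ZMod 2) (card_code_mod_two i j)
  rw [ZMod.natCast_mod, Nat.cast_add, ← Finset.sum_boole, ← Finset.sum_boole, Nat.cast_ite,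
    Nat.cast_one, Nat.cast_zero] at this
  simp only [Matrix.add_apply, Matrix.mul_apply, Matrix.one_apply, Matrix.transpose_apply,
    indicatorMatrix, Matrix.of_apply, ite_mul, one_mul, zero_mul, ← ite_and]
  exact this.symm

open Matrix in
/-- The dual of the code is self-orthogonal. -/
lemma dotProduct_eq_zero_of_codeWords {u v : Fin 24 → ZMod 2} (hu : ∀ k, ∑ i ∈ codeWords k, u i = 0)
    (hv : ∀ k, ∑ i ∈ codeWords k, v i = 0) : u ⬝ᵥ v = 0 := by
  have hmul (w : Fin 24 → ZMod 2) (hw : ∀ k, ∑ i ∈ codeWords k, w i = 0) :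
      indicatorMatrix codeWords *ᵥ w = 0 := by
    funext k
    simpa [Matrix.mulVec, dotProduct, indicatorMatrix] using hw k
  rw [← Matrix.one_mulVec v, one_eq_code, Matrix.add_mulVec, ← Matrix.mulVec_mulVec,
    ← Matrix.mulVec_mulVec, hmul v hv, Matrix.mulVec_zero, zero_add, Matrix.dotProduct_mulVec,
    Matrix.vecMul_transpose, hmul u hu, zero_dotProduct]

/-- Parity conditions satisfied by the coordinates of a vector of the dual lattice. -/
structure IsCodeVector (Z : Fin 22 → ℤ) (h k : ℤ) : Prop where
  hexad : ∀ b ∈ standardHexads, Even (∑ i ∈ b, Z i + h + k)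
  heptad : Even (∑ i ∈ standardHeptad, Z i + k)

/-- The vector with coordinates `Z` followed by `h` and `k`, modulo two. -/
def extendedVector (Z : Fin 22 → ℤ) (h k : ℤ) (i : Fin 24) : ZMod 2 :=
  if hi : i.1 < 22 then Z ⟨i, hi⟩ else if i.1 = 22 then h else k

lemma sum_extendedVector (Z : Fin 22 → ℤ) (h k : ℤ) (b : Finset (Fin 22)) :
    ∑ i ∈ b.map (Fin.castLEEmb (by norm_num)), extendedVector Z h k i =
      ∑ i ∈ b, (Z i : ZMod 2) := by
  rw [Finset.sum_map]
  refine Finset.sum_congr rfl fun i _ => ?_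
  simp [extendedVector]

lemma IsCodeVector.sum_codeWords {Z : Fin 22 → ℤ} {h k : ℤ} (hZ : IsCodeVector Z h k)
    (j : Fin 12) : ∑ i ∈ codeWords j, extendedVector Z h k i = 0 := by
  have e22 : extendedVector Z h k 22 = h := rfl
  have e23 : extendedVector Z h k 23 = k := rfl
  have hexad {b : Finset (Fin 22)} {W : Finset (Fin 24)} (hb : b ∈ standardHexads)
      (hW : W = insert 22 (insert 23 (b.map (Fin.castLEEmb (by norm_num))))) :
      ∑ i ∈ W, extendedVector Z h k i = 0 := by
    have h22 : (22 : Fin 24) ∉ insert 23 (b.map (Fin.castLEEmb (n := 22) (by norm_num))) := by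
      simp only [Finset.mem_insert, Finset.mem_map, Fin.castLEEmb_apply, Fin.ext_iff, not_or]
      refine ⟨by decide, ?_⟩
      rintro ⟨i, -, hi⟩
      exact i.2.ne hi
    have h23 : (23 : Fin 24) ∉ b.map (Fin.castLEEmb (n := 22) (by norm_num)) := by
      simp only [Finset.mem_map, Fin.castLEEmb_apply, Fin.ext_iff]
      rintro ⟨i, -, hi⟩
      exact (i.2.trans (by norm_num : 22 < 23)).ne hi
    have := (ZMod.intCast_eq_zero_iff_even).2 (hZ.hexad b hb)
    push_cast at this
    rw [hW, Finset.sum_insert h22, Finset.sum_insert h23, sum_extendedVector, e22, e23, ← this]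
    ring
  have heptad : ∑ i ∈ insert 23 (standardHeptad.map (Fin.castLEEmb (by norm_num))),
      extendedVector Z h k i = 0 := by
    have := (ZMod.intCast_eq_zero_iff_even).2 hZ.heptad
    push_cast at this
    rw [Finset.sum_insert (by decide), sum_extendedVector, e23, ← this]
    ring
  fin_cases j
  · exact hexad (b := {0, 1, 2, 3, 4, 5}) (by decide) (by decide)
  · exact hexad (b := {0, 1, 6, 7, 8, 9}) (by decide) (by decide)
  · exact hexad (b := {0, 2, 6, 10, 11, 12}) (by decide) (by decide)
  · exact hexad (b := {0, 3, 6, 13, 14, 15}) (by decide) (by decide)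
  · exact hexad (b := {0, 4, 6, 16, 17, 18}) (by decide) (by decide)
  · exact hexad (b := {0, 5, 6, 19, 20, 21}) (by decide) (by decide)
  · exact hexad (b := {1, 2, 6, 13, 16, 19}) (by decide) (by decide)
  · exact hexad (b := {1, 3, 6, 10, 17, 20}) (by decide) (by decide)
  · exact hexad (b := {1, 4, 6, 11, 14, 21}) (by decide) (by decide)
  · exact hexad (b := {2, 3, 6, 7, 18, 21}) (by decide) (by decide)
  · exact hexad (b := {2, 4, 6, 8, 15, 20}) (by decide) (by decide)
  · convert heptad using 2
    decide

lemma IsCodeVector.even_pairing {Z Z' : Fin 22 → ℤ} {h h' k k' : ℤ} (hZ : IsCodeVector Z h k)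
    (hZ' : IsCodeVector Z' h' k') : Even (∑ i, Z i * Z' i + h * h' + k * k') := by
  have := dotProduct_eq_zero_of_codeWords hZ.sum_codeWords hZ'.sum_codeWords
  rw [dotProduct, Fin.sum_univ_castSucc (n := 23), Fin.sum_univ_castSucc (n := 22)] at this
  rw [← ZMod.intCast_eq_zero_iff_even]
  push_cast
  rw [← this]
  congr 2

end BinaryCode

section Uniqueness

local notation "E" => EuclideanSpace ℝ (Fin 22)

/-- A frame whose hexads and heptads include the standard ones. -/
structure IsStandardFrame (A B : Finset (EuclideanSpace ℝ (Fin 22)))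
    (y₀ : EuclideanSpace ℝ (Fin 22)) (p : Fin 22 → EuclideanSpace ℝ (Fin 22)) : Prop
    extends IsFrame A B y₀ p where
  exists_hexad : ∀ b ∈ standardHexads, ∃ x ∈ A, ⟪x, y₀⟫ = 4 / 5 ∧ frameSupport p x = b
  exists_heptad : ∃ x ∈ A, ⟪x, y₀⟫ = -1 / 5 ∧ (frameSupport p x)ᶜ = standardHeptad

lemma frameSupport_comp (p : Fin 22 → E) (φ : Fin 22 ≃ Fin 22) (x : E) :
    frameSupport (p ∘ φ) x = (frameSupport p x).image φ.symm := by
  ext i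
  simp [frameSupport, ← Equiv.eq_symm_apply]

namespace IsLifted

variable {A B : Finset E}

lemma exists_isStandardFrame (h : IsLifted A B) :
    ∃ (y₀ : E) (p : Fin 22 → E), IsStandardFrame A B y₀ p := by
  obtain ⟨y₀, p, hF⟩ := h.exists_isFrame
  obtain ⟨φ, hH, hC⟩ := (hF.isHexadSystem h).exists_labelling (Fintype.card_fin 22)
  refine ⟨y₀, p ∘ φ, hF.reindex φ, fun b hb => ?_, ?_⟩
  · obtain ⟨x, hx, hxb⟩ := Finset.mem_image.1 (hH b hb)
    obtain ⟨hxA, hxy⟩ := Finset.mem_filter.1 hx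
    refine ⟨x, hxA, hxy, ?_⟩
    rw [frameSupport_comp, hxb, Finset.image_image]
    simp
  · obtain ⟨x, hx, hxb⟩ := Finset.mem_image.1 hC
    obtain ⟨hxA, hxy⟩ := Finset.mem_filter.1 hx
    refine ⟨x, hxA, hxy, ?_⟩
    ext i
    simpa [frameSupport] using Finset.ext_iff.1 hxb (φ i)

end IsLifted

namespace IsStandardFrame

variable {A B A' B' : Finset E} {y₀ y₀' : E} {p p' : Fin 22 → E}

lemma exists_isCodeVector (hF : IsStandardFrame A B y₀ p) (h : IsLifted A B) {z : E × ℝ}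
    (hz : HasIntPairings A B z) {n : ℤ} (hn : z.2 = n) :
    ∃ (Z : Fin 22 → ℤ) (k : ℤ), (∀ i, liftPairing z (p i, 3) = Z i) ∧
      liftPairing z (y₀, 1) = k ∧ IsCodeVector Z n k := by
  choose Z hZ using fun i => hz (p i, 3) (Or.inl ⟨hF.mem_left i, rfl⟩)
  obtain ⟨k, hk⟩ := hz (y₀, 1) (Or.inr ⟨hF.mem_right, rfl⟩)
  have hbase := hF.liftPairing_base z
  have pair {x : E} (hx : x ∈ A) (hxy : ⟪x, y₀⟫ ≠ -6 / 5) :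
      ∃ m : ℤ, (m : ℝ) = (∑ i ∈ frameSupport p x, (Z i : ℝ) - n * 3 -
        3 * k * (⟪x, y₀⟫ + 1 / 5)) / 2 + n * (⟪x, y₀⟫ + 1 / 5) + 3 * k := by
    obtain ⟨m, hm⟩ := hz (x, 3) (Or.inl ⟨hx, rfl⟩)
    refine ⟨m, ?_⟩
    rw [← hm, hF.liftPairing_eq]
    simp only [hF.liftPairing_frame h hx hxy, hZ, hk, hn, mul_ite, mul_one, mul_zero,
      Finset.sum_ite_mem, Finset.univ_inter]
    simp only [liftPairing]
    norm_num
  refine ⟨Z, k, hZ, hk, fun b hb => ?_, ?_⟩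
  · obtain ⟨x, hx, hxy, rfl⟩ := hF.exists_hexad b hb
    obtain ⟨m, hm⟩ := pair hx (by rw [hxy]; norm_num)
    rw [hxy] at hm
    refine ⟨m + n - k, ?_⟩
    rify
    linarith
  · obtain ⟨x, hx, hxy, hxb⟩ := hF.exists_heptad
    obtain ⟨m, hm⟩ := pair hx (by rw [hxy]; norm_num)
    have hsum := Finset.sum_add_sum_compl (frameSupport p x) fun i => (Z i : ℝ)
    simp only [hZ, hk, hn] at hbase
    rw [hxy] at hm
    rw [hxb, hbase] at hsum
    refine ⟨n - k - m, ?_⟩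
    rify
    linarith

lemma exists_int_liftPairing (hF : IsStandardFrame A B y₀ p) {z z' : E × ℝ}
    {Z Z' : Fin 22 → ℤ} {h h' k k' : ℤ} (hZ : IsCodeVector Z h k) (hZ' : IsCodeVector Z' h' k')
    (hz : ∀ i, liftPairing z (p i, 3) = Z i) (hz' : ∀ i, liftPairing z' (p i, 3) = Z' i)
    (hk : liftPairing z (y₀, 1) = k) (hk' : liftPairing z' (y₀, 1) = k')
    (hh : z.2 = h) (hh' : z'.2 = h') : ∃ n : ℤ, liftPairing z z' = n := by
  obtain ⟨m, hm⟩ := hZ.even_pairing hZ'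
  rify at hm
  refine ⟨m - h * h' - 2 * (k * k') + h * k' + h' * k, ?_⟩
  rw [hF.liftPairing_eq]
  simp only [hz, hz', hk, hk', hh, hh']
  push_cast
  linarith

/-- The isometry matching two frames. -/
lemma exists_isometry (hF : IsStandardFrame A B y₀ p) (hF' : IsStandardFrame A' B' y₀' p') :
    ∃ T : E ≃ₗᵢ[ℝ] E, (∀ d i, ⟪T d, p' i⟫ = ⟪d, p i⟫) ∧ ∀ d, ⟪T d, y₀'⟫ = ⟪d, y₀⟫ := by
  set L : E ≃ₗ[ℝ] E := hF.basis.equiv hF'.basis (Equiv.refl _)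
  have hLp (i) : L (p i) = p' i := by
    rw [← hF.basis_apply, Module.Basis.equiv_apply, Equiv.refl_apply, hF'.basis_apply]
  have hL (d i) : ⟪L d, p' i⟫ = ⟪d, p i⟫ := by
    rw [hF.eq_sum d, map_sum]
    simp only [map_smul, hLp]
    rw [hF.inner_sum_smul, hF'.inner_sum_smul]
  refine ⟨L.isometryOfInner fun d d' => ?_, hL, fun d => ?_⟩
  · rw [hF.inner_eq d d', hF'.inner_eq]
    simp only [hL]
  · change ⟪L d, y₀'⟫ = ⟪d, y₀⟫
    rw [hF.inner_eq d y₀, hF'.inner_eq]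
    simp only [hL, real_inner_comm (p _) y₀, real_inner_comm (p' _) y₀', hF.inner_base,
      hF'.inner_base]

lemma isLiftedPoint_map (h : IsLifted A B) (h' : IsLifted A' B') (hF : IsStandardFrame A B y₀ p)
    (hF' : IsStandardFrame A' B' y₀' p') {T : E ≃ₗᵢ[ℝ] E} (hT : ∀ d i, ⟪T d, p' i⟫ = ⟪d, p i⟫)
    (hT₀ : ∀ d, ⟪T d, y₀'⟫ = ⟪d, y₀⟫) {z : E × ℝ} (hz : IsLiftedPoint A B z) :
    IsLiftedPoint A' B' (T z.1, z.2) := by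
  have height {A B : Finset E} {z : E × ℝ} (hz : IsLiftedPoint A B z) : ∃ n : ℤ, z.2 = n := by
    rcases hz with hz | hz
    · exact ⟨3, by rw [hz.2]; norm_num⟩
    · exact ⟨1, by rw [hz.2]; norm_num⟩
  obtain ⟨n, hn⟩ := height hz
  obtain ⟨Z, k, hZ, hk, hcode⟩ := hF.exists_isCodeVector h (h.hasIntPairings hz) hn
  have hint : HasIntPairings A' B' (T z.1, z.2) := by
    intro z' hz'
    obtain ⟨n', hn'⟩ := height hz'
    obtain ⟨Z', k', hZ', hk', hcode'⟩ := hF'.exists_isCodeVector h' (h'.hasIntPairings hz') hn'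
    refine hF'.exists_int_liftPairing hcode hcode' (fun i => ?_) hZ' ?_ hk' hn hn'
    · rw [← hZ i]
      simp only [liftPairing, hT]
    · rw [← hk]
      simp only [liftPairing, hT₀]
  have h3 : liftPairing (T z.1, z.2) (T z.1, z.2) = 3 := by
    rw [← h.liftPairing_self hz]
    simp only [liftPairing, T.inner_map_map]
  refine (h'.isLiftedPoint_or_neg hint h3).resolve_right fun hneg => ?_
  have hpos {A B : Finset E} {z : E × ℝ} (hz : IsLiftedPoint A B z) : 0 < z.2 := by
    rcases hz with hz | hz <;> rw [hz.2] <;> norm_num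
  exact lt_asymm (hpos hz) (neg_pos.1 (hpos hneg))

end IsStandardFrame

namespace IsLifted

variable {A B A' B' : Finset E}

/-- Lifted designs are unique up to isometry. -/
lemma exists_isometry (h : IsLifted A B) (h' : IsLifted A' B') :
    ∃ T : E ≃ₗᵢ[ℝ] E, A.image T = A' ∧ B.image T = B' := by
  obtain ⟨y₀, p, hF⟩ := h.exists_isStandardFrame
  obtain ⟨y₀', p', hF'⟩ := h'.exists_isStandardFrame
  obtain ⟨T, hT, hT₀⟩ := hF.exists_isometry hF'
  refine ⟨T, Finset.eq_of_subset_of_card_le ?_ ?_, Finset.eq_of_subset_of_card_le ?_ ?_⟩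
  · refine Finset.image_subset_iff.2 fun x hx => ?_
    rcases hF.isLiftedPoint_map h h' hF' hT hT₀ (z := (x, 3)) (Or.inl ⟨hx, rfl⟩) with hz | hz
    · exact hz.1
    · exact absurd hz.2 (by norm_num)
  · rw [Finset.card_image_of_injective _ T.injective, h.card_left, h'.card_left]
  · refine Finset.image_subset_iff.2 fun x hx => ?_
    rcases hF.isLiftedPoint_map h h' hF' hT hT₀ (z := (x, 1)) (Or.inr ⟨hx, rfl⟩) with hz | hz
    · exact absurd hz.2 (by norm_num)
    · exact hz.1
  · rw [Finset.card_image_of_injective _ T.injective, h.card_right, h'.card_right]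

end IsLifted

/-- The designs in question arise from a lifted design by scaling. -/
lemma exists_isLifted_of_card {X₁ X₂ : Finset E} {w : E → ℝ} {r₁ r₂ : ℝ}
    (hr₁ : 0 < r₁) (hr₂ : 0 < r₂) (hrne : r₁ ≠ r₂)
    (hX₁ : ∀ x ∈ X₁, ‖x‖ = r₁) (hX₂ : ∀ x ∈ X₂, ‖x‖ = r₂)
    (hw : ∀ x ∈ X₁ ∪ X₂, 0 < w x) (hcard : (X₁ ∪ X₂).card = 2300)
    (h275 : X₁.card = 275 ∨ X₂.card = 275)
    (hdesign : IsEuclideanDesignTwoSpheres 6 X₁ X₂ w r₁ r₂) :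
    ∃ (A B : Finset E) (ρ ω : ℝ), IsLifted A B ∧ 0 < ρ ∧ 0 < ω ∧
      X₁ ∪ X₂ = (A ∪ B.image ((3 : ℝ) • ·)).image (ρ • ·) ∧
      (∀ x ∈ A, w (ρ • x) = ω) ∧ ∀ x ∈ B, w (ρ • (3 : ℝ) • x) = ω / 729 := by
  wlog h : X₁.card = 275 generalizing X₁ X₂ r₁ r₂
  · rw [Finset.union_comm] at hw hcard ⊢
    refine this hr₂ hr₁ hrne.symm hX₂ hX₁ hw hcard h275.symm (fun f hf => ?_)
      (h275.resolve_left h)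
    rw [add_comm, Finset.union_comm]
    exact hdesign f hf
  obtain ⟨A, B, ρ, ω, hlift, hρ, hω, rfl, rfl, hwA, hwB⟩ :=
    exists_isLifted hr₁ hr₂ hrne hX₁ hX₂ hw hcard h hdesign
  have hsmul (x : E) : (3 * ρ) • x = ρ • (3 : ℝ) • x := by rw [smul_smul, mul_comm]
  refine ⟨A, B, ρ, ω, hlift, hρ, hω, ?_, fun x hx => hwA _ (Finset.mem_image_of_mem _ hx),
    fun x hx => hwB _ (Finset.mem_image.2 ⟨x, hx, hsmul x⟩)⟩
  rw [Finset.image_union, Finset.image_image]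
  simp only [Function.comp_def, hsmul]

end Uniqueness

/-- uniqueness up to a similar transformation fixing the origin. Any two
Euclidean 6-designs in `ℝ²²`, each supported by exactly two concentric spheres of positive
radii centered at the origin, each of total cardinality 2300 and each with 275 points on one
of its two spheres, are related by `x ↦ c • O x` (with `c > 0`, `O` orthogonal), multiplying
the weights by a positive constant `λ`. -/
theorem statement1
    {X₁ X₂ X₁' X₂' : Finset (EuclideanSpace ℝ (Fin 22))}
    {w w' : EuclideanSpace ℝ (Fin 22) → ℝ} {r₁ r₂ r₁' r₂' : ℝ}
    (hr₁ : 0 < r₁) (hr₂ : 0 < r₂) (hrne : r₁ ≠ r₂)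
    (hr₁' : 0 < r₁') (hr₂' : 0 < r₂') (hrne' : r₁' ≠ r₂')
    (hX₁ : ∀ x ∈ X₁, ‖x‖ = r₁) (hX₂ : ∀ x ∈ X₂, ‖x‖ = r₂)
    (hX₁' : ∀ x ∈ X₁', ‖x‖ = r₁') (hX₂' : ∀ x ∈ X₂', ‖x‖ = r₂')
    (hw : ∀ x ∈ X₁ ∪ X₂, 0 < w x) (hw' : ∀ x ∈ X₁' ∪ X₂', 0 < w' x)
    (hcard : (X₁ ∪ X₂).card = 2300) (hcard' : (X₁' ∪ X₂').card = 2300)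
    (h275 : X₁.card = 275 ∨ X₂.card = 275) (h275' : X₁'.card = 275 ∨ X₂'.card = 275)
    (hdesign : IsEuclideanDesignTwoSpheres 6 X₁ X₂ w r₁ r₂)
    (hdesign' : IsEuclideanDesignTwoSpheres 6 X₁' X₂' w' r₁' r₂') :
    ∃ (c : ℝ) (O : EuclideanSpace ℝ (Fin 22) ≃ₗᵢ[ℝ] EuclideanSpace ℝ (Fin 22)) (lam : ℝ),
      0 < c ∧ 0 < lam ∧
      (X₁ ∪ X₂).image (fun x => c • O x) = X₁' ∪ X₂' ∧
      ∀ x ∈ X₁ ∪ X₂, w' (c • O x) = lam * w x := by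
  obtain ⟨A, B, ρ, ω, hL, hρ, hω, hX, hwA, hwB⟩ :=
    exists_isLifted_of_card hr₁ hr₂ hrne hX₁ hX₂ hw hcard h275 hdesign
  obtain ⟨A', B', ρ', ω', hL', hρ', hω', hX', hwA', hwB'⟩ :=
    exists_isLifted_of_card hr₁' hr₂' hrne' hX₁' hX₂' hw' hcard' h275' hdesign'
  obtain ⟨T, rfl, rfl⟩ := hL.exists_isometry hL'
  have hT (x : EuclideanSpace ℝ (Fin 22)) : (ρ' / ρ) • T (ρ • x) = ρ' • T x := by
    rw [map_smul, smul_smul, div_mul_cancel₀ _ hρ.ne']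
  refine ⟨ρ' / ρ, T, ω' / ω, by positivity, by positivity, ?_, ?_⟩
  · rw [hX, hX']
    simp only [Finset.image_union, Finset.image_image, Function.comp_def, hT]
    simp only [map_smul]
  · rw [hX]
    refine Finset.forall_mem_image.2 fun x hx => ?_
    rw [hT]
    rcases Finset.mem_union.1 hx with hx | hx
    · rw [hwA x hx, hwA' _ (Finset.mem_image_of_mem _ hx), div_mul_cancel₀ _ hω.ne']
    · obtain ⟨y, hy, rfl⟩ := Finset.mem_image.1 hx
      rw [map_smul, hwB y hy, hwB' _ (Finset.mem_image_of_mem _ hy)]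
      field_simp
end

section
/- Let (X,w) be a Euclidean 6-design in ℝ^22 supported by exactly two concentric spheres of positive radii r1, r2 centered at the origin, with fibers X1 and X2, |X| = 2300 and |X1| = 275. Then the set A(X1,X1) = { (x·y)/r1² : x, y ∈ X1, x ≠ y } of normalized inner products between distinct points of X1 equals {1/6, −1/4}. -/
open MeasureTheory Metric MvPolynomial
open scoped RealInnerProductSpace Classical

theorem measurePreserving_sphere_map {n : ℕ}
    (e : EuclideanSpace ℝ (Fin n) ≃ₗᵢ[ℝ] EuclideanSpace ℝ (Fin n)) :
    MeasurePreserving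
      (fun u : sphere (0 : EuclideanSpace ℝ (Fin n)) 1 =>
        (⟨e u, by simp⟩ : sphere (0 : EuclideanSpace ℝ (Fin n)) 1))
      (volume : Measure (EuclideanSpace ℝ (Fin n))).toSphere
      (volume : Measure (EuclideanSpace ℝ (Fin n))).toSphere := by
  have hm : Measurable (fun u : sphere (0 : EuclideanSpace ℝ (Fin n)) 1 =>
      (⟨e u, by simp⟩ : sphere (0 : EuclideanSpace ℝ (Fin n)) 1)) :=
    (Continuous.subtype_mk (by fun_prop) _).measurable
  refine ⟨hm, ?_⟩
  ext s hs
  rw [Measure.map_apply hm hs, Measure.toSphere_apply' _ (hm hs), Measure.toSphere_apply' _ hs]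
  congr 1
  conv_rhs => rw [← e.measurePreserving.measure_preimage_emb e.toHomeomorph.measurableEmbedding]
  congr 1
  ext x
  simp only [Set.mem_smul, Set.mem_image, Set.mem_preimage]
  constructor
  · rintro ⟨a, ha, _, ⟨u, hu, rfl⟩, rfl⟩
    exact ⟨a, ha, _, ⟨_, hu, rfl⟩, by simp⟩
  · rintro ⟨a, ha, _, ⟨u, hu, rfl⟩, h⟩
    refine ⟨a, ha, e.symm u, ⟨⟨e.symm u, by simp⟩, by simpa using hu, rfl⟩, ?_⟩
    apply e.injective
    simpa using h

theorem average_sphere_comp {n : ℕ}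
    (e : EuclideanSpace ℝ (Fin n) ≃ₗᵢ[ℝ] EuclideanSpace ℝ (Fin n))
    {g : EuclideanSpace ℝ (Fin n) → ℝ} (hg : Continuous g) :
    ⨍ u : sphere (0 : EuclideanSpace ℝ (Fin n)) 1, g (e u)
        ∂((volume : Measure (EuclideanSpace ℝ (Fin n))).toSphere)
      = ⨍ u : sphere (0 : EuclideanSpace ℝ (Fin n)) 1, g u
        ∂((volume : Measure (EuclideanSpace ℝ (Fin n))).toSphere) := by
  have he := measurePreserving_sphere_map e
  rw [average_eq, average_eq]
  congr 1
  nth_rewrite 2 [← he.map_eq]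
  rw [integral_map he.measurable.aemeasurable
    (by fun_prop : Continuous fun u : sphere (0 : EuclideanSpace ℝ (Fin n)) 1 =>
      g u).aestronglyMeasurable]

theorem integrable_sphere_of_continuous {n : ℕ} {g : EuclideanSpace ℝ (Fin n) → ℝ}
    (hg : Continuous g) :
    Integrable (fun u : sphere (0 : EuclideanSpace ℝ (Fin n)) 1 => g u)
      (volume : Measure (EuclideanSpace ℝ (Fin n))).toSphere :=
  (by fun_prop : Continuous fun u : sphere (0 : EuclideanSpace ℝ (Fin n)) 1 =>
      g u).integrable_of_hasCompactSupport (HasCompactSupport.of_compactSpace _)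

/-- The average of a function over the unit sphere of `ℝⁿ`, as a linear functional on
continuous functions of the ambient space. -/
noncomputable def unitSphereAverage (n : ℕ) : C(EuclideanSpace ℝ (Fin n), ℝ) →ₗ[ℝ] ℝ where
  toFun g := ⨍ u : sphere (0 : EuclideanSpace ℝ (Fin n)) 1, g u
    ∂((volume : Measure (EuclideanSpace ℝ (Fin n))).toSphere)
  map_add' g h := by
    simp only [average_eq, ContinuousMap.add_apply]
    rw [integral_add (integrable_sphere_of_continuous g.continuous)
      (integrable_sphere_of_continuous h.continuous), smul_add]
  map_smul' a g := by
    simp only [average_eq, ContinuousMap.smul_apply, integral_smul, RingHom.id_apply]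
    rw [smul_comm]

theorem unitSphereAverage_congr {n : ℕ} {g h : C(EuclideanSpace ℝ (Fin n), ℝ)}
    (hgh : ∀ u, ‖u‖ = 1 → g u = h u) : unitSphereAverage n g = unitSphereAverage n h := by
  change average _ _ = average _ _
  congr 1
  ext u
  exact hgh u (by simp)

theorem unitSphereAverage_comp {n : ℕ}
    (e : EuclideanSpace ℝ (Fin n) ≃ₗᵢ[ℝ] EuclideanSpace ℝ (Fin n))
    {g h : C(EuclideanSpace ℝ (Fin n), ℝ)} (hgh : ∀ u, h u = g (e u)) :
    unitSphereAverage n h = unitSphereAverage n g := by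
  refine Eq.trans ?_ (average_sphere_comp e g.continuous)
  change average _ _ = average _ _
  simp [hgh]

theorem unitSphereAverage_one {n : ℕ} [NeZero n] : unitSphereAverage n 1 = 1 := by
  have : Nontrivial (EuclideanSpace ℝ (Fin n)) := by
    apply Module.nontrivial_of_finrank_pos (R := ℝ)
    simpa using Nat.pos_of_neZero n
  have : NeZero ((volume : Measure (EuclideanSpace ℝ (Fin n))).toSphere) :=
    ⟨Measure.toSphere_ne_zero _⟩
  exact average_const _ (1 : ℝ)

/-- The linear form `u ↦ ⟪x, u⟫` as a continuous map. -/
noncomputable def innerForm {n : ℕ} (x : EuclideanSpace ℝ (Fin n)) :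
    C(EuclideanSpace ℝ (Fin n), ℝ) := ⟨fun u => ⟪x, u⟫, by fun_prop⟩

@[simp]
theorem innerForm_apply {n : ℕ} (x u : EuclideanSpace ℝ (Fin n)) : innerForm x u = ⟪x, u⟫ := rfl

theorem innerForm_smul {n : ℕ} (a : ℝ) (x : EuclideanSpace ℝ (Fin n)) :
    innerForm (a • x) = a • innerForm x := by
  ext u; simp [inner_smul_left]

theorem unitSphereAverage_innerForm_pow_of_odd {n k : ℕ} (hk : Odd k)
    (x : EuclideanSpace ℝ (Fin n)) : unitSphereAverage n (innerForm x ^ k) = 0 := by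
  have h := unitSphereAverage_comp (LinearIsometryEquiv.neg ℝ) (g := innerForm x ^ k)
    (h := -innerForm x ^ k) (by intro u; simp [hk.neg_pow])
  rw [map_neg] at h
  linarith

theorem unitSphereAverage_innerForm_pow_congr {n : ℕ} (k : ℕ)
    {x y : EuclideanSpace ℝ (Fin n)} (h : ‖x‖ = ‖y‖) :
    unitSphereAverage n (innerForm x ^ k) = unitSphereAverage n (innerForm y ^ k) := by
  refine unitSphereAverage_comp (Submodule.reflection (ℝ ∙ (x - y))ᗮ) fun u => ?_
  have h1 := Submodule.reflection_sub h
  have h2 := (Submodule.reflection (ℝ ∙ (x - y))ᗮ).inner_map_map x u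
  rw [h1] at h2
  simp [h2]

theorem exists_unitSphereAverage_innerForm_pow (n k : ℕ) [NeZero n] :
    ∃ c : ℝ, ∀ x : EuclideanSpace ℝ (Fin n),
      unitSphereAverage n (innerForm x ^ k) = c * ‖x‖ ^ k := by
  let e : EuclideanSpace ℝ (Fin n) := EuclideanSpace.single 0 1
  have he : ‖e‖ = 1 := by simp [e]
  refine ⟨unitSphereAverage n (innerForm e ^ k), fun x => ?_⟩
  have h : ‖x‖ = ‖‖x‖ • e‖ := by simp [norm_smul, he]
  rw [unitSphereAverage_innerForm_pow_congr k h, innerForm_smul, smul_pow, map_smul, smul_eq_mul,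
    mul_comm]

theorem sum_innerForm_single_sq_apply {n : ℕ} {u : EuclideanSpace ℝ (Fin n)} (hu : ‖u‖ = 1) :
    ∑ i, ⟪EuclideanSpace.single i (1 : ℝ), u⟫ ^ 2 = 1 := by
  have := EuclideanSpace.real_norm_sq_eq u
  rw [hu] at this
  simp [EuclideanSpace.inner_single_left, ← this]

theorem unitSphereAverage_innerForm_sq {n : ℕ} [NeZero n] (x : EuclideanSpace ℝ (Fin n)) :
    unitSphereAverage n (innerForm x ^ 2) = ‖x‖ ^ 2 / n := by
  obtain ⟨c, hc⟩ := exists_unitSphereAverage_innerForm_pow n 2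
  have h : unitSphereAverage n
      (∑ i, innerForm (EuclideanSpace.single i (1 : ℝ)) ^ 2) = 1 := by
    refine (unitSphereAverage_congr fun u hu => ?_).trans unitSphereAverage_one
    simpa using sum_innerForm_single_sq_apply hu
  simp only [map_sum, hc] at h
  have hn : (n : ℝ) ≠ 0 := NeZero.ne _
  simp at h
  rw [hc]
  field_simp
  linear_combination ‖x‖ ^ 2 * h

theorem unitSphereAverage_innerForm_pow_four {n : ℕ} [NeZero n] (x : EuclideanSpace ℝ (Fin n)) :
    unitSphereAverage n (innerForm x ^ 4) = 3 * ‖x‖ ^ 4 / (n * (n + 2)) := by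
  obtain ⟨c, hc⟩ := exists_unitSphereAverage_innerForm_pow n 4
  have polar (x y : EuclideanSpace ℝ (Fin n)) :
      unitSphereAverage n (innerForm x ^ 2 * innerForm y ^ 2)
        = c / 3 * (‖x‖ ^ 2 * ‖y‖ ^ 2 + 2 * ⟪x, y⟫ ^ 2) := by
    have h : innerForm (x + y) ^ 4 + innerForm (x - y) ^ 4
        = (2 : ℝ) • innerForm x ^ 4 + (12 : ℝ) • (innerForm x ^ 2 * innerForm y ^ 2)
          + (2 : ℝ) • innerForm y ^ 4 := by
      ext u
      simp [inner_add_left, inner_sub_left]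
      ring
    have h' := congrArg (unitSphereAverage n) h
    simp only [map_add, map_smul, hc, smul_eq_mul] at h'
    have h1 := norm_add_sq_real x y
    have h2 := norm_sub_sq_real x y
    have h3 : ‖x + y‖ ^ 4 = (‖x‖ ^ 2 + 2 * ⟪x, y⟫ + ‖y‖ ^ 2) ^ 2 := by rw [← h1]; ring
    have h4 : ‖x - y‖ ^ 4 = (‖x‖ ^ 2 - 2 * ⟪x, y⟫ + ‖y‖ ^ 2) ^ 2 := by rw [← h2]; ring
    rw [h3, h4] at h'
    linear_combination -h' / 12
  have h : unitSphereAverage n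
      (∑ i, ∑ j, innerForm (EuclideanSpace.single i (1 : ℝ)) ^ 2 *
        innerForm (EuclideanSpace.single j (1 : ℝ)) ^ 2) = 1 := by
    refine (unitSphereAverage_congr fun u hu => ?_).trans unitSphereAverage_one
    have := sum_innerForm_single_sq_apply hu
    simp only [ContinuousMap.sum_apply, ContinuousMap.mul_apply, ContinuousMap.pow_apply,
      innerForm_apply, ContinuousMap.one_apply, ← Finset.mul_sum, ← Finset.sum_mul, this, mul_one]
  simp only [map_sum, polar] at h
  have hn : (n : ℝ) ≠ 0 := NeZero.ne _
  simp [← Finset.mul_sum, Finset.sum_add_distrib,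
    EuclideanSpace.inner_single_left] at h
  rw [hc]
  field_simp
  linear_combination 3 * ‖x‖ ^ 4 * h

/-- The linear form `u ↦ ⟪x, u⟫` as a polynomial. -/
noncomputable def innerPoly {n : ℕ} (x : EuclideanSpace ℝ (Fin n)) : MvPolynomial (Fin n) ℝ :=
  ∑ i, C (x i) * X i

theorem eval_innerPoly {n : ℕ} (x y : EuclideanSpace ℝ (Fin n)) :
    eval (y : Fin n → ℝ) (innerPoly x) = ⟪x, y⟫ := by
  simp [innerPoly, PiLp.inner_apply, mul_comm]

theorem eval_smul_innerPoly {n : ℕ} (r : ℝ) (x y : EuclideanSpace ℝ (Fin n)) :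
    eval (fun i => r * y i) (innerPoly x) = r * ⟪x, y⟫ := by
  exact (eval_innerPoly x (r • y)).trans (inner_smul_right x y r)

theorem totalDegree_innerPoly_le {n : ℕ} (x : EuclideanSpace ℝ (Fin n)) :
    (innerPoly x).totalDegree ≤ 1 :=
  totalDegree_finsetSum_le fun i _ => (totalDegree_mul _ _).trans (by simp)

theorem sphereAvg_eq_unitSphereAverage {n : ℕ} {r : ℝ} {f : MvPolynomial (Fin n) ℝ}
    {g : C(EuclideanSpace ℝ (Fin n), ℝ)}
    (h : ∀ u : EuclideanSpace ℝ (Fin n), ‖u‖ = 1 → eval (fun i => r * u i) f = g u) :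
    sphereAvg n r f = unitSphereAverage n g := by
  change average _ _ = average _ _
  congr 1
  ext u
  exact h u (by simp)

/-- The polynomial `|x|² - s²`. -/
noncomputable def sphereEquation (n : ℕ) (s : ℝ) : MvPolynomial (Fin n) ℝ :=
  ∑ i, X i ^ 2 - C (s ^ 2)

theorem totalDegree_sphereEquation_le (n : ℕ) (s : ℝ) :
    (sphereEquation n s).totalDegree ≤ 2 :=
  (totalDegree_sub _ _).trans (max_le (totalDegree_finsetSum_le fun i _ => by simp)
    ((totalDegree_C _).trans_le zero_le_two))

theorem eval_sphereEquation {n : ℕ} (s : ℝ) (x : EuclideanSpace ℝ (Fin n)) :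
    eval (x : Fin n → ℝ) (sphereEquation n s) = ‖x‖ ^ 2 - s ^ 2 := by
  simp [sphereEquation, EuclideanSpace.real_norm_sq_eq]

theorem sphereAvg_sphereEquation_mul {n : ℕ} (r s : ℝ) (f : MvPolynomial (Fin n) ℝ) :
    sphereAvg n r (sphereEquation n s * f) = (r ^ 2 - s ^ 2) * sphereAvg n r f := by
  have h (u : sphere (0 : EuclideanSpace ℝ (Fin n)) 1) :
      eval (fun i => r * (u : EuclideanSpace ℝ (Fin n)) i) (sphereEquation n s)
        = r ^ 2 - s ^ 2 := by
    have := eval_sphereEquation s (r • (u : EuclideanSpace ℝ (Fin n)))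
    rw [norm_smul, norm_eq_of_mem_sphere, mul_one, Real.norm_eq_abs, sq_abs] at this
    exact this
  simp only [sphereAvg, average_eq, eval_mul, h, integral_const_mul, smul_eq_mul]
  ring

/-- The first fiber of a Euclidean `(t + 2)`-design on two spheres is a weighted spherical
`t`-design. -/
theorem IsEuclideanDesignTwoSpheres.sum_fiber {t : ℕ}
    {X₁ X₂ : Finset (EuclideanSpace ℝ (Fin 22))} {w : EuclideanSpace ℝ (Fin 22) → ℝ}
    {r₁ r₂ : ℝ} (hdesign : IsEuclideanDesignTwoSpheres (t + 2) X₁ X₂ w r₁ r₂)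
    (hr₁ : 0 < r₁) (hr₂ : 0 < r₂) (hrne : r₁ ≠ r₂)
    (hX₁ : ∀ x ∈ X₁, ‖x‖ = r₁) (hX₂ : ∀ x ∈ X₂, ‖x‖ = r₂)
    {f : MvPolynomial (Fin 22) ℝ} (hf : f.totalDegree ≤ t) :
    ∑ x ∈ X₁, w x * eval (x : Fin 22 → ℝ) f = (∑ x ∈ X₁, w x) * sphereAvg 22 r₁ f := by
  have hdeg : (sphereEquation 22 r₂ * f).totalDegree ≤ t + 2 := by
    have := totalDegree_mul (sphereEquation 22 r₂) f
    have := totalDegree_sphereEquation_le 22 r₂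
    omega
  have hdisj : Disjoint X₁ X₂ := by
    rw [Finset.disjoint_left]
    intro x h₁ h₂
    exact hrne ((hX₁ x h₁).symm.trans (hX₂ x h₂))
  have h := hdesign _ hdeg
  have hs₁ : ∑ x ∈ X₁, w x * eval (x : Fin 22 → ℝ) (sphereEquation 22 r₂ * f)
      = (r₁ ^ 2 - r₂ ^ 2) * ∑ x ∈ X₁, w x * eval (x : Fin 22 → ℝ) f := by
    rw [Finset.mul_sum]
    refine Finset.sum_congr rfl fun x hx => ?_
    rw [eval_mul, eval_sphereEquation, hX₁ x hx]
    ring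
  have hs₂ : ∑ x ∈ X₂, w x * eval (x : Fin 22 → ℝ) (sphereEquation 22 r₂ * f) = 0 := by
    refine Finset.sum_eq_zero fun x hx => ?_
    rw [eval_mul, eval_sphereEquation, hX₂ x hx]
    ring
  rw [Finset.sum_union hdisj, hs₁, hs₂, sphereAvg_sphereEquation_mul,
    sphereAvg_sphereEquation_mul] at h
  have hne : r₁ ^ 2 - r₂ ^ 2 ≠ 0 := by
    rw [sub_ne_zero]
    exact fun h => hrne ((sq_eq_sq₀ hr₁.le hr₂.le).1 h)
  apply mul_left_cancel₀ hne
  linear_combination -h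

/-- The degree-two reproducing kernel of the sphere of radius `r` in `ℝ²²`, up to scaling, with
one argument fixed. -/
noncomputable def kernelPoly (r : ℝ) (x : EuclideanSpace ℝ (Fin 22)) : MvPolynomial (Fin 22) ℝ :=
  C 24 * innerPoly x ^ 2 + (C (2 * r ^ 2) * innerPoly x - C (r ^ 4))

theorem totalDegree_kernelPoly_le (r : ℝ) (x : EuclideanSpace ℝ (Fin 22)) :
    (kernelPoly r x).totalDegree ≤ 2 := by
  have h := totalDegree_innerPoly_le x
  refine (totalDegree_add _ _).trans (max_le ?_ ((totalDegree_sub _ _).trans (max_le ?_ ?_)))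
  · have h₁ := totalDegree_mul (C 24) (innerPoly x ^ 2)
    have h₂ := totalDegree_pow (innerPoly x) 2
    rw [totalDegree_C] at h₁
    omega
  · have h₁ := totalDegree_mul (C (2 * r ^ 2)) (innerPoly x)
    rw [totalDegree_C] at h₁
    omega
  · exact (totalDegree_C _).trans_le zero_le_two

theorem eval_kernelPoly (r : ℝ) (x y : EuclideanSpace ℝ (Fin 22)) :
    eval (y : Fin 22 → ℝ) (kernelPoly r x)
      = 24 * ⟪x, y⟫ ^ 2 + (2 * r ^ 2 * ⟪x, y⟫ - r ^ 4) := by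
  simp [kernelPoly, eval_innerPoly]

theorem sphereAvg_kernelPoly_sq {r : ℝ} {x : EuclideanSpace ℝ (Fin 22)} (hx : ‖x‖ = r) :
    sphereAvg 22 r (kernelPoly r x ^ 2) = 25 / 11 * r ^ 8 := by
  have h : sphereAvg 22 r (kernelPoly r x ^ 2) = unitSphereAverage 22
      ((576 * r ^ 4) • innerForm x ^ 4 + (96 * r ^ 5) • innerForm x ^ 3
        - (44 * r ^ 6) • innerForm x ^ 2 - (4 * r ^ 7) • innerForm x ^ 1 + r ^ 8 • 1) := by
    refine sphereAvg_eq_unitSphereAverage fun u _ => ?_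
    simp [kernelPoly, eval_smul_innerPoly]
    ring
  rw [h]
  simp only [map_add, map_sub, map_smul, unitSphereAverage_innerForm_pow_four,
    unitSphereAverage_innerForm_sq, unitSphereAverage_one, hx, smul_eq_mul,
    unitSphereAverage_innerForm_pow_of_odd (by decide : Odd 3),
    unitSphereAverage_innerForm_pow_of_odd (by decide : Odd 1)]
  norm_num
  ring

theorem sphereAvg_innerPoly {n : ℕ} (r : ℝ) (x : EuclideanSpace ℝ (Fin n)) :
    sphereAvg n r (innerPoly x) = 0 := by
  rw [sphereAvg_eq_unitSphereAverage (g := r • innerForm x ^ 1), map_smul,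
    unitSphereAverage_innerForm_pow_of_odd odd_one, smul_zero]
  intro u _
  simp [eval_smul_innerPoly]

/-- the normalized inner products between distinct points of the fiber `X₁`
form the set `{1/6, -1/4}`. -/
theorem statement2
    {X₁ X₂ : Finset (EuclideanSpace ℝ (Fin 22))} {w : EuclideanSpace ℝ (Fin 22) → ℝ}
    {r₁ r₂ : ℝ} (hr₁ : 0 < r₁) (hr₂ : 0 < r₂) (hrne : r₁ ≠ r₂)
    (hX₁ : ∀ x ∈ X₁, ‖x‖ = r₁) (hX₂ : ∀ x ∈ X₂, ‖x‖ = r₂)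
    (hw : ∀ x ∈ X₁ ∪ X₂, 0 < w x)
    (hcard : (X₁ ∪ X₂).card = 2300) (hcard₁ : X₁.card = 275)
    (hdesign : IsEuclideanDesignTwoSpheres 6 X₁ X₂ w r₁ r₂) :
    {a : ℝ | ∃ x ∈ X₁, ∃ y ∈ X₁, x ≠ y ∧ ⟪x, y⟫ / (r₁ * r₁) = a}
      = {1 / 6, -(1 / 4)} := by
  have hw₁ : ∀ x ∈ X₁, 0 < w x := fun x hx => hw x (Finset.mem_union_left _ hx)
  set W := ∑ x ∈ X₁, w x with hW
  have fiber {f : MvPolynomial (Fin 22) ℝ} (hf : f.totalDegree ≤ 4) :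
      ∑ x ∈ X₁, w x * eval (x : Fin 22 → ℝ) f = W * sphereAvg 22 r₁ f :=
    hdesign.sum_fiber (t := 4) hr₁ hr₂ hrne hX₁ hX₂ hf
  have inner_self {x} (hx : x ∈ X₁) : ⟪x, x⟫ = r₁ ^ 2 := by
    rw [real_inner_self_eq_norm_sq, hX₁ x hx]
  have kernel_sum {x} (hx : x ∈ X₁) :
      w x * (25 * r₁ ^ 4) ^ 2
        + ∑ y ∈ X₁.erase x, w y * (24 * ⟪x, y⟫ ^ 2 + (2 * r₁ ^ 2 * ⟪x, y⟫ - r₁ ^ 4)) ^ 2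
        = W * (25 / 11 * r₁ ^ 8) := by
    have hdeg : (kernelPoly r₁ x ^ 2).totalDegree ≤ 4 := by
      have h₁ := totalDegree_pow (kernelPoly r₁ x) 2
      have h₂ := totalDegree_kernelPoly_le r₁ x
      omega
    have h := fiber hdeg
    rw [sphereAvg_kernelPoly_sq (hX₁ x hx), ← Finset.add_sum_erase _ _ hx] at h
    simp only [eval_pow, eval_kernelPoly, inner_self hx] at h
    rw [← h]
    ring
  have hr8 : 0 < r₁ ^ 8 := by positivity
  have weight_le : ∀ x ∈ X₁, w x ≤ W / 275 := by
    intro x hx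
    have h₀ : 0 ≤ ∑ y ∈ X₁.erase x,
        w y * (24 * ⟪x, y⟫ ^ 2 + (2 * r₁ ^ 2 * ⟪x, y⟫ - r₁ ^ 4)) ^ 2 :=
      Finset.sum_nonneg fun y hy =>
        mul_nonneg (hw₁ y (Finset.mem_of_mem_erase hy)).le (sq_nonneg _)
    have h := kernel_sum hx
    have h' : r₁ ^ 8 * w x ≤ r₁ ^ 8 * (W / 275) := by linarith
    exact le_of_mul_le_mul_left h' hr8
  have weight_eq : ∀ x ∈ X₁, w x = W / 275 :=
    (Finset.sum_eq_sum_iff_of_le weight_le).1 (by simp [hcard₁, ← hW]; ring)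
  have two_distance : ∀ x ∈ X₁, ∀ y ∈ X₁, x ≠ y →
      ⟪x, y⟫ = r₁ ^ 2 / 6 ∨ ⟪x, y⟫ = -(r₁ ^ 2 / 4) := by
    intro x hx y hy hxy
    have h₀ : ∑ y ∈ X₁.erase x,
        w y * (24 * ⟪x, y⟫ ^ 2 + (2 * r₁ ^ 2 * ⟪x, y⟫ - r₁ ^ 4)) ^ 2 = 0 := by
      have h := kernel_sum hx
      rw [weight_eq x hx] at h
      linear_combination h
    have hy' : y ∈ X₁.erase x := Finset.mem_erase.2 ⟨hxy.symm, hy⟩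
    have h := (Finset.sum_eq_zero_iff_of_nonneg fun y hy =>
      mul_nonneg (hw₁ y (Finset.mem_of_mem_erase hy)).le (sq_nonneg _)).1 h₀ y hy'
    have h' := eq_zero_of_pow_eq_zero ((mul_eq_zero.1 h).resolve_left (hw₁ y hy).ne')
    have hprod : (⟪x, y⟫ - r₁ ^ 2 / 6) * (⟪x, y⟫ + r₁ ^ 2 / 4) = 0 := by
      linear_combination h' / 24
    rcases mul_eq_zero.1 hprod with h | h
    · left; linarith
    · right; linarith
  obtain ⟨x, hx⟩ : X₁.Nonempty := Finset.card_pos.1 (by omega)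
  have hWpos : 0 < W / 275 := weight_eq x hx ▸ hw₁ x hx
  have balanced : ∑ y ∈ X₁.erase x, ⟪x, y⟫ = -r₁ ^ 2 := by
    have h := fiber ((totalDegree_innerPoly_le x).trans (by norm_num))
    rw [sphereAvg_innerPoly, mul_zero] at h
    simp only [eval_innerPoly] at h
    rw [Finset.sum_congr rfl fun y hy => by rw [weight_eq y hy], ← Finset.mul_sum,
      ← Finset.add_sum_erase _ _ hx, inner_self hx] at h
    linarith [(mul_eq_zero.1 h).resolve_left hWpos.ne']
  have hcard_erase : (X₁.erase x).card = 274 := by rw [Finset.card_erase_of_mem hx, hcard₁]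
  have exists_inner_ne {a : ℝ} (ha : 274 * a ≠ -r₁ ^ 2) : ∃ y ∈ X₁, x ≠ y ∧ ⟪x, y⟫ ≠ a := by
    by_contra! hcon
    apply ha
    rw [← balanced, Finset.sum_congr rfl fun y hy =>
      hcon y (Finset.mem_of_mem_erase hy) (Finset.ne_of_mem_erase hy).symm]
    simp [hcard_erase]
  have hr2 : 0 < r₁ ^ 2 := by positivity
  ext a
  simp only [Set.mem_ofPred_eq, Set.mem_insert_iff, Set.mem_singleton_iff]
  constructor
  · rintro ⟨x, hx, y, hy, hxy, rfl⟩
    rcases two_distance x hx y hy hxy with h | h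
    · left; rw [h]; field_simp
    · right; rw [h]; field_simp
  · rintro (rfl | rfl)
    · obtain ⟨y, hy, hxy, hne⟩ := exists_inner_ne (a := -(r₁ ^ 2 / 4)) (by intro h; linarith)
      refine ⟨x, hx, y, hy, hxy, ?_⟩
      rw [(two_distance x hx y hy hxy).resolve_right hne]
      field_simp
    · obtain ⟨y, hy, hxy, hne⟩ := exists_inner_ne (a := r₁ ^ 2 / 6) (by intro h; linarith)
      refine ⟨x, hx, y, hy, hxy, ?_⟩
      rw [(two_distance x hx y hy hxy).resolve_left hne]
      field_simp
end
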